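/- arXiv:1401.0664 — 2 statements merged into one kernel-verified Lean document; each statement's English description precedes it below -/
import Mathlib

section
/- Let λ, μ, ν be weakly decreasing sequences of n real numbers. There exist complex Hermitian n×n matrices A and B with ordered spectra λ and μ respectively such that A + B has ordered spectrum ν, if and only if there exist real symmetric n×n matrices A' and B' with ordered spectra λ and μ respectively such that A' + B' has ordered spectrum ν. -/
open Polynomial in
/-- `μ` (weakly decreasing) is the ordered spectrum of the real matrix `A`:
the characteristic polynomial of `A` is `∏ i (X - μ i)`, i.e. the `μ i` are the
eigenvalues of `A` with multiplicity, listed in weakly decreasing order. -/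
def HasOrdSpecR {n : ℕ} (A : Matrix (Fin n) (Fin n) ℝ) (μ : Fin n → ℝ) : Prop :=
  Antitone μ ∧ A.charpoly = ∏ i, (X - C (μ i))

open Polynomial in
/-- `μ` (weakly decreasing, real) is the ordered spectrum of the complex matrix `A`. -/
def HasOrdSpecC {n : ℕ} (A : Matrix (Fin n) (Fin n) ℂ) (μ : Fin n → ℝ) : Prop :=
  Antitone μ ∧ A.charpoly = ∏ i, (X - C ((μ i : ℂ)))

/-- For `σ = (σ₁ ≥ … ≥ σ_{2p})`, `sminusR σ = σ₋ = (σ₁, σ₃, …, σ_{2p-1})`. -/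
def sminusR {p : ℕ} (σ : Fin (2 * p) → ℝ) : Fin p → ℝ :=
  fun i => σ ⟨2 * i.1, by have := i.2; omega⟩

/-- For `σ = (σ₁ ≥ … ≥ σ_{2p})`, `splusR σ = σ₊ = (σ₂, σ₄, …, σ_{2p})`. -/
def splusR {p : ℕ} (σ : Fin (2 * p) → ℝ) : Fin p → ℝ :=
  fun i => σ ⟨2 * i.1 + 1, by have := i.2; omega⟩

/-- For `ν = (ν₁ ≥ … ≥ ν_p)`, `dupR ν = ν⁽²⁾ = (ν₁, ν₁, ν₂, ν₂, …, ν_p, ν_p)`. -/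
def dupR {p : ℕ} (ν : Fin p → ℝ) : Fin (2 * p) → ℝ :=
  fun i => ν ⟨i.1 / 2, by have := i.2; omega⟩

open Matrix

theorem hm_perm {n : ℕ} {α : Type*} (f g : Fin n → α)
    (h : Multiset.map f Finset.univ.val = Multiset.map g Finset.univ.val) :
    ∃ σ : Equiv.Perm (Fin n), f = g ∘ σ := by
  classical
  have h1 : ∀ a, Nonempty ({i // f i = a} ≃ {i // g i = a}) := by
    intro a
    rw [← Fintype.card_eq]
    have := congrArg (Multiset.count a) h
    rw [Multiset.count_map, Multiset.count_map] at this
    rw [Fintype.card_subtype, Fintype.card_subtype]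
    simp only [Finset.card, Finset.filter_val]
    convert this using 3 <;> simp [eq_comm]
  have e := fun a => (h1 a).some
  refine ⟨((Equiv.sigmaFiberEquiv f).symm.trans (Equiv.sigmaCongrRight e)).trans
    (Equiv.sigmaFiberEquiv g), ?_⟩
  ext i
  have := (e (f i) ⟨i, rfl⟩).2
  exact this.symm

/-- spectral theorem with prescribed diagonal -/
theorem hm_diag {n : ℕ} (A : Matrix (Fin n) (Fin n) ℂ) (hA : A.IsHermitian) (l : Fin n → ℝ)
    (h : A.charpoly = ∏ i, (Polynomial.X - Polynomial.C ((l i : ℂ)))) :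
    ∃ U : Matrix (Fin n) (Fin n) ℂ, Uᴴ * U = 1 ∧ A = U * diagonal (fun i => (l i : ℂ)) * Uᴴ := by
  have h1 := hA.roots_charpoly_eq_eigenvalues
  have h2 : A.charpoly.roots = Multiset.map (fun i => (l i : ℂ)) Finset.univ.val := by
    rw [h]
    have := Polynomial.roots_multiset_prod_X_sub_C (Multiset.map (fun i => (l i : ℂ)) Finset.univ.val)
    rwa [Multiset.map_map] at this
  rw [h2] at h1
  obtain ⟨σ, hσ⟩ := hm_perm _ _ h1
  have hs := hA.spectral_theorem
  set V := hA.eigenvectorUnitary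
  have hV : V.1ᴴ * V.1 = 1 := by
    have := V.2
    rwa [Matrix.mem_unitaryGroup_iff'] at this
  refine ⟨V.1.submatrix id σ, ?_, ?_⟩
  · rw [conjTranspose_submatrix, ← submatrix_mul _ _ _ _ _ Function.bijective_id, hV]
    simp
  · rw [Unitary.conjStarAlgAut_apply] at hs
    rw [hσ]
    conv_lhs => rw [hs]
    have : diagonal ((RCLike.ofReal ∘ hA.eigenvalues) ∘ σ : Fin n → ℂ) = (diagonal (RCLike.ofReal ∘ hA.eigenvalues : Fin n → ℂ)).submatrix σ σ := by
      ext i j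
      simp [diagonal_apply]
    rw [this, conjTranspose_submatrix, submatrix_mul_equiv, submatrix_mul_equiv]
    simp [star_eq_conjTranspose]

theorem hm_basis {n : ℕ} (S T : EuclideanSpace ℝ (Fin n) →ₗ[ℝ] EuclideanSpace ℝ (Fin n))
    (hS : S.IsSymmetric) (hT : T.IsSymmetric) (hST : ∀ v, S (T v) = T (S v)) :
    ∃ C : OrthonormalBasis (Fin n) ℝ (EuclideanSpace ℝ (Fin n)),
      ∀ i, (∃ a : ℝ, S (C i) = a • C i) ∧ (∃ a : ℝ, T (C i) = a • C i) := by
  classical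
  have inv : ∀ μ : Module.End.Eigenvalues S, ∀ v ∈ Module.End.eigenspace S (μ : ℝ),
      T v ∈ Module.End.eigenspace S (μ : ℝ) := by
    intro μ v hv
    rw [Module.End.mem_eigenspace_iff] at hv ⊢
    rw [hST, hv, map_smul]
  have hr := fun μ => hT.restrict_invariant (inv μ)
  obtain ⟨bb, hbb⟩ : ∃ bb : (μ : Module.End.Eigenvalues S) →
      OrthonormalBasis (Fin (Module.finrank ℝ (Module.End.eigenspace S (μ : ℝ)))) ℝ
        (Module.End.eigenspace S (μ : ℝ)),
      ∀ μ i, ∃ a : ℝ, T (bb μ i : EuclideanSpace ℝ (Fin n)) = a • (bb μ i : EuclideanSpace ℝ (Fin n)) := by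
    refine ⟨fun μ => (hr μ).eigenvectorBasis rfl, fun μ i => ⟨(hr μ).eigenvalues rfl i, ?_⟩⟩
    exact congrArg Subtype.val ((hr μ).apply_eigenvectorBasis rfl i)
  let B := DirectSum.IsInternal.collectedOrthonormalBasis hS.orthogonalFamily_eigenspaces'
    hS.direct_sum_isInternal bb
  have hcard : Fintype.card ((μ : Module.End.Eigenvalues S) ×
      Fin (Module.finrank ℝ (Module.End.eigenspace S (μ : ℝ)))) = Fintype.card (Fin n) := by
    have := Module.finrank_eq_card_basis B.toBasis
    rw [← this]; simp
  have hB : ∀ i, (∃ a : ℝ, S (B i) = a • B i) ∧ (∃ a : ℝ, T (B i) = a • B i) := by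
    rintro ⟨μ, i⟩
    constructor
    · refine ⟨(μ : ℝ), ?_⟩
      have := DirectSum.IsInternal.collectedOrthonormalBasis_mem hS.direct_sum_isInternal
        hS.orthogonalFamily_eigenspaces' bb ⟨μ, i⟩
      exact Module.End.mem_eigenspace_iff.1 this
    · have hh : B ⟨μ, i⟩ = (bb μ i : EuclideanSpace ℝ (Fin n)) := by
        simp [B, DirectSum.IsInternal.collectedOrthonormalBasis]
      rw [hh]
      exact hbb μ i
  refine ⟨B.reindex (Fintype.equivOfCardEq hcard), fun i => ?_⟩
  rw [OrthonormalBasis.reindex_apply]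
  exact hB _

/-- joint diagonalization of commuting real symmetric matrices -/
theorem hm_joint {n : ℕ} (A E : Matrix (Fin n) (Fin n) ℝ) (hA : Aᵀ = A) (hE : Eᵀ = E)
    (hc : A * E = E * A) : ∃ (O : Matrix (Fin n) (Fin n) ℝ) (a e : Fin n → ℝ),
    Oᵀ * O = 1 ∧ O * Oᵀ = 1 ∧ Monotone a ∧ A = O * diagonal a * Oᵀ ∧ E = O * diagonal e * Oᵀ := by
  classical
  have hA' : (toEuclideanLin A).IsSymmetric := isSymmetric_toEuclideanLin_iff.2 (by
    rw [IsHermitian, conjTranspose_eq_transpose_of_trivial, hA])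
  have hE' : (toEuclideanLin E).IsSymmetric := isSymmetric_toEuclideanLin_iff.2 (by
    rw [IsHermitian, conjTranspose_eq_transpose_of_trivial, hE])
  set S := toEuclideanLin A
  set T := toEuclideanLin E
  have hST : ∀ v, S (T v) = T (S v) := by
    intro v
    ext i
    simp [S, T, toLpLin_apply, hc]
  obtain ⟨C, hC⟩ := hm_basis S T hA' hE' hST
  choose a ha using fun i => (hC i).1
  choose e he using fun i => (hC i).2
  let O : Matrix (Fin n) (Fin n) ℝ := of fun i j => C j i
  have hO : Oᵀ * O = 1 := by
    ext i j
    have := C.orthonormal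
    rw [orthonormal_iff_ite] at this
    have := this i j
    simp only [PiLp.inner_apply, RCLike.inner_apply, conj_trivial] at this
    simp only [O, mul_apply, one_apply, transpose_apply, of_apply, ← this]
    exact Finset.sum_congr rfl fun _ _ => mul_comm _ _
  have hO2 : O * Oᵀ = 1 := mul_eq_one_comm.1 hO
  have key : ∀ (M : Matrix (Fin n) (Fin n) ℝ) (a : Fin n → ℝ), (∀ i, toEuclideanLin M (C i) = a i • C i) → M = O * diagonal a * Oᵀ := by
    intro M a h
    have : M * O = O * diagonal a := by
      ext i j
      have := congrArg (fun v => v.ofLp i) (h j)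
      simp only [toLpLin_apply, mulVec, dotProduct, PiLp.smul_apply, smul_eq_mul] at this
      rw [mul_diagonal, mul_apply]
      simp only [O, of_apply]
      rw [this, mul_comm]
    rw [← this, Matrix.mul_assoc, hO2, Matrix.mul_one]
  have k1 := key A a ha
  have k2 := key E e he
  let σ := Tuple.sort a
  have red : ∀ d : Fin n → ℝ, O * diagonal d * Oᵀ = (O.submatrix id σ) * diagonal (d ∘ σ) * (O.submatrix id σ)ᵀ := by
    intro d
    have : diagonal (d ∘ σ) = (diagonal d).submatrix σ σ := by
      ext i j
      simp [diagonal_apply]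
    rw [this, transpose_submatrix, submatrix_mul_equiv, submatrix_mul_equiv]
    simp
  have hO3 : (O.submatrix id σ)ᵀ * (O.submatrix id σ) = 1 := by
    rw [transpose_submatrix, ← submatrix_mul _ _ _ _ _ Function.bijective_id, hO]
    simp
  exact ⟨O.submatrix id σ, a ∘ σ, e ∘ σ, hO3, mul_eq_one_comm.1 hO3, Tuple.monotone_sort a, by rw [← red]; exact k1, by rw [← red]; exact k2⟩

/-- a polynomial vanishing on a nonempty open set is zero -/
theorem hm_poly_zero {τ : Type*} [Fintype τ] (f : MvPolynomial τ ℂ) (U : Set (τ → ℂ)) (hU : IsOpen U)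
    (hne : U.Nonempty) (h : ∀ y ∈ U, MvPolynomial.eval y f = 0) : f = 0 := by
  obtain ⟨y, hy⟩ := hne
  obtain ⟨ε, hε, hb⟩ := Metric.isOpen_iff.1 hU y hy
  refine MvPolynomial.funext_set (fun i => Metric.ball (y i) ε) (fun i => ?_) (fun x hx => ?_)
  · exact infinite_of_mem_nhds (y i) (Metric.ball_mem_nhds _ hε)
  · rw [map_zero]
    apply h _ (hb _)
    rw [ball_pi _ hε]
    exact hx

/-- A polynomial map whose range has nonempty interior has dense range. -/
theorem hm_dense {σ τ : Type} [Fintype σ] [Fintype τ] (F : τ → MvPolynomial σ ℂ)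
    (U : Set (τ → ℂ)) (hU : IsOpen U) (hne : U.Nonempty)
    (h : U ⊆ Set.range (fun x : σ → ℂ => fun j => MvPolynomial.eval x (F j))) :
    Dense (Set.range (fun x : σ → ℂ => fun j => MvPolynomial.eval x (F j))) := by
  classical
  let φ : MvPolynomial τ ℂ →ₐ[ℂ] MvPolynomial σ ℂ := MvPolynomial.aeval F
  have hev : ∀ (x : σ → ℂ) (p : MvPolynomial τ ℂ), MvPolynomial.eval x (φ p) =
      MvPolynomial.eval (fun j => MvPolynomial.eval x (F j)) p := by
    intro x p
    induction p using MvPolynomial.induction_on with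
    | C a => simp [φ]
    | add p q hp hq => simp [hp, hq]
    | mul_X p i hp => rw [map_mul, map_mul, hp, map_mul]; simp [φ]
  have hinj : Function.Injective φ := by
    rw [injective_iff_map_eq_zero]
    intro p hp
    refine hm_poly_zero p U hU hne fun y hy => ?_
    obtain ⟨x, rfl⟩ := h hy
    rw [← hev, hp, map_zero]
  have hft : φ.toRingHom.FiniteType := by
    have : φ.FiniteType := by
      apply AlgHom.FiniteType.of_comp_finiteType (f := Algebra.ofId ℂ (MvPolynomial τ ℂ))
      have : φ.comp (Algebra.ofId ℂ (MvPolynomial τ ℂ)) = Algebra.ofId ℂ _ := Subsingleton.elim _ _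
      rw [this]
      have h2 : Algebra.FiniteType ℂ (MvPolynomial σ ℂ) := inferInstance
      exact RingHom.finiteType_algebraMap.2 h2
    exact this
  have hfp := RingHom.FinitePresentation.of_finiteType.1 hft
  have hcon := PrimeSpectrum.isConstructible_range_comap hfp
  obtain ⟨S, hS⟩ := PrimeSpectrum.exists_constructibleSetData_iff.2 hcon
  let η : PrimeSpectrum (MvPolynomial τ ℂ) := ⟨⊥, Ideal.isPrime_bot⟩
  have hη : η ∈ Set.range (PrimeSpectrum.comap φ.toRingHom) := by
    refine ⟨⟨⊥, Ideal.isPrime_bot⟩, ?_⟩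
    ext p
    simp [η, PrimeSpectrum.comap, Ideal.mem_comap]
    exact map_eq_zero_iff φ hinj
  rw [← hS] at hη
  simp only [PrimeSpectrum.ConstructibleSetData.toSet, Set.mem_iUnion] at hη
  obtain ⟨C, hCS, hC⟩ := hη
  simp only [PrimeSpectrum.BasicConstructibleSetData.toSet, Set.mem_sdiff, PrimeSpectrum.mem_zeroLocus] at hC
  obtain ⟨hC1, hC2⟩ := hC
  have hf0 : C.f ≠ 0 := by
    intro h0
    apply hC2
    simp [h0, η]
  have main : ∀ y : τ → ℂ, MvPolynomial.eval y C.f ≠ 0 → y ∈ Set.range (fun x : σ → ℂ => fun j => MvPolynomial.eval x (F j)) := by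
    intro y hy
    let m : PrimeSpectrum (MvPolynomial τ ℂ) := ⟨RingHom.ker (MvPolynomial.eval y), RingHom.ker_isPrime _⟩
    have hm : m ∈ Set.range (PrimeSpectrum.comap φ.toRingHom) := by
      rw [← hS]
      simp only [PrimeSpectrum.ConstructibleSetData.toSet, Set.mem_iUnion]
      refine ⟨C, hCS, ?_⟩
      simp only [PrimeSpectrum.BasicConstructibleSetData.toSet, Set.mem_sdiff, PrimeSpectrum.mem_zeroLocus]
      constructor
      · intro p hp
        have : p = 0 := by simpa [η] using hC1 hp
        rw [this]
        exact zero_mem _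
      · intro h0
        apply hy
        have : C.f ∈ RingHom.ker (MvPolynomial.eval y) := h0 rfl
        exact this
    obtain ⟨Q, hQ⟩ := hm
    obtain ⟨M, hM, hQM⟩ := Ideal.exists_le_maximal Q.asIdeal Q.isPrime.ne_top
    obtain ⟨x, hx⟩ := MvPolynomial.isMaximal_iff_eq_vanishingIdeal_singleton.1 hM
    refine ⟨x, funext fun j => ?_⟩
    have h1 : MvPolynomial.X j - MvPolynomial.C (y j) ∈ m.asIdeal := by
      simp [m, RingHom.mem_ker]
    rw [← hQ] at h1
    have h2 : φ (MvPolynomial.X j - MvPolynomial.C (y j)) ∈ Q.asIdeal := h1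
    have h3 := hQM h2
    rw [hx, MvPolynomial.mem_vanishingIdeal_singleton_iff] at h3
    have h4 : MvPolynomial.eval x (φ (MvPolynomial.X j - MvPolynomial.C (y j))) = 0 := by
      simpa [MvPolynomial.aeval_eq_eval] using h3
    rw [hev] at h4
    simpa [sub_eq_zero] using h4
  rw [dense_iff_inter_open]
  intro V hV hVne
  by_contra hcontra
  apply hf0
  refine hm_poly_zero _ V hV hVne fun y hy => ?_
  by_contra h0
  exact hcontra ⟨y, hy, main y h0⟩

open scoped Matrix.Norms.Operator in
theorem hm_deriv {n : ℕ} {ι : Type*} [Fintype ι] (X M : ι → Matrix (Fin n) (Fin n) ℝ) (t : ℝ) :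
    HasDerivAt (fun t : ℝ => ∑ k, NormedSpace.exp (t • X k) * M k * NormedSpace.exp (t • (-X k)))
      (∑ k, NormedSpace.exp (t • X k) * (X k * M k - M k * X k) * NormedSpace.exp (t • (-X k))) t := by
  refine HasDerivAt.fun_sum fun k _ => ?_
  have h1 := hasDerivAt_exp_smul_const (X k) t
  have h2 := hasDerivAt_exp_smul_const' (-X k) t
  have h3 := (h1.mul_const (M k)).mul h2
  have e : NormedSpace.exp (t • X k) * (X k * M k - M k * X k) * NormedSpace.exp (t • (-X k)) =
      NormedSpace.exp (t • X k) * X k * M k * NormedSpace.exp (t • -X k) +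
      NormedSpace.exp (t • X k) * M k * (-X k * NormedSpace.exp (t • -X k)) := by
    simp only [Matrix.mul_sub, Matrix.sub_mul, Matrix.mul_assoc, Matrix.neg_mul, Matrix.mul_neg, sub_eq_add_neg, Matrix.mul_add, Matrix.add_mul]
  rw [e]
  exact h3

open scoped Matrix.Norms.Operator in
theorem hm_deriv_tr {n : ℕ} (P Q : ℝ → Matrix (Fin n) (Fin n) ℝ) (P' Q' : Matrix (Fin n) (Fin n) ℝ) (t : ℝ)
    (hP : HasDerivAt P P' t) (hQ : HasDerivAt Q Q' t) :
    HasDerivAt (fun t => trace (P t * Q t)) (trace (P' * Q t + P t * Q')) t := by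
  have h := hP.mul hQ
  let L : Matrix (Fin n) (Fin n) ℝ →L[ℝ] ℝ := LinearMap.toContinuousLinearMap (traceLinearMap (Fin n) ℝ ℝ)
  exact (L.hasFDerivAt.comp_hasDerivAt t h)

theorem hm_var {n : ℕ} {ι : Type*} [Fintype ι] (A X : ι → Matrix (Fin n) (Fin n) ℝ)
    (hX : ∀ k, (X k)ᵀ = - X k)
    (hmin : ∀ V : ι → Matrix (Fin n) (Fin n) ℝ, (∀ k, V k * (V k)ᵀ = 1) →
      trace ((∑ k, A k) * (∑ k, A k)) ≤ trace ((∑ k, V k * A k * (V k)ᵀ) * (∑ k, V k * A k * (V k)ᵀ))) :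
    trace ((∑ k, A k) * (∑ k, (X k * A k - A k * X k))) = 0 ∧
    (∑ k, (X k * A k - A k * X k) = 0 → 0 ≤ trace ((∑ k, A k) *
      (∑ k, (X k * (X k * A k - A k * X k) - (X k * A k - A k * X k) * X k)))) := by
  let G : (ι → Matrix (Fin n) (Fin n) ℝ) → ℝ → Matrix (Fin n) (Fin n) ℝ := fun M t =>
    ∑ k, NormedSpace.exp (t • X k) * M k * NormedSpace.exp (t • (-X k))
  let D : (ι → Matrix (Fin n) (Fin n) ℝ) → ι → Matrix (Fin n) (Fin n) ℝ := fun M k => X k * M k - M k * X k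
  let g : ℝ → ℝ := fun t => trace (G A t * G A t)
  let g1 : ℝ → ℝ := fun t => trace (G (D A) t * G A t + G A t * G (D A) t)
  have hg1 : ∀ t, HasDerivAt g (g1 t) t := fun t =>
    hm_deriv_tr _ _ _ _ t (hm_deriv X A t) (hm_deriv X A t)
  have hG0 : ∀ M, G M 0 = ∑ k, M k := by intro M; simp [G]
  have hmin' : ∀ t, g 0 ≤ g t := by
    intro t
    have := hmin (fun k => NormedSpace.exp (t • X k)) (fun k => by
      rw [← Matrix.exp_transpose, transpose_smul, hX, smul_neg, Matrix.exp_neg]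
      exact Matrix.mul_nonsing_inv _ ((Matrix.isUnit_iff_isUnit_det _).1 (Matrix.isUnit_exp _)))
    simp only [g, hG0]
    refine this.trans (le_of_eq ?_)
    simp only [G, ← Matrix.exp_transpose, transpose_smul, hX]
  have hloc : IsLocalMin g 0 := Filter.Eventually.of_forall hmin'
  have h0 : g1 0 = 0 := hloc.hasDerivAt_eq_zero (hg1 0)
  constructor
  · simp only [g1, hG0, D] at h0
    rw [trace_add, trace_mul_comm] at h0
    linarith
  · intro hC
    have hD : ∑ k, D A k = 0 := hC
    let g2 : ℝ := trace (G (D (D A)) 0 * G A 0 + G (D A) 0 * G (D A) 0) + trace (G (D A) 0 * G (D A) 0 + G A 0 * G (D (D A)) 0)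
    have hg2 : HasDerivAt g1 g2 0 := by
      have e1 := hm_deriv_tr _ _ _ _ 0 (hm_deriv X (D A) 0) (hm_deriv X A 0)
      have e2 := hm_deriv_tr _ _ _ _ 0 (hm_deriv X A 0) (hm_deriv X (D A) 0)
      have e3 := e1.add e2
      have : g1 = (fun t => trace (G (D A) t * G A t)) + (fun t => trace (G A t * G (D A) t)) := by
        ext t; simp [g1, trace_add]
      rw [this]
      exact e3
    by_contra hneg
    push Not at hneg
    have hg2v : g2 = 2 * trace ((∑ k, A k) * ∑ k, D (D A) k) := by
      simp only [g2, hG0, hD]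
      simp only [Matrix.zero_mul, add_zero, zero_add]
      rw [trace_mul_comm]; ring
    have hg2n : g2 < 0 := by
      rw [hg2v]
      have : trace ((∑ k, A k) * ∑ k, D (D A) k) < 0 := hneg
      linarith
    have hdg : deriv g = g1 := funext fun t => (hg1 t).deriv
    have hmax : IsLocalMax g 0 := by
      apply isLocalMax_of_deriv_deriv_neg
      · rw [hdg, hg2.deriv]; exact hg2n
      · rw [hdg, h0]
      · exact (hg1 0).continuousAt
    have hconst : g =ᶠ[nhds 0] fun _ => g 0 := by
      filter_upwards [hmax] with t ht
      exact le_antisymm ht (hmin' t)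
    have hd1 : g1 =ᶠ[nhds 0] fun _ => 0 := by
      have := hconst.deriv
      rw [hdg] at this
      simpa using this
    have : deriv g1 0 = 0 := by
      rw [hd1.deriv_eq]; simp
    rw [hg2.deriv] at this
    linarith

/-- existence of minimizer -/
theorem hm_min {n : ℕ} {ι : Type*} [Fintype ι] (D : ι → Matrix (Fin n) (Fin n) ℝ) :
    ∃ O : ι → Matrix (Fin n) (Fin n) ℝ, (∀ k, O k * (O k)ᵀ = 1) ∧
     ∀ V : ι → Matrix (Fin n) (Fin n) ℝ, (∀ k, V k * (V k)ᵀ = 1) →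
      trace ((∑ k, O k * D k * (O k)ᵀ) * (∑ k, O k * D k * (O k)ᵀ)) ≤
      trace ((∑ k, V k * D k * (V k)ᵀ) * (∑ k, V k * D k * (V k)ᵀ)) := by
  let K : Set (ι → Matrix (Fin n) (Fin n) ℝ) := {V | ∀ k, V k * (V k)ᵀ = 1}
  let B : Set (ι → Matrix (Fin n) (Fin n) ℝ) := Set.univ.pi fun _ => Set.univ.pi fun _ => Set.univ.pi fun _ => Set.Icc (-1 : ℝ) 1
  have hB : IsCompact B := isCompact_univ_pi fun _ => isCompact_univ_pi fun _ => isCompact_univ_pi fun _ => isCompact_Icc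
  have hKB : K ⊆ B := by
    intro V hV k _ i _ j _
    have h1 := congrFun (congrFun (hV k) i) i
    rw [mul_apply] at h1
    simp only [transpose_apply, one_apply_eq] at h1
    have h2 : V k i j * V k i j ≤ ∑ j, V k i j * V k i j :=
      Finset.single_le_sum (f := fun j => V k i j * V k i j) (fun _ _ => mul_self_nonneg _) (Finset.mem_univ j)
    rw [h1] at h2
    constructor <;> nlinarith
  have hKc : IsClosed K := by
    have : K = ⋂ k, {V | V k * (V k)ᵀ = 1} := by ext; simp [K]
    rw [this]
    refine isClosed_iInter fun k => isClosed_eq ?_ continuous_const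
    fun_prop
  have hK : IsCompact K := hB.of_isClosed_subset hKc hKB
  obtain ⟨O, hO, hmin⟩ := hK.exists_isMinOn (f := fun V => trace ((∑ k, V k * D k * (V k)ᵀ) * (∑ k, V k * D k * (V k)ᵀ))) ⟨fun _ => 1, by simp [K]⟩ (by fun_prop)
  exact ⟨O, hO, fun V hV => hmin hV⟩
theorem hm_comm {n : ℕ} {ι : Type*} [Fintype ι] [DecidableEq ι] (A : ι → Matrix (Fin n) (Fin n) ℝ)
    (hA : ∀ k, (A k)ᵀ = A k)
    (hmin : ∀ V : ι → Matrix (Fin n) (Fin n) ℝ, (∀ k, V k * (V k)ᵀ = 1) →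
      trace ((∑ k, A k) * (∑ k, A k)) ≤ trace ((∑ k, V k * A k * (V k)ᵀ) * (∑ k, V k * A k * (V k)ᵀ)))
    (k : ι) : A k * (∑ j, A j) = (∑ j, A j) * A k := by
  set E := ∑ j, A j with hE
  have hEt : Eᵀ = E := by rw [hE, transpose_sum]; exact Finset.sum_congr rfl fun k _ => hA k
  set C := A k * E - E * A k with hC
  have hCt : Cᵀ = - C := by
    rw [hC, transpose_sub, transpose_mul, transpose_mul, hA, hEt]; abel
  have h := (hm_var A (fun j => if j = k then C else 0) (fun j => by
    split_ifs
    · exact hCt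
    · simp) hmin).1
  have h1 : ∑ j, ((if j = k then C else 0) * A j - A j * (if j = k then C else 0)) = C * A k - A k * C := by
    rw [Finset.sum_eq_single k]
    · simp
    · intro j _ hj; simp [hj]
    · simp
  rw [h1] at h
  have h2 : trace (E * (C * A k - A k * C)) = trace (C * C) := by
    conv_rhs => rw [hC, ← hC]
    rw [mul_sub, trace_sub]
    have : C * C = C * (A k * E) - C * (E * A k) := by rw [← mul_sub]
    rw [this, trace_sub, ← mul_assoc, trace_mul_cycle, ← mul_assoc E, trace_mul_comm (E * A k), trace_mul_comm C (A k * E)]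
  have h3 : trace (C * Cᵀ) = 0 := by
    rw [hCt, mul_neg, trace_neg, ← h2]
    rw [← hE] at h
    rw [h, neg_zero]
  have h4 : C = 0 := by
    have := (Matrix.trace_mul_conjTranspose_self_eq_zero_iff (A := C)).1 (by simpa [conjTranspose_eq_transpose_of_trivial] using h3)
    exact this
  exact sub_eq_zero.1 h4

theorem hm_second {n : ℕ} {ι : Type*} [Fintype ι] (A O : ι → Matrix (Fin n) (Fin n) ℝ)
    (a e : ι → Fin n → ℝ)
    (hmin : ∀ V : ι → Matrix (Fin n) (Fin n) ℝ, (∀ k, V k * (V k)ᵀ = 1) →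
      trace ((∑ k, A k) * (∑ k, A k)) ≤ trace ((∑ k, V k * A k * (V k)ᵀ) * (∑ k, V k * A k * (V k)ᵀ)))
    (hO : ∀ k, (O k)ᵀ * O k = 1)
    (hA : ∀ k, A k = O k * diagonal (a k) * (O k)ᵀ)
    (hE : ∀ k, ∑ j, A j = O k * diagonal (e k) * (O k)ᵀ)
    (z : ι → Matrix (Fin n) (Fin n) ℝ)
    (hz : ∑ k, O k * z k * (O k)ᵀ = 0)
    (hs : ∀ k i j, z k i j ≠ 0 → 0 ≤ e k i ∧ e k j < 0 ∧ a k j < a k i) : ∀ k, z k = 0 := by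
  let s : ι → Matrix (Fin n) (Fin n) ℝ := fun k => z k + (z k)ᵀ
  let x : ι → Matrix (Fin n) (Fin n) ℝ := fun k => of fun i j => s k i j / (a k i - a k j)
  have hs' : ∀ k i j, s k i j ≠ 0 → 0 < (e k i - e k j) * (a k i - a k j) := by
    intro k i j h
    have : z k i j ≠ 0 ∨ z k j i ≠ 0 := by
      by_contra hh
      push Not at hh
      apply h
      simp [s, hh.1, hh.2]
    rcases this with h | h
    · obtain ⟨h1, h2, h3⟩ := hs k i j h
      apply mul_pos <;> linarith
    · obtain ⟨h1, h2, h3⟩ := hs k j i h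
      apply mul_pos_of_neg_of_neg <;> linarith
  have hst : ∀ k i j, s k i j = s k j i := by intro k i j; simp [s, add_comm]
  have hxt : ∀ k, (x k)ᵀ = - x k := by
    intro k; ext i j
    rw [transpose_apply, Matrix.neg_apply]
    simp only [x, of_apply]
    rw [hst, ← neg_sub, div_neg]
  have hxa : ∀ k, x k * diagonal (a k) - diagonal (a k) * x k = - s k := by
    intro k; ext i j
    rw [Matrix.sub_apply, mul_diagonal, diagonal_mul, Matrix.neg_apply]
    simp only [x, of_apply]
    by_cases h : s k i j = 0
    · simp [h]
    · have := hs' k i j h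
      have h2 : a k i - a k j ≠ 0 := by intro h3; rw [h3] at this; simp at this
      field_simp; ring
  have hcomm : ∀ k, (O k * x k * (O k)ᵀ) * A k - A k * (O k * x k * (O k)ᵀ) = - (O k * s k * (O k)ᵀ) := by
    intro k
    have : - (O k * s k * (O k)ᵀ) = O k * (- s k) * (O k)ᵀ := by simp
    rw [this, ← hxa, hA]
    have e1 : ∀ p q : Matrix (Fin n) (Fin n) ℝ, (O k * p * (O k)ᵀ) * (O k * q * (O k)ᵀ) = O k * (p * q) * (O k)ᵀ := by
      intro p q
      calc _ = O k * p * ((O k)ᵀ * O k) * q * (O k)ᵀ := by simp only [mul_assoc]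
        _ = _ := by rw [hO]; simp only [mul_assoc, mul_one, one_mul]
    rw [e1, e1, mul_sub, sub_mul]
  have hsum : ∑ k, O k * s k * (O k)ᵀ = 0 := by
    have h2 := congrArg transpose hz
    rw [transpose_sum, transpose_zero] at h2
    have h3 : ∀ k, O k * s k * (O k)ᵀ = O k * z k * (O k)ᵀ + (O k * z k * (O k)ᵀ)ᵀ := by
      intro k
      simp only [s, mul_add, add_mul, transpose_mul, transpose_transpose, mul_assoc]
    simp_rw [h3]
    rw [Finset.sum_add_distrib, hz, h2, add_zero]
  have h := (hm_var A (fun k => O k * x k * (O k)ᵀ) (fun k => by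
    simp only [transpose_mul, transpose_transpose, hxt]
    simp [mul_assoc]) hmin).2 (by
      simp_rw [hcomm]; rw [Finset.sum_neg_distrib, hsum, neg_zero])
  rw [Matrix.mul_sum, trace_sum] at h
  have ht : ∀ k, trace ((∑ j, A j) * ((O k * x k * (O k)ᵀ) * ((O k * x k * (O k)ᵀ) * A k - A k * (O k * x k * (O k)ᵀ)) - ((O k * x k * (O k)ᵀ) * A k - A k * (O k * x k * (O k)ᵀ)) * (O k * x k * (O k)ᵀ)))
      = - ∑ i, ∑ j, (e k i - e k j) * (x k i j * s k i j) := by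
    intro k
    rw [hcomm, hE k]
    have e1 : ∀ p q : Matrix (Fin n) (Fin n) ℝ, (O k * p * (O k)ᵀ) * (O k * q * (O k)ᵀ) = O k * (p * q) * (O k)ᵀ := by
      intro p q
      calc _ = O k * p * ((O k)ᵀ * O k) * q * (O k)ᵀ := by simp only [mul_assoc]
        _ = _ := by rw [hO]; simp only [mul_assoc, mul_one, one_mul]
    have e2 : (O k * x k * (O k)ᵀ) * - (O k * s k * (O k)ᵀ) - - (O k * s k * (O k)ᵀ) * (O k * x k * (O k)ᵀ) = O k * (s k * x k - x k * s k) * (O k)ᵀ := by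
      rw [mul_neg, neg_mul, e1, e1, mul_sub, sub_mul]; abel
    rw [e2, e1, trace_mul_comm, ← mul_assoc, hO, one_mul]
    have e3 : trace (diagonal (e k) * (s k * x k - x k * s k)) = ∑ i, ∑ j, e k i * (s k i j * x k j i - x k i j * s k j i) := by
      rw [trace]
      refine Finset.sum_congr rfl fun i _ => ?_
      rw [diag_apply, diagonal_mul, Matrix.sub_apply, mul_apply, mul_apply, ← Finset.sum_sub_distrib, Finset.mul_sum]
    have hxs : ∀ i j, x k j i = - x k i j := fun i j => congrFun (congrFun (hxt k) i) j
    have e4 : ∑ i, ∑ j, e k j * (x k i j * s k i j) = - ∑ i, ∑ j, e k i * (x k i j * s k i j) := by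
      rw [Finset.sum_comm, ← Finset.sum_neg_distrib]
      refine Finset.sum_congr rfl fun i _ => ?_
      rw [← Finset.sum_neg_distrib]
      refine Finset.sum_congr rfl fun j _ => ?_
      rw [hxs i j, hst k j i]; ring
    rw [e3]
    simp_rw [sub_mul, Finset.sum_sub_distrib]
    rw [e4, ← Finset.sum_neg_distrib, ← Finset.sum_sub_distrib, ← Finset.sum_neg_distrib]
    refine Finset.sum_congr rfl fun i _ => ?_
    rw [← Finset.sum_neg_distrib, ← Finset.sum_sub_distrib, ← Finset.sum_neg_distrib]
    refine Finset.sum_congr rfl fun j _ => ?_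
    rw [hxs i j, hst k j i]; ring
  simp_rw [ht] at h
  rw [Finset.sum_neg_distrib] at h
  have hpos : ∀ k i j, 0 ≤ (e k i - e k j) * (x k i j * s k i j) ∧ (s k i j ≠ 0 → 0 < (e k i - e k j) * (x k i j * s k i j)) := by
    intro k i j
    have h2 : s k i j ≠ 0 → 0 < (e k i - e k j) * (x k i j * s k i j) := by
      intro hne
      have h3 := hs' k i j hne
      have h2 : a k i - a k j ≠ 0 := by intro h4; rw [h4] at h3; simp at h3
      have : (e k i - e k j) * (x k i j * s k i j) = ((e k i - e k j) * (a k i - a k j)) * (s k i j / (a k i - a k j))^2 := by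
        simp only [x, of_apply]; field_simp
      rw [this]
      positivity
    refine ⟨?_, h2⟩
    by_cases h0 : s k i j = 0
    · simp [h0]
    · exact (h2 h0).le
  have hsz : ∀ k i j, s k i j = 0 := by
    intro k i j
    by_contra hne
    have h1 := (hpos k i j).2 hne
    have h2 : (e k i - e k j) * (x k i j * s k i j) ≤ ∑ j, (e k i - e k j) * (x k i j * s k i j) :=
      Finset.single_le_sum (f := fun j => (e k i - e k j) * (x k i j * s k i j)) (fun j _ => (hpos k i j).1) (Finset.mem_univ j)
    have h3 : ∑ j, (e k i - e k j) * (x k i j * s k i j) ≤ ∑ i, ∑ j, (e k i - e k j) * (x k i j * s k i j) :=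
      Finset.single_le_sum (f := fun i => ∑ j, (e k i - e k j) * (x k i j * s k i j)) (fun i _ => Finset.sum_nonneg fun j _ => (hpos k i j).1) (Finset.mem_univ i)
    have h4 : ∑ i, ∑ j, (e k i - e k j) * (x k i j * s k i j) ≤ ∑ k, ∑ i, ∑ j, (e k i - e k j) * (x k i j * s k i j) :=
      Finset.single_le_sum (f := fun k => ∑ i, ∑ j, (e k i - e k j) * (x k i j * s k i j)) (fun k _ => Finset.sum_nonneg fun i _ => Finset.sum_nonneg fun j _ => (hpos k i j).1) (Finset.mem_univ k)
    linarith
  intro k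
  ext i j
  by_contra hne
  rw [Matrix.zero_apply] at hne
  have h1 := hs k i j hne
  have h2 : z k i j + z k j i = 0 := hsz k i j
  have h3 : z k j i ≠ 0 := by intro h; rw [h, add_zero] at h2; exact hne h2
  have h4 := hs k j i h3
  linarith [h1.1, h4.2.1]
theorem hm_surj {n : ℕ} {ι : Type} [Fintype ι] [DecidableEq ι] (O : ι → Matrix (Fin n) (Fin n) ℝ)
    (hO : ∀ k, O k * (O k)ᵀ = 1)
    (m1 m2 : ι → Fin n → Fin n → Bool)
    (hsec : ∀ z : ι → Matrix (Fin n) (Fin n) ℝ, ∑ k, O k * z k * (O k)ᵀ = 0 →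
      (∀ k i j, z k i j ≠ 0 → m1 k i j = false ∧ m2 k i j = false) → ∀ k, z k = 0)
    (T : ι → Matrix (Fin n) (Fin n) ℂ) :
    ∃ (H : Matrix (Fin n) (Fin n) ℂ) (Q P : ι → Matrix (Fin n) (Fin n) ℂ),
      (∀ k i j, m1 k i j = false → Q k i j = 0) ∧ (∀ k i j, m2 k i j = false → P k i j = 0) ∧
      ∀ k, T k = H * (O k).map (algebraMap ℝ ℂ) + (O k).map (algebraMap ℝ ℂ) * Q k + (O k).map (algebraMap ℝ ℂ) * P k := by
  let Oc : ι → Matrix (Fin n) (Fin n) ℂ := fun k => (O k).map (algebraMap ℝ ℂ)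
  have hOc : ∀ k, Oc k * (Oc k)ᵀ = 1 := by
    intro k
    simp only [Oc]
    rw [← transpose_map, ← Matrix.map_mul, hO]
    simp
  have hOc' : ∀ k, (Oc k)ᵀ * Oc k = 1 := fun k => mul_eq_one_comm.1 (hOc k)
  -- the submodule of attained values, in the moving frames
  let S : Submodule ℂ (ι → Matrix (Fin n) (Fin n) ℂ) :=
    { carrier := {T | ∃ (H : Matrix (Fin n) (Fin n) ℂ) (Q P : ι → Matrix (Fin n) (Fin n) ℂ), (∀ k i j, m1 k i j = false → Q k i j = 0) ∧ (∀ k i j, m2 k i j = false → P k i j = 0) ∧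
        ∀ k, T k = (Oc k)ᵀ * H * Oc k + Q k + P k}
      zero_mem' := ⟨0, 0, 0, by simp, by simp, by simp⟩
      add_mem' := by
        rintro T T' ⟨H, Q, P, h1, h2, h3⟩ ⟨H', Q', P', h1', h2', h3'⟩
        refine ⟨H + H', Q + Q', P + P', ?_, ?_, ?_⟩
        · intro k i j h; simp [h1 k i j h, h1' k i j h]
        · intro k i j h; simp [h2 k i j h, h2' k i j h]
        · intro k; simp only [Pi.add_apply, h3, h3', mul_add, add_mul]; abel
      smul_mem' := by
        rintro c T ⟨H, Q, P, h1, h2, h3⟩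
        refine ⟨c • H, c • Q, c • P, ?_, ?_, ?_⟩
        · intro k i j h; simp [h1 k i j h]
        · intro k i j h; simp [h2 k i j h]
        · intro k; simp [h3, smul_add] }
  have hS : S = ⊤ := by
    by_contra hne
    obtain ⟨f, hf0, hf⟩ := Submodule.exists_le_ker_of_lt_top S (lt_top_iff_ne_top.2 hne)
    let B : ι → Fin n → Fin n → (ι → Matrix (Fin n) (Fin n) ℂ) := fun k i j => Pi.single k (Matrix.single i j 1)
    let z : ι → Matrix (Fin n) (Fin n) ℂ := fun k => of fun i j => f (B k i j)
    have hfz : ∀ T : ι → Matrix (Fin n) (Fin n) ℂ, f T = ∑ k, ∑ i, ∑ j, T k i j * z k i j := by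
      intro T
      have : T = ∑ k, ∑ i, ∑ j, T k i j • B k i j := by
        funext k
        rw [Finset.sum_apply, Finset.sum_eq_single k]
        · conv_lhs => rw [matrix_eq_sum_single (T k)]
          rw [Finset.sum_apply]
          refine Finset.sum_congr rfl fun i _ => ?_
          rw [Finset.sum_apply]
          refine Finset.sum_congr rfl fun j _ => ?_
          simp [B, Matrix.smul_single]
        · intro k' _ hk'
          simp [Finset.sum_apply, B, Pi.single_eq_of_ne hk'.symm]
        · simp
      conv_lhs => rw [this]
      simp only [map_sum, map_smul, smul_eq_mul]
      rfl
    have hm1 : ∀ k i j, m1 k i j = true → z k i j = 0 := by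
      intro k i j h
      apply hf
      refine ⟨0, B k i j, 0, ?_, by simp, by simp⟩
      intro k' i' j' h'
      simp only [B]
      by_cases hk : k' = k
      · subst hk
        rw [Pi.single_eq_same, Matrix.single_apply, if_neg]
        rintro ⟨rfl, rfl⟩
        rw [h] at h'; cases h'
      · rw [Pi.single_eq_of_ne hk]; rfl
    have hm2 : ∀ k i j, m2 k i j = true → z k i j = 0 := by
      intro k i j h
      apply hf
      refine ⟨0, 0, B k i j, by simp, ?_, by simp⟩
      intro k' i' j' h'
      simp only [B]
      by_cases hk : k' = k
      · subst hk
        rw [Pi.single_eq_same, Matrix.single_apply, if_neg]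
        rintro ⟨rfl, rfl⟩
        rw [h] at h'; cases h'
      · rw [Pi.single_eq_of_ne hk]; rfl
    have hH : ∀ a b, ∑ k, ∑ i, ∑ j, (O k a i : ℂ) * z k i j * (O k b j : ℂ) = 0 := by
      intro a b
      have h := hf (show (fun k => (Oc k)ᵀ * Matrix.single a b 1 * Oc k) ∈ S from
        ⟨Matrix.single a b 1, 0, 0, by simp, by simp, by simp⟩)
      rw [LinearMap.mem_ker, hfz] at h
      rw [← h]
      refine Finset.sum_congr rfl fun k _ => Finset.sum_congr rfl fun i _ => Finset.sum_congr rfl fun j _ => ?_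
      have : ((Oc k)ᵀ * Matrix.single a b (1 : ℂ) * Oc k : Matrix (Fin n) (Fin n) ℂ) i j = (O k a i : ℂ) * (O k b j : ℂ) := by
        rw [mul_assoc, mul_apply, Finset.sum_eq_single a]
        · simp [Oc]
        · intro c _ hc
          rw [Matrix.single_mul_apply_of_ne _ _ _ _ _ hc]; simp
        · simp
      rw [this]; ring
    have hent : ∀ (y : ι → Matrix (Fin n) (Fin n) ℝ), (∀ a b, ∑ k, ∑ i, ∑ j, O k a i * y k i j * O k b j = 0) →
        ∑ k, O k * y k * (O k)ᵀ = 0 := by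
      intro y hy
      ext a b
      rw [Matrix.sum_apply, Matrix.zero_apply, ← hy a b]
      refine Finset.sum_congr rfl fun k _ => ?_
      rw [mul_apply, Finset.sum_comm]
      refine Finset.sum_congr rfl fun j _ => ?_
      rw [mul_apply, Finset.sum_mul]
      rfl
    have hre := hsec (fun k => of fun i j => (z k i j).re) (hent _ fun a b => by
      have := congrArg Complex.re (hH a b)
      simpa using this) (fun k i j h => by
        constructor
        · by_contra h'
          exact h (by simp [hm1 k i j (by simpa using h')])
        · by_contra h'
          exact h (by simp [hm2 k i j (by simpa using h')]))
    have him := hsec (fun k => of fun i j => (z k i j).im) (hent _ fun a b => by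
      have := congrArg Complex.im (hH a b)
      simpa using this) (fun k i j h => by
        constructor
        · by_contra h'
          exact h (by simp [hm1 k i j (by simpa using h')])
        · by_contra h'
          exact h (by simp [hm2 k i j (by simpa using h')]))
    apply hf0
    apply LinearMap.ext
    intro T
    rw [hfz]
    have hz : ∀ k i j, z k i j = 0 := by
      intro k i j
      apply Complex.ext
      · exact congrFun (congrFun (hre k) i) j
      · exact congrFun (congrFun (him k) i) j
    simp [hz]
  have hT : (fun k => (Oc k)ᵀ * T k) ∈ S := by rw [hS]; trivial
  obtain ⟨H, Q, P, h1, h2, h3⟩ := hT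
  refine ⟨H, Q, P, h1, h2, fun k => ?_⟩
  have := congrArg (fun Z => Oc k * Z) (h3 k)
  simp only [mul_add, ← mul_assoc, hOc, one_mul] at this
  exact this

open scoped Matrix.Norms.Operator in
theorem hm_open {n : ℕ} {ι : Type} [Fintype ι] {V : Type} [NormedAddCommGroup V] [NormedSpace ℂ V] [FiniteDimensional ℂ V]
    (O : ι → Matrix (Fin n) (Fin n) ℂ)
    (h : V →ₗ[ℂ] Matrix (Fin n) (Fin n) ℂ) (q p : ι → V →ₗ[ℂ] Matrix (Fin n) (Fin n) ℂ) (x : V)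
    (hx : h x = 1) (qx : ∀ k, q k x = 1) (px : ∀ k, p k x = 1)
    (hs : ∀ T : ι → Matrix (Fin n) (Fin n) ℂ, ∃ v, ∀ k, T k = h v * O k + O k * q k v + O k * p k v)
    {W : Type} [NormedAddCommGroup W] [NormedSpace ℂ W] [FiniteDimensional ℂ W]
    (L : W ≃ₗ[ℂ] (ι → Matrix (Fin n) (Fin n) ℂ)) :
    ∃ U : Set W, IsOpen U ∧ U.Nonempty ∧ ∀ w ∈ U, ∃ v, ∀ k, L w k = h v * O k * q k v * p k v := by
  let h' := LinearMap.toContinuousLinearMap h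
  let q' := fun k => LinearMap.toContinuousLinearMap (q k)
  let p' := fun k => LinearMap.toContinuousLinearMap (p k)
  have hd : ∀ k, HasStrictFDerivAt (fun v => h' v * O k * q' k v * p' k v) _ x := fun k =>
    ((h'.hasStrictFDerivAt.mul_const' (O k)).mul' (q' k).hasStrictFDerivAt).mul' (p' k).hasStrictFDerivAt
  have hD := hasStrictFDerivAt_pi.2 hd
  have hsurj := hD.map_nhds_eq_of_surj (by
    rw [LinearMap.range_eq_top]
    intro T
    obtain ⟨v, hv⟩ := hs T
    refine ⟨v, funext fun k => ?_⟩
    rw [hv k]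
    change (h' x * O k * q' k x) * p k v + ((h' x * O k) * q k v + (h v * O k) * q' k x) * p' k x = _
    rw [show h' x = 1 from hx, show q' k x = 1 from qx k, show p' k x = 1 from px k]
    simp only [one_mul, mul_one]
    abel)
  let f : V → (ι → Matrix (Fin n) (Fin n) ℂ) := fun v k => h' v * O k * q' k v * p' k v
  have hr : Set.range f ∈ nhds (f x) := by
    have hr1 : Set.range f ∈ Filter.map (fun x i => h' x * O i * (q' i) x * (p' i) x) (nhds x) :=
      Filter.mem_map.2 (Filter.Eventually.of_forall fun v => ⟨v, rfl⟩)
    rw [hsurj] at hr1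
    exact hr1
  have hLc : Continuous L := L.toLinearMap.continuous_of_finiteDimensional
  refine ⟨L ⁻¹' interior (Set.range f), isOpen_interior.preimage hLc, ⟨L.symm (f x), ?_⟩, ?_⟩
  · rw [Set.mem_preimage, L.apply_symm_apply]
    exact mem_interior_iff_mem_nhds.2 hr
  · intro w hw
    obtain ⟨v, hv⟩ := interior_subset hw
    exact ⟨v, fun k => by rw [← hv]; rfl⟩

theorem hm_phi_dense {n : ℕ} {ι : Type} [Fintype ι] [DecidableEq ι] (O : ι → Matrix (Fin n) (Fin n) ℝ)
    (hO : ∀ k, O k * (O k)ᵀ = 1)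
    (m1 m2 : ι → Fin n → Fin n → Bool) (h1 : ∀ k i, m1 k i i = true) (h2 : ∀ k i, m2 k i i = true)
    (hsec : ∀ z : ι → Matrix (Fin n) (Fin n) ℝ, ∑ k, O k * z k * (O k)ᵀ = 0 →
      (∀ k i j, z k i j ≠ 0 → m1 k i j = false ∧ m2 k i j = false) → ∀ k, z k = 0) :
    Dense {G : ι → Matrix (Fin n) (Fin n) ℂ | ∃ (H : Matrix (Fin n) (Fin n) ℂ) (Q P : ι → Matrix (Fin n) (Fin n) ℂ),
      (∀ k i j, m1 k i j = false → Q k i j = 0) ∧ (∀ k i j, m2 k i j = false → P k i j = 0) ∧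
      ∀ k, G k = H * (O k).map (algebraMap ℝ ℂ) * Q k * P k} := by
  let σ := (Fin n × Fin n) ⊕ (ι × Fin n × Fin n) ⊕ (ι × Fin n × Fin n)
  let τ := ι × Fin n × Fin n
  let h : (σ → ℂ) →ₗ[ℂ] Matrix (Fin n) (Fin n) ℂ :=
    { toFun := fun x => of fun i j => x (Sum.inl (i, j))
      map_add' := fun x y => rfl
      map_smul' := fun c x => rfl }
  let q : ι → (σ → ℂ) →ₗ[ℂ] Matrix (Fin n) (Fin n) ℂ := fun k =>
    { toFun := fun x => of fun i j => if m1 k i j = true then x (Sum.inr (Sum.inl (k, i, j))) else 0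
      map_add' := fun x y => by ext i j; simp; split_ifs <;> simp
      map_smul' := fun c x => by ext i j; simp }
  let p : ι → (σ → ℂ) →ₗ[ℂ] Matrix (Fin n) (Fin n) ℂ := fun k =>
    { toFun := fun x => of fun i j => if m2 k i j = true then x (Sum.inr (Sum.inr (k, i, j))) else 0
      map_add' := fun x y => by ext i j; simp; split_ifs <;> simp
      map_smul' := fun c x => by ext i j; simp }
  let L : (τ → ℂ) ≃ₗ[ℂ] (ι → Matrix (Fin n) (Fin n) ℂ) :=
    { toFun := fun w k => of fun i j => w (k, i, j)
      invFun := fun G t => G t.1 t.2.1 t.2.2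
      map_add' := fun x y => rfl
      map_smul' := fun c x => rfl
      left_inv := fun w => rfl
      right_inv := fun G => rfl }
  let x0 : σ → ℂ := Sum.elim (fun t => if t.1 = t.2 then 1 else 0)
    (Sum.elim (fun t => if t.2.1 = t.2.2 then 1 else 0) (fun t => if t.2.1 = t.2.2 then 1 else 0))
  let Oc : ι → Matrix (Fin n) (Fin n) ℂ := fun k => (O k).map (algebraMap ℝ ℂ)
  have eh : ∀ x i j, h x i j = x (Sum.inl (i, j)) := fun _ _ _ => rfl
  have eq : ∀ k x i j, q k x i j = if m1 k i j = true then x (Sum.inr (Sum.inl (k, i, j))) else 0 := fun _ _ _ _ => rfl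
  have ep : ∀ k x i j, p k x i j = if m2 k i j = true then x (Sum.inr (Sum.inr (k, i, j))) else 0 := fun _ _ _ _ => rfl
  clear_value h q p
  obtain ⟨U, hU, hUne, hUs⟩ := hm_open Oc h q p x0
    (by ext i j; simp [eh, x0, Matrix.one_apply])
    (by
      intro k; ext i j
      by_cases hij : i = j
      · subst hij; simp [eq, x0, h1]
      · simp [eq, x0, Matrix.one_apply, hij])
    (by
      intro k; ext i j
      by_cases hij : i = j
      · subst hij; simp [ep, x0, h2]
      · simp [ep, x0, Matrix.one_apply, hij])
    (by
      intro T
      obtain ⟨H, Q, P, hQ, hP, hT⟩ := hm_surj O hO m1 m2 hsec T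
      refine ⟨Sum.elim (fun t => H t.1 t.2) (Sum.elim (fun t => Q t.1 t.2.1 t.2.2) (fun t => P t.1 t.2.1 t.2.2)), fun k => ?_⟩
      rw [hT k]
      congr 1
      · congr 2
        · ext i j
          simp [eh]
        · ext i j
          by_cases hm : m1 k i j = true
          · simp [eq, hm]
          · simp [eq, hm, hQ k i j (by simpa using hm)]
      · congr 1
        ext i j
        by_cases hm : m2 k i j = true
        · simp [ep, hm]
        · simp [ep, hm, hP k i j (by simpa using hm)])
    L
  let Hp : Matrix (Fin n) (Fin n) (MvPolynomial σ ℂ) := of fun i j => MvPolynomial.X (Sum.inl (i, j))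
  let Op : ι → Matrix (Fin n) (Fin n) (MvPolynomial σ ℂ) := fun k => (Oc k).map MvPolynomial.C
  let Qp : ι → Matrix (Fin n) (Fin n) (MvPolynomial σ ℂ) := fun k => of fun i j => if m1 k i j = true then MvPolynomial.X (Sum.inr (Sum.inl (k, i, j))) else 0
  let Pp : ι → Matrix (Fin n) (Fin n) (MvPolynomial σ ℂ) := fun k => of fun i j => if m2 k i j = true then MvPolynomial.X (Sum.inr (Sum.inr (k, i, j))) else 0
  let F : τ → MvPolynomial σ ℂ := fun t => (Hp * Op t.1 * Qp t.1 * Pp t.1) t.2.1 t.2.2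
  have hF : ∀ (x : σ → ℂ) (k : ι) (i j : Fin n), MvPolynomial.eval x (F (k, i, j)) = (h x * Oc k * q k x * p k x) i j := by
    intro x k i j
    have e : (Hp * Op k * Qp k * Pp k).map (MvPolynomial.eval x) = h x * Oc k * q k x * p k x := by
      rw [Matrix.map_mul, Matrix.map_mul, Matrix.map_mul]
      congr 1
      · congr 1
        · congr 1
          · ext i j; simp [Hp, eh]
          · ext i j; simp [Op]
        · ext i j; simp only [Qp, eq, map_apply, of_apply]; split_ifs <;> simp
      · ext i j; simp only [Pp, ep, map_apply, of_apply]; split_ifs <;> simp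
    exact congrFun (congrFun e i) j
  have hdense := hm_dense F U hU hUne (by
    intro w hw
    obtain ⟨v, hv⟩ := hUs w hw
    refine ⟨v, funext fun t => ?_⟩
    obtain ⟨k, i, j⟩ := t
    simp only
    rw [hF, ← hv k]
    rfl)
  have hLc : Continuous L := by
    refine continuous_pi fun k => continuous_pi fun i => continuous_pi fun j => ?_
    exact continuous_apply (k, i, j)
  have hd2 : DenseRange (L ∘ fun x : σ → ℂ => fun j => MvPolynomial.eval x (F j)) :=
    DenseRange.comp L.surjective.denseRange hdense hLc
  refine Dense.mono ?_ hd2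
  rintro G ⟨x, rfl⟩
  refine ⟨h x, fun k => q k x, fun k => p k x, ?_, ?_, ?_⟩
  · intro k i j hm; simp [eq, hm]
  · intro k i j hm; simp [ep, hm]
  · intro k; ext i j; exact hF x k i j
theorem hm_gs {n : ℕ} (M : Matrix (Fin n) (Fin n) ℂ) (hM : IsUnit M) (L : Finset (Fin n)) (α : Fin n → ℝ)
    (hα : Monotone α) (hMα : ∀ i j, α j < α i → M i j = 0) :
    ∃ (U : Matrix (Fin n) L ℂ) (C C' : Matrix L L ℂ), Uᴴ * U = 1 ∧ U = (M.submatrix id Subtype.val : Matrix (Fin n) L ℂ) * C ∧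
      (M.submatrix id Subtype.val : Matrix (Fin n) L ℂ) = U * C' ∧ ∀ i (j : L), α j < α i → U i j = 0 := by
  let f : L → EuclideanSpace ℂ (Fin n) := fun j => WithLp.toLp 2 (fun i => M i j)
  have hli : LinearIndependent ℂ f := by
    have h1 := Matrix.linearIndependent_cols_of_isUnit hM
    have h2 := h1.comp (Subtype.val : L → Fin n) Subtype.val_injective
    have h3 := h2.map' (WithLp.linearEquiv 2 ℂ (Fin n → ℂ)).symm.toLinearMap (LinearEquiv.ker _)
    exact h3
  let u := InnerProductSpace.gramSchmidtNormed ℂ f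
  have hu : Orthonormal ℂ u := InnerProductSpace.gramSchmidtNormed_orthonormal hli
  have hsp : Submodule.span ℂ (Set.range u) = Submodule.span ℂ (Set.range f) := by
    rw [InnerProductSpace.span_gramSchmidtNormed_range, InnerProductSpace.span_gramSchmidt]
  have h1 : ∀ j, ∃ c : L → ℂ, ∑ i, c i • f i = u j := fun j =>
    (Submodule.mem_span_range_iff_exists_fun ℂ).1 (hsp ▸ Submodule.subset_span ⟨j, rfl⟩)
  have h2 : ∀ j, ∃ c : L → ℂ, ∑ i, c i • u i = f j := fun j =>
    (Submodule.mem_span_range_iff_exists_fun ℂ).1 (hsp ▸ Submodule.subset_span ⟨j, rfl⟩)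
  choose c hc using h1
  choose c' hc' using h2
  refine ⟨of fun i j => u j i, of fun i j => c j i, of fun i j => c' j i, ?_, ?_, ?_, ?_⟩
  · ext i j
    have := (orthonormal_iff_ite.1 hu) i j
    rw [PiLp.inner_apply] at this
    rw [mul_apply, Matrix.one_apply, ← this]
    refine Finset.sum_congr rfl fun k _ => ?_
    simp [mul_comm]
  · ext i j
    rw [of_apply, ← hc j, mul_apply]
    simp [f, mul_comm]
  · ext i j
    rw [submatrix_apply]
    have : M (id i) j = f j i := rfl
    rw [this, ← hc' j, mul_apply]
    simp [mul_comm]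
  · intro i j hij
    rw [of_apply]
    have hm : u j ∈ Submodule.span ℂ (f '' Set.Iic j) := by
      rw [← InnerProductSpace.span_gramSchmidt_Iic, ← InnerProductSpace.span_gramSchmidtNormed]
      exact Submodule.subset_span ⟨j, le_refl j, rfl⟩
    generalize u j = y at hm
    induction hm using Submodule.span_induction with
    | mem x hx =>
      obtain ⟨k, hk, rfl⟩ := hx
      exact hMα i k (lt_of_le_of_lt (hα hk) hij)
    | zero => rfl
    | add x y _ _ hx hy => simp [hx, hy]
    | smul a x _ hx => simp [hx]

theorem hm_T {n : ℕ} (M : Matrix (Fin n) (Fin n) ℂ) (hM : IsUnit M) (L : Finset (Fin n)) (α : Fin n → ℝ)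
    (hα : Monotone α) (hMα : ∀ i j, α j < α i → M i j = 0) :
    ∃ (R K : Matrix (Fin n) (Fin n) ℂ), Rᴴ = R ∧ R * R = R ∧ trace R = L.card ∧
      R = M * diagonal (fun i => if i ∈ L then 1 else 0) * K ∧
      R * (M * diagonal (fun i => if i ∈ L then 1 else 0)) = M * diagonal (fun i => if i ∈ L then 1 else 0) ∧
      (trace (diagonal (fun i => (α i : ℂ)) * R)).re ≤ ∑ j ∈ L, α j := by
  obtain ⟨U, C, C', hU, hUC, hUC', hUα⟩ := hm_gs M hM L α hα hMα
  let J : Matrix (Fin n) L ℂ := (1 : Matrix (Fin n) (Fin n) ℂ).submatrix id Subtype.val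
  have hN : (M.submatrix id Subtype.val : Matrix (Fin n) L ℂ) = M * J := by
    ext i j
    simp [J, mul_apply, Matrix.one_apply]
  have hJ : Jᵀ * J = 1 := by
    ext i j
    simp only [J, mul_apply, transpose_apply, submatrix_apply, id, Matrix.one_apply]
    rw [Finset.sum_eq_single (i : Fin n)]
    · by_cases hij : i = j
      · subst hij; simp
      · have : (i : Fin n) ≠ j := fun h => hij (Subtype.ext h)
        simp [hij, this]
    · intro k _ hk; simp [hk]
    · simp
  have hJ2 : J * Jᵀ = diagonal (fun i => if i ∈ L then 1 else 0) := by
    ext i j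
    simp only [J, mul_apply, transpose_apply, submatrix_apply, id, Matrix.one_apply, diagonal_apply]
    rw [Finset.sum_coe_sort L (fun k => (if i = k then (1 : ℂ) else 0) * if j = k then 1 else 0)]
    by_cases hij : i = j
    · subst hij; simp
    · simp [hij]
  rw [← hJ2]
  rw [hN] at hUC hUC'
  refine ⟨U * Uᴴ, J * C * Uᴴ, ?_, ?_, ?_, ?_, ?_, ?_⟩
  · simp
  · calc U * Uᴴ * (U * Uᴴ) = U * (Uᴴ * U) * Uᴴ := by simp only [Matrix.mul_assoc]
      _ = _ := by rw [hU, Matrix.mul_one]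
  · rw [trace_mul_comm, hU]; simp
  · calc U * Uᴴ = M * J * C * Uᴴ := by rw [← hUC]
      _ = M * J * (1 : Matrix L L ℂ) * C * Uᴴ := by rw [Matrix.mul_one]
      _ = _ := by rw [← hJ]; simp only [Matrix.mul_assoc]
  · rw [← Matrix.mul_assoc M, hUC']
    calc U * Uᴴ * (U * C' * Jᵀ) = U * (Uᴴ * U) * C' * Jᵀ := by simp only [Matrix.mul_assoc]
      _ = _ := by rw [hU, Matrix.mul_one]
  · have hnorm : ∀ j : L, ∑ i, Complex.normSq (U i j) = 1 := by
      intro j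
      have h := congrFun (congrFun hU j) j
      rw [mul_apply, Matrix.one_apply_eq] at h
      have h2 := congrArg Complex.re h
      rw [Complex.re_sum] at h2
      simpa [Complex.normSq_apply] using h2
    have e1 : (trace (diagonal (fun i => (α i : ℂ)) * (U * Uᴴ))).re = ∑ j : L, ∑ i, α i * Complex.normSq (U i j) := by
      rw [trace, Complex.re_sum, Finset.sum_comm]
      refine Finset.sum_congr rfl fun i _ => ?_
      rw [diag_apply, diagonal_mul, mul_apply, Complex.re_ofReal_mul, Complex.re_sum, Finset.mul_sum]
      refine Finset.sum_congr rfl fun j _ => ?_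
      simp [Complex.normSq_apply]
    rw [e1, ← Finset.sum_coe_sort L α]
    refine Finset.sum_le_sum fun j _ => ?_
    calc ∑ i, α i * Complex.normSq (U i j) ≤ ∑ i, α j * Complex.normSq (U i j) := by
          refine Finset.sum_le_sum fun i _ => ?_
          by_cases h : α j < α i
          · simp [hUα i j h]
          · exact mul_le_mul_of_nonneg_right (not_lt.1 h) (Complex.normSq_nonneg _)
      _ = α j := by rw [← Finset.mul_sum, hnorm, mul_one]
theorem hm_proj_compact (n : ℕ) : IsCompact {P : Matrix (Fin n) (Fin n) ℂ | Pᴴ = P ∧ P * P = P} := by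
  let B : Set (Matrix (Fin n) (Fin n) ℂ) := Set.univ.pi fun _ => Set.univ.pi fun _ => Metric.closedBall (0 : ℂ) 1
  have hB : IsCompact B := isCompact_univ_pi fun _ => isCompact_univ_pi fun _ => isCompact_closedBall _ _
  refine hB.of_isClosed_subset ?_ ?_
  · exact (isClosed_eq (by fun_prop) (by fun_prop)).inter (isClosed_eq (by fun_prop) (by fun_prop))
  · rintro P ⟨h1, h2⟩ i _ j _
    have h3 : (P i i).re = ∑ j, Complex.normSq (P i j) := by
      have h4 : P * Pᴴ = P := by rw [h1, h2]
      have h5 := congrArg Complex.re (congrFun (congrFun h4 i) i)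
      rw [mul_apply, Complex.re_sum] at h5
      rw [← h5]
      refine Finset.sum_congr rfl fun j _ => ?_
      simp [Complex.normSq_apply]
    have h4 : ∀ j, Complex.normSq (P i j) ≤ (P i i).re := by
      intro j
      rw [h3]
      exact Finset.single_le_sum (f := fun j => Complex.normSq (P i j)) (fun _ _ => Complex.normSq_nonneg _) (Finset.mem_univ j)
    have h5 := h4 i
    rw [Complex.normSq_apply] at h5
    have h6 : (P i i).re ≤ 1 := by nlinarith [mul_self_nonneg (P i i).im]
    have h7 := (h4 j).trans h6
    rw [Complex.normSq_eq_norm_sq] at h7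
    rw [mem_closedBall_zero_iff]
    nlinarith [norm_nonneg (P i j)]

theorem hm_closed {n : ℕ} {ι : Type} [Fintype ι] (D : ι → Matrix (Fin n) (Fin n) ℂ) (c : ι → ℝ) (r : ℂ) :
    IsClosed {G : ι → Matrix (Fin n) (Fin n) ℂ | ∃ (P : Matrix (Fin n) (Fin n) ℂ) (R : ι → Matrix (Fin n) (Fin n) ℂ),
      (Pᴴ = P ∧ P * P = P) ∧ trace P = r ∧ ∀ k, ((R k)ᴴ = R k ∧ R k * R k = R k) ∧ trace (R k) = r ∧
        P * G k * R k = G k * R k ∧ (trace (D k * R k)).re ≤ c k} := by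
  let X := {P : Matrix (Fin n) (Fin n) ℂ | Pᴴ = P ∧ P * P = P}
  have : CompactSpace X := isCompact_iff_compactSpace.1 (hm_proj_compact n)
  let Z : Set ((X × (ι → X)) × (ι → Matrix (Fin n) (Fin n) ℂ)) :=
    {t | trace (t.1.1 : Matrix (Fin n) (Fin n) ℂ) = r} ∩ ⋂ k, ({t | trace (t.1.2 k : Matrix (Fin n) (Fin n) ℂ) = r} ∩
      ({t | (t.1.1 : Matrix (Fin n) (Fin n) ℂ) * t.2 k * (t.1.2 k : Matrix (Fin n) (Fin n) ℂ) = t.2 k * (t.1.2 k : Matrix (Fin n) (Fin n) ℂ)} ∩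
        {t | (trace (D k * (t.1.2 k : Matrix (Fin n) (Fin n) ℂ))).re ≤ c k}))
  have c1 : Continuous fun t : (X × (ι → X)) × (ι → Matrix (Fin n) (Fin n) ℂ) => (t.1.1 : Matrix (Fin n) (Fin n) ℂ) :=
    continuous_subtype_val.comp (continuous_fst.comp continuous_fst)
  have c2 : ∀ k, Continuous fun t : (X × (ι → X)) × (ι → Matrix (Fin n) (Fin n) ℂ) => (t.1.2 k : Matrix (Fin n) (Fin n) ℂ) := fun k =>
    continuous_subtype_val.comp ((continuous_apply k).comp (continuous_snd.comp continuous_fst))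
  have c3 : ∀ k, Continuous fun t : (X × (ι → X)) × (ι → Matrix (Fin n) (Fin n) ℂ) => t.2 k := fun k =>
    (continuous_apply k).comp continuous_snd
  have hZ : IsClosed Z := by
    refine (isClosed_eq c1.matrix_trace continuous_const).inter (isClosed_iInter fun k => ?_)
    refine (isClosed_eq (c2 k).matrix_trace continuous_const).inter (IsClosed.inter ?_ ?_)
    · exact isClosed_eq ((c1.matrix_mul (c3 k)).matrix_mul (c2 k)) ((c3 k).matrix_mul (c2 k))
    · exact isClosed_le (Complex.continuous_re.comp (continuous_const.matrix_mul (c2 k)).matrix_trace) continuous_const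
  have h := isClosedMap_snd_of_compactSpace _ hZ
  convert h using 1
  ext G
  constructor
  · rintro ⟨P, R, hP, hr, hR⟩
    refine ⟨((⟨P, hP⟩, fun k => ⟨R k, (hR k).1⟩), G), ?_, rfl⟩
    refine ⟨hr, Set.mem_iInter.2 fun k => ⟨(hR k).2.1, (hR k).2.2.1, (hR k).2.2.2⟩⟩
  · rintro ⟨⟨⟨P, R⟩, G'⟩, ⟨hr, hR⟩, rfl⟩
    refine ⟨P, fun k => R k, P.2, hr, fun k => ⟨(R k).2, ?_⟩⟩
    have := Set.mem_iInter.1 hR k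
    exact ⟨this.1, this.2.1, this.2.2⟩

/-- a value of the polynomial map with invertible entries satisfies the projection condition -/
theorem hm_range {n : ℕ} {ι : Type} (k0 : ι) (O : ι → Matrix (Fin n) (Fin n) ℂ)
    (hO : ∀ k, (O k)ᵀ * O k = 1)
    (a : ι → Fin n → ℝ) (ha : ∀ k, Monotone (a k)) (L : ι → Finset (Fin n)) (r : ℕ) (hr : ∀ k, (L k).card = r)
    (hP : ∀ k, O k * diagonal (fun i => if i ∈ L k then (1 : ℂ) else 0) * (O k)ᵀ =
      O k0 * diagonal (fun i => if i ∈ L k0 then (1 : ℂ) else 0) * (O k0)ᵀ)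
    (G : ι → Matrix (Fin n) (Fin n) ℂ) (hG : ∀ k, IsUnit (G k))
    (H : Matrix (Fin n) (Fin n) ℂ) (Q P : ι → Matrix (Fin n) (Fin n) ℂ)
    (hQ : ∀ k i j, i ∉ L k → j ∈ L k → Q k i j = 0)
    (hPt : ∀ k i j, a k j < a k i → P k i j = 0)
    (hGe : ∀ k, G k = H * O k * Q k * P k) :
    ∃ (S : Matrix (Fin n) (Fin n) ℂ) (R : ι → Matrix (Fin n) (Fin n) ℂ),
      (Sᴴ = S ∧ S * S = S) ∧ trace S = r ∧ ∀ k, ((R k)ᴴ = R k ∧ R k * R k = R k) ∧ trace (R k) = r ∧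
        S * G k * R k = G k * R k ∧ (trace (diagonal (fun i => (a k i : ℂ)) * R k)).re ≤ ∑ j ∈ L k, a k j := by
  let p : ι → Matrix (Fin n) (Fin n) ℂ := fun k => diagonal (fun i => if i ∈ L k then (1 : ℂ) else 0)
  have hpp : ∀ k, p k * p k = p k := by
    intro k; simp only [p, diagonal_mul_diagonal]; congr 1; ext i; split_ifs <;> simp
  have hdet : ∀ k, IsUnit H.det ∧ IsUnit (O k).det ∧ IsUnit (P k).det := by
    intro k
    have := (Matrix.isUnit_iff_isUnit_det _).1 (hG k)
    rw [hGe, det_mul, det_mul, det_mul, IsUnit.mul_iff, IsUnit.mul_iff, IsUnit.mul_iff] at this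
    exact ⟨this.1.1.1, this.1.1.2, this.2⟩
  have hHO : IsUnit (H * O k0) := by
    rw [Matrix.isUnit_iff_isUnit_det, det_mul]
    exact (hdet k0).1.mul (hdet k0).2.1
  obtain ⟨S, K0, hS1, hS2, hS3, -, hS5, -⟩ := hm_T (H * O k0) hHO (L k0) (fun _ => 0) (fun _ _ _ => le_refl _)
    (fun i j h => absurd h (lt_irrefl _))
  have hSP : S * (H * (O k0 * p k0 * (O k0)ᵀ)) = H * (O k0 * p k0 * (O k0)ᵀ) := by
    have := congrArg (fun Z => Z * (O k0)ᵀ) hS5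
    simpa only [Matrix.mul_assoc] using this
  have hR : ∀ k, ∃ R : Matrix (Fin n) (Fin n) ℂ, (Rᴴ = R ∧ R * R = R) ∧ trace R = r ∧
        S * G k * R = G k * R ∧ (trace (diagonal (fun i => (a k i : ℂ)) * R)).re ≤ ∑ j ∈ L k, a k j := by
    intro k
    have hPu := (hdet k).2.2
    have : Invertible (P k) := invertibleOfIsUnitDet _ hPu
    have hbt : BlockTriangular (P k) (a k) := fun i j h => hPt k i j h
    have hbt' := blockTriangular_inv_of_blockTriangular hbt
    obtain ⟨R, K, h1, h2, h3, h4, -, h6⟩ := hm_T (P k)⁻¹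
      ((Matrix.isUnit_nonsing_inv_iff).2 ((Matrix.isUnit_iff_isUnit_det _).2 hPu)) (L k) (a k) (ha k)
      (fun i j h => hbt' h)
    refine ⟨R, ⟨h1, h2⟩, by rw [h3, hr], ?_, h6⟩
    have h4' : R = (P k)⁻¹ * p k * K := h4
    have hqp : Q k * p k = p k * Q k * p k := by
      ext i j
      simp only [p]
      rw [mul_diagonal, mul_diagonal, diagonal_mul]
      by_cases hj : j ∈ L k
      · by_cases hi : i ∈ L k
        · simp [hi]
        · simp [hQ k i j hi hj]
      · simp [hj]
    have e1 : G k * R = H * (O k0 * p k0 * (O k0)ᵀ) * (O k * Q k * p k * K) := by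
      rw [← hP k, hGe, h4']
      calc H * O k * Q k * P k * ((P k)⁻¹ * p k * K) = H * O k * Q k * (P k * (P k)⁻¹) * p k * K := by simp only [Matrix.mul_assoc]
        _ = H * O k * (Q k * p k) * K := by rw [Matrix.mul_nonsing_inv _ hPu]; simp only [Matrix.mul_assoc, Matrix.one_mul]
        _ = H * O k * p k * 1 * Q k * p k * K := by rw [hqp]; simp only [Matrix.mul_assoc, Matrix.one_mul]
        _ = _ := by rw [← hO k]; simp only [Matrix.mul_assoc, p]
    rw [Matrix.mul_assoc, e1, ← Matrix.mul_assoc, hSP]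
  choose R hR using hR
  exact ⟨S, R, ⟨hS1, hS2⟩, by rw [hS3, hr], hR⟩

open scoped ComplexOrder in
theorem hm_at_unitary {n : ℕ} {ι : Type} [Fintype ι] (a : ι → Fin n → ℝ) (c : ι → ℝ) (r : ℂ)
    (W : ι → Matrix (Fin n) (Fin n) ℂ) (hW : ∀ k, (W k)ᴴ * W k = 1)
    (hW0 : ∑ k, W k * diagonal (fun i => (a k i : ℂ)) * (W k)ᴴ = 0)
    (h : ∃ (P : Matrix (Fin n) (Fin n) ℂ) (R : ι → Matrix (Fin n) (Fin n) ℂ),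
      (Pᴴ = P ∧ P * P = P) ∧ trace P = r ∧ ∀ k, ((R k)ᴴ = R k ∧ R k * R k = R k) ∧ trace (R k) = r ∧
        P * W k * R k = W k * R k ∧ (trace (diagonal (fun i => (a k i : ℂ)) * R k)).re ≤ c k) :
    0 ≤ ∑ k, c k := by
  obtain ⟨P, R, ⟨hP1, hP2⟩, hPr, hR⟩ := h
  have hS : ∀ k, P = W k * R k * (W k)ᴴ := by
    intro k
    obtain ⟨⟨h1, h2⟩, h3, h4, -⟩ := hR k
    set S := W k * R k * (W k)ᴴ with hSd
    have hSh : Sᴴ = S := by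
      rw [hSd]; simp only [conjTranspose_mul, conjTranspose_conjTranspose, h1, Matrix.mul_assoc]
    have hSS : S * S = S := by
      calc S * S = W k * R k * ((W k)ᴴ * W k) * R k * (W k)ᴴ := by rw [hSd]; simp only [Matrix.mul_assoc]
        _ = W k * (R k * R k) * (W k)ᴴ := by rw [hW]; simp only [Matrix.mul_assoc, Matrix.one_mul]
        _ = S := by rw [h2]
    have hSt : trace S = r := by
      rw [hSd, trace_mul_comm, ← Matrix.mul_assoc, hW, Matrix.one_mul, h3]
    have hPS : P * S = S := by
      rw [hSd, ← Matrix.mul_assoc, ← Matrix.mul_assoc, h4]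
    have hSP : S * P = S := by
      have := congrArg conjTranspose hPS
      rwa [conjTranspose_mul, hSh, hP1] at this
    have h5 : (P - S) * (P - S)ᴴ = P - S := by
      rw [conjTranspose_sub, hP1, hSh, sub_mul, mul_sub, mul_sub, hP2, hPS, hSP, hSS]; abel
    have h6 : P - S = 0 := by
      refine (Matrix.trace_mul_conjTranspose_self_eq_zero_iff (A := P - S)).1 ?_
      rw [h5, trace_sub, hPr, hSt, sub_self]
    exact sub_eq_zero.1 h6
  have ht : ∀ k, trace (W k * diagonal (fun i => (a k i : ℂ)) * (W k)ᴴ * P) = trace (diagonal (fun i => (a k i : ℂ)) * R k) := by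
    intro k
    rw [hS k]
    calc _ = trace (W k * (diagonal (fun i => (a k i : ℂ)) * ((W k)ᴴ * W k) * R k * (W k)ᴴ)) := by simp only [Matrix.mul_assoc]
      _ = _ := by rw [hW, Matrix.mul_one, trace_mul_comm, Matrix.mul_assoc, hW, Matrix.mul_one]
  have h0 : (trace ((∑ k, W k * diagonal (fun i => (a k i : ℂ)) * (W k)ᴴ) * P)).re = 0 := by rw [hW0]; simp
  rw [Matrix.sum_mul, trace_sum, Complex.re_sum] at h0
  rw [← h0]
  refine Finset.sum_le_sum fun k _ => ?_
  rw [ht k]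
  exact (hR k).2.2.2

theorem hm_low {n : ℕ} (O O' : Matrix (Fin n) (Fin n) ℝ) (e e' : Fin n → ℝ)
    (hO : Oᵀ * O = 1) (hO' : O'ᵀ * O' = 1)
    (h : O * diagonal e * Oᵀ = O' * diagonal e' * O'ᵀ) :
    O * diagonal (fun i => if e i < 0 then (1 : ℝ) else 0) * Oᵀ =
      O' * diagonal (fun i => if e' i < 0 then (1 : ℝ) else 0) * O'ᵀ := by
  have hOo : O * Oᵀ = 1 := mul_eq_one_comm.1 hO
  have hOo' : O' * O'ᵀ = 1 := mul_eq_one_comm.1 hO'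
  have h1 : O'ᵀ * O * diagonal e = diagonal e' * (O'ᵀ * O) := by
    calc O'ᵀ * O * diagonal e = O'ᵀ * (O * diagonal e * Oᵀ) * O := by
          simp only [Matrix.mul_assoc, hO, Matrix.mul_one]
      _ = (O'ᵀ * O') * diagonal e' * (O'ᵀ * O) := by rw [h]; simp only [Matrix.mul_assoc]
      _ = _ := by rw [hO', Matrix.one_mul]
  have h2 : O'ᵀ * O * diagonal (fun i => if e i < 0 then (1 : ℝ) else 0) =
      diagonal (fun i => if e' i < 0 then (1 : ℝ) else 0) * (O'ᵀ * O) := by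
    ext i j
    have h3 := congrFun (congrFun h1 i) j
    rw [mul_diagonal, diagonal_mul] at h3 ⊢
    by_cases hx : (O'ᵀ * O) i j = 0
    · rw [hx]; simp
    · have : e j = e' i := by
        apply mul_left_cancel₀ hx; rw [h3, mul_comm]
      rw [this, mul_comm]
  calc O * diagonal (fun i => if e i < 0 then (1 : ℝ) else 0) * Oᵀ
      = O' * (O'ᵀ * O * diagonal (fun i => if e i < 0 then (1 : ℝ) else 0)) * Oᵀ := by
        rw [← Matrix.mul_assoc, ← Matrix.mul_assoc, hOo', Matrix.one_mul]
    _ = O' * diagonal (fun i => if e' i < 0 then (1 : ℝ) else 0) * O'ᵀ * (O * Oᵀ) := by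
        rw [h2]; simp only [Matrix.mul_assoc]
    _ = _ := by rw [hOo, Matrix.mul_one]

theorem hm_tr_low {n : ℕ} (O : Matrix (Fin n) (Fin n) ℝ) (e b : Fin n → ℝ) (hO : Oᵀ * O = 1) :
    trace ((O * diagonal b * Oᵀ) * (O * diagonal (fun i => if e i < 0 then (1 : ℝ) else 0) * Oᵀ)) =
      ∑ j ∈ Finset.univ.filter (fun j => e j < 0), b j := by
  have : (O * diagonal b * Oᵀ) * (O * diagonal (fun i => if e i < 0 then (1 : ℝ) else 0) * Oᵀ) =
      O * (diagonal b * diagonal (fun i => if e i < 0 then (1 : ℝ) else 0) * Oᵀ) := by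
    simp only [Matrix.mul_assoc]
    rw [← Matrix.mul_assoc Oᵀ O, hO, Matrix.one_mul]
  rw [this, trace_mul_comm, Matrix.mul_assoc, hO, Matrix.mul_one, diagonal_mul_diagonal, trace_diagonal,
    Finset.sum_filter]
  exact Finset.sum_congr rfl fun i _ => by split_ifs <;> simp

theorem hm_core {n : ℕ} {ι : Type} [Fintype ι] [DecidableEq ι] (k0 : ι)
    (A O : ι → Matrix (Fin n) (Fin n) ℝ) (a e : ι → Fin n → ℝ)
    (hmin : ∀ V : ι → Matrix (Fin n) (Fin n) ℝ, (∀ k, V k * (V k)ᵀ = 1) →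
      trace ((∑ k, A k) * (∑ k, A k)) ≤ trace ((∑ k, V k * A k * (V k)ᵀ) * (∑ k, V k * A k * (V k)ᵀ)))
    (hO : ∀ k, (O k)ᵀ * O k = 1) (ha : ∀ k, Monotone (a k))
    (hA : ∀ k, A k = O k * diagonal (a k) * (O k)ᵀ)
    (hE : ∀ k, ∑ j, A j = O k * diagonal (e k) * (O k)ᵀ)
    (W : ι → Matrix (Fin n) (Fin n) ℂ) (hW : ∀ k, (W k)ᴴ * W k = 1)
    (hW0 : ∑ k, W k * diagonal (fun i => (a k i : ℂ)) * (W k)ᴴ = 0) :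
    0 ≤ ∑ j ∈ Finset.univ.filter (fun j => e k0 j < 0), e k0 j := by
  classical
  have hOo : ∀ k, O k * (O k)ᵀ = 1 := fun k => mul_eq_one_comm.1 (hO k)
  have hlow : ∀ k, O k * diagonal (fun i => if e k i < 0 then (1 : ℝ) else 0) * (O k)ᵀ =
      O k0 * diagonal (fun i => if e k0 i < 0 then (1 : ℝ) else 0) * (O k0)ᵀ := fun k =>
    hm_low _ _ _ _ (hO k) (hO k0) (by rw [← hE, ← hE])
  let L : ι → Finset (Fin n) := fun k => Finset.univ.filter (fun j => e k j < 0)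
  have hr : ∀ k, (L k).card = (L k0).card := by
    intro k
    have h1 : ∀ k, trace (O k * diagonal (fun i => if e k i < 0 then (1 : ℝ) else 0) * (O k)ᵀ) = ((L k).card : ℝ) := by
      intro k
      rw [Matrix.mul_assoc, trace_mul_comm, Matrix.mul_assoc, hO, Matrix.mul_one, trace_diagonal]
      simp [L]
    have := congrArg trace (hlow k)
    rw [h1, h1] at this
    exact_mod_cast this
  let OC : ι → Matrix (Fin n) (Fin n) ℂ := fun k => (O k).map (algebraMap ℝ ℂ)
  have hOC : ∀ k, (OC k)ᵀ * OC k = 1 := by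
    intro k
    have := congrArg (fun M : Matrix (Fin n) (Fin n) ℝ => M.map (algebraMap ℝ ℂ)) (hO k)
    simp only [Matrix.map_mul] at this
    change ((O k).map (algebraMap ℝ ℂ))ᵀ * (O k).map (algebraMap ℝ ℂ) = _ at this
    rw [Matrix.map_one _ (map_zero _) (map_one _)] at this
    exact this
  have hPC : ∀ k, OC k * diagonal (fun i => if i ∈ L k then (1 : ℂ) else 0) * (OC k)ᵀ =
      OC k0 * diagonal (fun i => if i ∈ L k0 then (1 : ℂ) else 0) * (OC k0)ᵀ := by
    intro k
    have hd : ∀ k, (diagonal (fun i => if e k i < 0 then (1 : ℝ) else 0)).map (algebraMap ℝ ℂ) =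
        diagonal (fun i => if i ∈ L k then (1 : ℂ) else 0) := by
      intro k
      rw [diagonal_map (map_zero _)]
      congr 1
      ext i
      by_cases h : e k i < 0 <;> simp [L, h]
    have := congrArg (fun M : Matrix (Fin n) (Fin n) ℝ => M.map (algebraMap ℝ ℂ)) (hlow k)
    simp only [Matrix.map_mul, hd] at this
    exact this
  have hdense := hm_phi_dense O hOo (fun k i j => decide (¬ (0 ≤ e k i ∧ e k j < 0)))
    (fun k i j => decide (¬ (a k j < a k i))) (by intro k i; simp) (by intro k i; simp)
    (by
      intro z hz hs
      refine hm_second A O a e hmin hO hA hE z hz ?_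
      intro k i j hne
      have := hs k i j hne
      simp only [decide_eq_false_iff_not, not_not] at this
      exact ⟨this.1.1, this.1.2, this.2⟩)
  have hclosed := hm_closed (fun k => diagonal (fun i => (a k i : ℂ))) (fun k => ∑ j ∈ L k, a k j) ((L k0).card : ℂ)
  have hWmem := closure_minimal (s := {G : ι → Matrix (Fin n) (Fin n) ℂ | ∃ (H : Matrix (Fin n) (Fin n) ℂ) (Q P : ι → Matrix (Fin n) (Fin n) ℂ), (∀ k i j, decide (¬ (0 ≤ e k i ∧ e k j < 0)) = false → Q k i j = 0) ∧ (∀ k i j, decide (¬ (a k j < a k i)) = false → P k i j = 0) ∧ ∀ k, G k = H * (O k).map (algebraMap ℝ ℂ) * Q k * P k} ∩ {G : ι → Matrix (Fin n) (Fin n) ℂ | ∀ k, (G k).det ≠ 0}) (by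
      rintro G ⟨⟨H, Q, P, hQ, hP, hG⟩, hdet⟩
      refine hm_range k0 OC hOC a ha L _ hr hPC G (fun k => ?_) H Q P ?_ ?_ hG
      · rw [Matrix.isUnit_iff_isUnit_det]; exact (hdet k).isUnit
      · intro k i j hi hj
        apply hQ
        simp only [L, Finset.mem_filter, Finset.mem_univ, true_and, not_lt] at hi hj
        simp [hi, hj]
      · intro k i j hij
        apply hP
        simp [hij]) hclosed
  have hopen : IsOpen {G : ι → Matrix (Fin n) (Fin n) ℂ | ∀ k, (G k).det ≠ 0} := by
    simp only [Set.ofPred_forall]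
    refine isOpen_iInter_of_finite fun k => ?_
    exact isOpen_ne.preimage ((continuous_apply k).matrix_det)
  have hWc : W ∈ closure ({G : ι → Matrix (Fin n) (Fin n) ℂ | ∃ (H : Matrix (Fin n) (Fin n) ℂ) (Q P : ι → Matrix (Fin n) (Fin n) ℂ), (∀ k i j, decide (¬ (0 ≤ e k i ∧ e k j < 0)) = false → Q k i j = 0) ∧ (∀ k i j, decide (¬ (a k j < a k i)) = false → P k i j = 0) ∧ ∀ k, G k = H * (O k).map (algebraMap ℝ ℂ) * Q k * P k} ∩ {G : ι → Matrix (Fin n) (Fin n) ℂ | ∀ k, (G k).det ≠ 0}) := by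
    rw [Set.inter_comm]
    apply hdense.open_subset_closure_inter hopen
    intro k h0
    have := congrArg det (hW k)
    rw [det_mul, h0] at this
    simp at this
  have h0 := hm_at_unitary a (fun k => ∑ j ∈ L k, a k j) _ W hW hW0 (hWmem hWc)
  have h1 : ∀ k, ∑ j ∈ L k, a k j = trace (A k * (O k0 * diagonal (fun i => if e k0 i < 0 then (1 : ℝ) else 0) * (O k0)ᵀ)) := by
    intro k
    rw [← hlow k, hA, hm_tr_low _ _ _ (hO k)]
  rw [Finset.sum_congr rfl fun k _ => h1 k, ← trace_sum, ← Finset.sum_mul, hE k0, hm_tr_low _ _ _ (hO k0)] at h0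
  exact h0

theorem hm_general {n : ℕ} {ι : Type} [Fintype ι] [DecidableEq ι] [Nonempty ι] (d : ι → Fin n → ℝ)
    (U : ι → Matrix (Fin n) (Fin n) ℂ) (hU : ∀ k, (U k)ᴴ * U k = 1)
    (hU0 : ∑ k, U k * diagonal (fun i => (d k i : ℂ)) * (U k)ᴴ = 0) :
    ∃ O : ι → Matrix (Fin n) (Fin n) ℝ, (∀ k, O k * (O k)ᵀ = 1) ∧
      ∑ k, O k * diagonal (d k) * (O k)ᵀ = 0 := by
  obtain ⟨O1, hO1, hmin1⟩ := hm_min (fun k => diagonal (d k))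
  refine ⟨O1, hO1, ?_⟩
  have hO1' : ∀ k, (O1 k)ᵀ * O1 k = 1 := fun k => mul_eq_one_comm.1 (hO1 k)
  let A : ι → Matrix (Fin n) (Fin n) ℝ := fun k => O1 k * diagonal (d k) * (O1 k)ᵀ
  have hAt : ∀ k, (A k)ᵀ = A k := by
    intro k
    simp [A, transpose_mul, Matrix.mul_assoc]
  have hEt : (∑ k, A k)ᵀ = ∑ k, A k := by
    rw [transpose_sum]; exact Finset.sum_congr rfl fun k _ => hAt k
  have hmin : ∀ V : ι → Matrix (Fin n) (Fin n) ℝ, (∀ k, V k * (V k)ᵀ = 1) →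
      trace ((∑ k, A k) * (∑ k, A k)) ≤ trace ((∑ k, V k * A k * (V k)ᵀ) * (∑ k, V k * A k * (V k)ᵀ)) := by
    intro V hV
    have h1 := hmin1 (fun k => V k * O1 k) (by
      intro k
      rw [transpose_mul, Matrix.mul_assoc, ← Matrix.mul_assoc (O1 k), hO1, Matrix.one_mul, hV])
    have h2 : ∀ k, V k * O1 k * diagonal (d k) * (V k * O1 k)ᵀ = V k * A k * (V k)ᵀ := by
      intro k; simp only [A, transpose_mul, Matrix.mul_assoc]
    simp only [h2] at h1
    exact h1
  have hj := fun k => hm_joint (A k) (∑ j, A j) (hAt k) hEt (hm_comm A hAt hmin k)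
  choose O a e hO hO' ha hA hE using hj
  let k0 : ι := Classical.arbitrary ι
  let W : ι → Matrix (Fin n) (Fin n) ℂ := fun k => U k * ((O1 k)ᵀ * O k).map (algebraMap ℝ ℂ)
  have hstar : ∀ M : Matrix (Fin n) (Fin n) ℝ, (M.map (algebraMap ℝ ℂ))ᴴ = Mᵀ.map (algebraMap ℝ ℂ) := by
    intro M; ext i j; simp
  have hW : ∀ k, (W k)ᴴ * W k = 1 := by
    intro k
    simp only [W, conjTranspose_mul, hstar]
    rw [Matrix.mul_assoc, ← Matrix.mul_assoc (U k)ᴴ, hU, Matrix.one_mul, ← Matrix.map_mul, transpose_mul,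
      transpose_transpose, Matrix.mul_assoc, ← Matrix.mul_assoc (O1 k), hO1, Matrix.one_mul, hO]
    simp
  have hdm : ∀ b : Fin n → ℝ, diagonal (fun i => (b i : ℂ)) = (diagonal b).map (algebraMap ℝ ℂ) := by
    intro b; rw [diagonal_map (map_zero _)]; rfl
  have hWd : ∀ k, W k * diagonal (fun i => (a k i : ℂ)) * (W k)ᴴ = U k * diagonal (fun i => (d k i : ℂ)) * (U k)ᴴ := by
    intro k
    have h1 : ((O1 k)ᵀ * O k) * diagonal (a k) * ((O1 k)ᵀ * O k)ᵀ = diagonal (d k) := by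
      calc ((O1 k)ᵀ * O k) * diagonal (a k) * ((O1 k)ᵀ * O k)ᵀ = (O1 k)ᵀ * (O k * diagonal (a k) * (O k)ᵀ) * O1 k := by
            simp only [transpose_mul, transpose_transpose, Matrix.mul_assoc]
        _ = ((O1 k)ᵀ * O1 k) * diagonal (d k) * ((O1 k)ᵀ * O1 k) := by
            rw [← hA]; simp only [A, Matrix.mul_assoc]
        _ = _ := by rw [hO1', Matrix.one_mul, Matrix.mul_one]
    rw [hdm, hdm, ← h1]
    simp only [W, conjTranspose_mul, hstar, transpose_mul, Matrix.map_mul, Matrix.mul_assoc]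
  have hcore := hm_core k0 A O a e hmin hO ha hA hE W hW (by rw [← hU0]; exact Finset.sum_congr rfl fun k _ => hWd k)
  have htr : ∑ i, e k0 i = 0 := by
    have h1 : trace (∑ j, A j) = ∑ i, e k0 i := by
      rw [hE k0, Matrix.mul_assoc, trace_mul_comm, Matrix.mul_assoc, hO, Matrix.mul_one, trace_diagonal]
    have h2 : trace (∑ j, A j) = ∑ k, ∑ i, d k i := by
      rw [trace_sum]
      refine Finset.sum_congr rfl fun k _ => ?_
      simp only [A]
      rw [Matrix.mul_assoc, trace_mul_comm, Matrix.mul_assoc, hO1', Matrix.mul_one, trace_diagonal]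
    have h3 := congrArg trace hU0
    rw [trace_sum, trace_zero, Finset.sum_congr rfl (g := fun k => ∑ i, (d k i : ℂ)) (fun k _ => by
      rw [Matrix.mul_assoc, trace_mul_comm, Matrix.mul_assoc, hU, Matrix.mul_one, trace_diagonal])] at h3
    rw [← h1, h2]
    exact_mod_cast h3
  have hnn : ∀ i, 0 ≤ e k0 i := by
    by_contra! hc
    obtain ⟨i, hi⟩ := hc
    have : ∑ j ∈ Finset.univ.filter (fun j => e k0 j < 0), e k0 j < 0 :=
      Finset.sum_neg (fun j hj => (Finset.mem_filter.1 hj).2) ⟨i, by simp [hi]⟩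
    linarith
  have hz : e k0 = 0 := by
    ext i
    exact (Finset.sum_eq_zero_iff_of_nonneg fun i _ => hnn i).1 htr i (Finset.mem_univ i)
  have := hE k0
  rw [hz] at this
  change ∑ j, A j = 0
  rw [this]
  simp

theorem hm_charpoly_conj {n : ℕ} (O : Matrix (Fin n) (Fin n) ℝ) (hO : O * Oᵀ = 1) (d : Fin n → ℝ) :
    (O * diagonal d * Oᵀ).charpoly = ∏ i, (Polynomial.X - Polynomial.C (d i)) := by
  rw [Matrix.charpoly_mul_comm, ← Matrix.mul_assoc, mul_eq_one_comm.1 hO, Matrix.one_mul, Matrix.charpoly_diagonal]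

/-- For weakly decreasing `λ, μ, ν ∈ ℝ^n`, there exist complex
Hermitian `n×n` matrices `A, B` with ordered spectra `λ, μ` and `A + B` of ordered
spectrum `ν`, iff there exist real symmetric `n×n` matrices with the same property. -/
theorem hermitian_iff_symmetric_spectra (n : ℕ) (lam mu ν : Fin n → ℝ)
    (hlam : Antitone lam) (hmu : Antitone mu) (hν : Antitone ν) :
    (∃ A B : Matrix (Fin n) (Fin n) ℂ, A.IsHermitian ∧ B.IsHermitian ∧
      HasOrdSpecC A lam ∧ HasOrdSpecC B mu ∧ HasOrdSpecC (A + B) ν) ↔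
    (∃ A' B' : Matrix (Fin n) (Fin n) ℝ, A'.IsSymm ∧ B'.IsSymm ∧
      HasOrdSpecR A' lam ∧ HasOrdSpecR B' mu ∧ HasOrdSpecR (A' + B') ν) := by
  constructor
  · rintro ⟨A, B, hA, hB, ⟨-, hA1⟩, ⟨-, hB1⟩, ⟨-, hC1⟩⟩
    obtain ⟨U0, hU0, hA2⟩ := hm_diag A hA lam hA1
    obtain ⟨U1, hU1, hB2⟩ := hm_diag B hB mu hB1
    obtain ⟨U2, hU2, hC2⟩ := hm_diag (A + B) (hA.add hB) ν hC1
    obtain ⟨O, hO, hs⟩ := hm_general (ι := Fin 3) ![lam, mu, -ν] ![U0, U1, U2]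
      (by intro k; fin_cases k <;> simp [hU0, hU1, hU2])
      (by
        have hneg : (diagonal (fun i => (((-ν) i : ℝ) : ℂ)) : Matrix (Fin n) (Fin n) ℂ) =
            - diagonal (fun i => (ν i : ℂ)) := by
          rw [diagonal_neg]; congr 1; ext i; simp
        rw [Fin.sum_univ_three]
        change U0 * diagonal (fun i => (lam i : ℂ)) * U0ᴴ + U1 * diagonal (fun i => (mu i : ℂ)) * U1ᴴ +
          U2 * diagonal (fun i => (((-ν) i : ℝ) : ℂ)) * U2ᴴ = 0
        rw [hneg, Matrix.mul_neg, Matrix.neg_mul, ← hA2, ← hB2, ← hC2, add_neg_cancel])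
    have hsum : O 0 * diagonal lam * (O 0)ᵀ + O 1 * diagonal mu * (O 1)ᵀ = O 2 * diagonal ν * (O 2)ᵀ := by
      rw [Fin.sum_univ_three] at hs
      change O 0 * diagonal lam * (O 0)ᵀ + O 1 * diagonal mu * (O 1)ᵀ + O 2 * diagonal (-ν) * (O 2)ᵀ = 0 at hs
      have hneg : (diagonal (-ν) : Matrix (Fin n) (Fin n) ℝ) = - diagonal ν := (diagonal_neg ν).symm
      rw [hneg, Matrix.mul_neg, Matrix.neg_mul] at hs
      exact eq_of_sub_eq_zero (by rw [sub_eq_add_neg]; exact hs)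
    refine ⟨O 0 * diagonal lam * (O 0)ᵀ, O 1 * diagonal mu * (O 1)ᵀ, ?_, ?_, ⟨hlam, hm_charpoly_conj _ (hO 0) _⟩,
      ⟨hmu, hm_charpoly_conj _ (hO 1) _⟩, hν, ?_⟩
    · simp [Matrix.IsSymm, transpose_mul, Matrix.mul_assoc]
    · simp [Matrix.IsSymm, transpose_mul, Matrix.mul_assoc]
    · rw [hsum]; exact hm_charpoly_conj _ (hO 2) _
  · rintro ⟨A, B, hA, hB, ⟨-, hA1⟩, ⟨-, hB1⟩, ⟨-, hC1⟩⟩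
    have hh : ∀ M : Matrix (Fin n) (Fin n) ℝ, M.IsSymm → (M.map (algebraMap ℝ ℂ)).IsHermitian := by
      intro M hM
      ext i j
      have := congrFun (congrFun hM i) j
      simp only [transpose_apply] at this
      simp [this]
    have hc : ∀ (M : Matrix (Fin n) (Fin n) ℝ) (l : Fin n → ℝ),
        M.charpoly = ∏ i, (Polynomial.X - Polynomial.C (l i)) →
        (M.map (algebraMap ℝ ℂ)).charpoly = ∏ i, (Polynomial.X - Polynomial.C ((l i : ℂ))) := by
      intro M l h
      rw [Matrix.charpoly_map, h, Polynomial.map_prod]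
      simp
    refine ⟨A.map (algebraMap ℝ ℂ), B.map (algebraMap ℝ ℂ), hh A hA, hh B hB, ⟨hlam, hc _ _ hA1⟩, ⟨hmu, hc _ _ hB1⟩,
      hν, ?_⟩
    rw [← Matrix.map_add _ (map_add _)]
    exact hc _ _ hC1
end

section
/- Let λ and μ be weakly decreasing sequences of n real numbers. The set of ordered spectra of matrices A + B, where A and B range over complex Hermitian n×n matrices with ordered spectra λ and μ respectively, is a convex subset of ℝ^n. -/
open Matrix

/-- automorphisms of `ℂ` over a subfield act transitively on transcendental elements -/
theorem hs_exists_auto (F : Subfield ℂ) (t t' : ℂ) (ht : Transcendental F t)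
    (ht' : Transcendental F t') : ∃ σ : ℂ ≃+* ℂ, σ t = t' ∧ ∀ x ∈ F, σ x = x := by
  have h1 : AlgebraicIndepOn F id ({t} : Set ℂ) :=
    (algebraicIndependent_singleton_iff (⟨t, rfl⟩ : ({t} : Set ℂ))).2 ht
  have h2 : AlgebraicIndepOn F id ({t'} : Set ℂ) :=
    (algebraicIndependent_singleton_iff (⟨t', rfl⟩ : ({t'} : Set ℂ))).2 ht'
  obtain ⟨T, hT, hTb⟩ := exists_isTranscendenceBasis_superset h1
  obtain ⟨T', hT', hTb'⟩ := exists_isTranscendenceBasis_superset h2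
  have hc := hTb.lift_cardinalMk_eq hTb'
  simp only [Cardinal.lift_id] at hc
  obtain ⟨e0⟩ := Cardinal.eq.1 hc
  let a : T := ⟨t, hT rfl⟩
  let b : T' := ⟨t', hT' rfl⟩
  let e1 : T ≃ T' := e0.trans (Equiv.swap (e0 a) b)
  have he1 : e1 a = b := by simp [e1]
  let := IsAlgClosed.isAlgClosure_of_transcendence_basis _ hTb
  let := IsAlgClosed.isAlgClosure_of_transcendence_basis _ hTb'
  let e : Algebra.adjoin F (Set.range (Subtype.val : T → ℂ)) ≃ₐ[F]
      Algebra.adjoin F (Set.range (Subtype.val : T' → ℂ)) :=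
    (hTb.1.aevalEquiv.symm.trans (MvPolynomial.renameEquiv F e1)).trans hTb'.1.aevalEquiv
  let σ := IsAlgClosure.equivOfEquiv ℂ ℂ e.toRingEquiv
  have hσ : ∀ x, σ (algebraMap _ ℂ x) = algebraMap _ ℂ (e x) := fun x =>
    IsAlgClosure.equivOfEquiv_algebraMap ℂ ℂ e.toRingEquiv x
  refine ⟨σ, ?_, ?_⟩
  · have h := hσ (hTb.1.aevalEquiv (MvPolynomial.X a))
    simp only [e, AlgEquiv.trans_apply, AlgEquiv.symm_apply_apply,
      MvPolynomial.renameEquiv_apply, MvPolynomial.rename_X, he1] at h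
    simpa [a, b] using h
  · intro x hx
    have h := hσ (algebraMap F _ ⟨x, hx⟩)
    rw [e.commutes] at h
    exact h

theorem hs_exists_transc (s : Set ℂ) (hs : s.Countable) :
    ∃ t : ℂ, Transcendental (Subfield.closure s) t := by
  have hc : Countable (Subfield.closure s) := by
    have := Subfield.cardinalMk_closure_le_max s
    rw [← Cardinal.mk_le_aleph0_iff]
    refine this.trans (max_le ?_ le_rfl)
    exact Cardinal.mk_le_aleph0_iff.2 hs
  have := Algebraic.countable (Subfield.closure s) ℂ
  by_contra! h
  have h2 : {x : ℂ | IsAlgebraic (Subfield.closure s) x} = Set.univ := by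
    ext x; simpa [Transcendental] using h x
  rw [h2] at this
  exact not_countable_complex this

theorem hs_transc_affine (F : Subfield ℂ) (t : ℂ) (ht : Transcendental F t) (q r : ℂ) (hq : q ∈ F)
    (hr : r ∈ F) (hr0 : r ≠ 0) : Transcendental F (q + r * t) := by
  intro h
  apply ht
  have h1 : IsAlgebraic F (r⁻¹ * ((q + r * t) - q)) := by
    refine IsAlgebraic.mul ?_ (h.sub ?_)
    · exact isAlgebraic_algebraMap (A := ℂ) (⟨r⁻¹, F.inv_mem hr⟩ : F)
    · exact isAlgebraic_algebraMap (A := ℂ) (⟨q, hq⟩ : F)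
  convert h1 using 1
  field_simp
  ring

/-- the standard flag -/
def hsE (n i : ℕ) : Submodule ℂ (Fin n → ℂ) where
  carrier := {v | ∀ j : Fin n, i ≤ j.val → v j = 0}
  add_mem' := by intro a b ha hb j hj; simp [ha j hj, hb j hj]
  zero_mem' := by intro j _; rfl
  smul_mem' := by intro c a ha j hj; simp [ha j hj]

theorem mem_hsE {n i : ℕ} {v : Fin n → ℂ} : v ∈ hsE n i ↔ ∀ j : Fin n, i ≤ j.val → v j = 0 :=
  Iff.rfl

theorem hsE_zero (n : ℕ) : hsE n 0 = ⊥ := by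
  ext v; simp [mem_hsE, funext_iff]

theorem hsE_top (n : ℕ) : hsE n n = ⊤ := by
  ext v; simp only [mem_hsE, Submodule.mem_top, iff_true]; intro j hj; have := j.2; omega

/-- weighted dimension -/
noncomputable def hsS {n : ℕ} (w : Fin n → ℝ) (W : Submodule ℂ (Fin n → ℂ)) : ℝ :=
  ∑ j : Fin n, w j * ((Module.finrank ℂ (W ⊓ hsE n (j.val + 1) : Submodule ℂ (Fin n → ℂ)) : ℝ)
    - (Module.finrank ℂ (W ⊓ hsE n j.val : Submodule ℂ (Fin n → ℂ)) : ℝ))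

theorem hs_abel0 (n : ℕ) (w c : ℕ → ℝ) (hw : ∀ i, i + 1 < n → w (i + 1) ≤ w i)
    (hc0 : c 0 = 0) (hc : ∀ i ≤ n, 0 ≤ c i) (m : ℕ) (hm : m + 1 ≤ n) :
    w m * c (m + 1) ≤ ∑ j ∈ Finset.range (m + 1), w j * (c (j + 1) - c j) := by
  induction m with
  | zero => simp [hc0]
  | succ m ih =>
    rw [Finset.sum_range_succ]
    have h1 := ih (by omega)
    have h2 := hw m (by omega)
    have h3 := hc (m + 1) (by omega)
    nlinarith

theorem hs_abel {n : ℕ} (w : Fin n → ℝ) (hw : Antitone w) (a b : ℕ → ℝ) (h0 : a 0 = b 0)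
    (hn : a n = b n) (hab : ∀ i ≤ n, a i ≤ b i) :
    ∑ j : Fin n, w j * (a (j.val + 1) - a j.val) ≤
      ∑ j : Fin n, w j * (b (j.val + 1) - b j.val) := by
  rcases n with _ | m
  · simp
  let w' : ℕ → ℝ := fun i => if h : i < m + 1 then w ⟨i, h⟩ else 0
  have key := hs_abel0 (m + 1) w' (fun i => b i - a i)
    (by
      intro i hi
      have hi' : i < m + 1 := by omega
      simp only [w', hi, hi', dif_pos]
      exact hw (by simp [Fin.le_def]))
    (by simp [h0]) (fun i hi => sub_nonneg.2 (hab i hi)) m le_rfl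
  simp only [hn, sub_self, mul_zero] at key
  rw [← sub_nonneg, ← Finset.sum_sub_distrib]
  rw [← Fin.sum_univ_eq_sum_range (fun j => w' j * (b (j + 1) - a (j + 1) - (b j - a j)))] at key
  convert key using 1
  refine Finset.sum_congr rfl fun j _ => ?_
  have : w' j.val = w j := by simp only [w', j.2, dif_pos]
  rw [this]; ring

theorem hs_jump {n : ℕ} (a : Fin n → ℝ) (j : Fin n) :
    (∑ l, if l.val < j.val + 1 then a l else 0) - (∑ l, if l.val < j.val then a l else 0) = a j := by
  rw [← Finset.sum_sub_distrib]
  rw [Finset.sum_eq_single j]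
  · simp
  · intro b _ hb
    have : b.val ≠ j.val := fun h => hb (Fin.ext h)
    by_cases h1 : b.val < j.val
    · have : b.val < j.val + 1 := by omega
      simp [h1, this]
    · have : ¬ b.val < j.val + 1 := by omega
      simp [h1, this]
  · simp

/-- `P` is the orthogonal projection matrix onto `W` -/
structure hsProj {n : ℕ} (P : Matrix (Fin n) (Fin n) ℂ) (W : Submodule ℂ (Fin n → ℂ)) : Prop where
  herm : Pᴴ = P
  idem : P * P = P
  mem : ∀ v, v ∈ W ↔ P *ᵥ v = v

theorem hsProj.trace {n : ℕ} {P : Matrix (Fin n) (Fin n) ℂ} {W : Submodule ℂ (Fin n → ℂ)}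
    (h : hsProj P W) : P.trace = (Module.finrank ℂ W : ℂ) := by
  have hp : LinearMap.IsProj W (Matrix.toLin' P) := by
    constructor
    · intro x
      rw [h.mem, Matrix.toLin'_apply, Matrix.mulVec_mulVec, h.idem]
    · intro x hx
      rw [Matrix.toLin'_apply]; exact (h.mem x).1 hx
  rw [← hp.trace, Matrix.trace_toLin'_eq]

/-- existence of a subspace for a projection matrix -/
theorem hsProj_of {n : ℕ} (P : Matrix (Fin n) (Fin n) ℂ) (h1 : Pᴴ = P) (h2 : P * P = P) :
    ∃ W, hsProj P W := by
  refine ⟨LinearMap.ker (Matrix.toLin' P - LinearMap.id), h1, h2, fun v => ?_⟩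
  simp [sub_eq_zero]

theorem hsProj_exists {n : ℕ} (W : Submodule ℂ (Fin n → ℂ)) : ∃ P, hsProj P W := by
  let e := (WithLp.linearEquiv 2 ℂ (Fin n → ℂ))
  let W' : Submodule ℂ (EuclideanSpace ℂ (Fin n)) := W.comap e.toLinearMap
  let p : EuclideanSpace ℂ (Fin n) →ₗ[ℂ] EuclideanSpace ℂ (Fin n) := W'.starProjection.toLinearMap
  let P : Matrix (Fin n) (Fin n) ℂ := Matrix.toEuclideanLin.symm p
  have hP : Matrix.toEuclideanLin P = p := by simp [P]
  have hv : ∀ v : Fin n → ℂ, P *ᵥ v = (p (WithLp.toLp 2 v)).ofLp := by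
    intro v; rw [← hP]; simp
  refine ⟨P, ?_, ?_, ?_⟩
  · have : P.IsHermitian := by
      rw [← Matrix.isSymmetric_toEuclideanLin_iff, hP]
      exact W'.starProjection_isSymmetric
    exact this
  · apply Matrix.toLin'.injective
    ext1 i
    ext1
    simp only [LinearMap.comp_apply, Matrix.toLin'_apply, Matrix.toLin'_mul, hv]
    congr 1
    exact DFunLike.congr_fun (W'.isIdempotentElem_starProjection.eq)
      (WithLp.toLp 2 ((LinearMap.single ℂ (fun _ => ℂ) i) 1))
  · intro v
    rw [hv]
    have : v ∈ W ↔ WithLp.toLp 2 v ∈ W' := Iff.rfl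
    rw [this, ← Submodule.starProjection_eq_self_iff]
    constructor
    · intro h
      change ((W'.starProjection) (WithLp.toLp 2 v)).ofLp = v
      rw [h]
    · intro h
      change (W'.starProjection) (WithLp.toLp 2 v) = _
      exact congrArg (WithLp.toLp 2) h

theorem hsProj.mul_of_le {n : ℕ} {P Q : Matrix (Fin n) (Fin n) ℂ} {V W : Submodule ℂ (Fin n → ℂ)}
    (hP : hsProj P V) (hQ : hsProj Q W) (h : W ≤ V) : P * Q = Q := by
  apply Matrix.toLin'.injective
  apply LinearMap.ext
  intro v
  rw [Matrix.toLin'_mul, LinearMap.comp_apply, Matrix.toLin'_apply, Matrix.toLin'_apply]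
  refine (hP.mem _).1 (h ((hQ.mem _).2 ?_))
  rw [Matrix.mulVec_mulVec, hQ.idem]

theorem hs_diag_nonneg {n : ℕ} {P : Matrix (Fin n) (Fin n) ℂ} (h1 : Pᴴ = P) (h2 : P * P = P)
    (j : Fin n) : 0 ≤ (P j j).re := by
  have : P j j = ∑ l, P j l * star (P j l) := by
    conv_lhs => rw [← h2]
    rw [Matrix.mul_apply]
    refine Finset.sum_congr rfl fun l _ => ?_
    conv_lhs => rw [← h1]
    conv_rhs => rw [← h1]
    simp only [Matrix.conjTranspose_apply]
    congr 1
    conv_lhs => rw [← h1]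
    simp
  rw [this, Complex.re_sum]
  refine Finset.sum_nonneg fun l _ => ?_
  rw [Complex.star_def, Complex.mul_conj]
  exact Complex.normSq_nonneg _

theorem hsProj.entry_bound {n : ℕ} {P : Matrix (Fin n) (Fin n) ℂ} (h1 : Pᴴ = P) (h2 : P * P = P)
    (i j : Fin n) : ‖P i j‖ ≤ 1 := by
  have hs : ∀ i j, star (P i j) = P j i := by
    intro i j; conv_rhs => rw [← h1]
    rfl
  have h3 : ∀ i, (P i i).re = ∑ l, ‖P i l‖ ^ 2 := by
    intro i
    conv_lhs => rw [← h2]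
    rw [Matrix.mul_apply, Complex.re_sum]
    refine Finset.sum_congr rfl fun l _ => ?_
    rw [← hs i l, Complex.star_def, Complex.mul_conj, Complex.normSq_eq_norm_sq]
    exact_mod_cast rfl
  have h4 : ‖P i i‖ ^ 2 ≤ (P i i).re := by
    rw [h3]; exact Finset.single_le_sum (f := fun l => ‖P i l‖ ^ 2) (fun _ _ => by positivity) (Finset.mem_univ i)
  have h5 : ‖P i j‖ ^ 2 ≤ (P i i).re := by
    rw [h3]; exact Finset.single_le_sum (f := fun l => ‖P i l‖ ^ 2) (fun _ _ => by positivity) (Finset.mem_univ j)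
  have h6 := Complex.re_le_norm (P i i)
  have h7 := norm_nonneg (P i i)
  have h8 := norm_nonneg (P i j)
  have h9 : (P i i).re ≤ 1 := by nlinarith
  nlinarith

theorem hs_key {n : ℕ} {P : Matrix (Fin n) (Fin n) ℂ} {W : Submodule ℂ (Fin n → ℂ)}
    (hP : hsProj P W) (w : Fin n → ℝ) (hw : Antitone w) :
    hsS w W ≤ ∑ j, w j * (P j j).re := by
  have h := hs_abel w hw
    (fun i => (Module.finrank ℂ (W ⊓ hsE n i : Submodule ℂ (Fin n → ℂ)) : ℝ))
    (fun i => ∑ l : Fin n, if l.val < i then (P l l).re else 0) ?_ ?_ ?_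
  · refine h.trans (le_of_eq ?_)
    exact Finset.sum_congr rfl fun j _ => by rw [hs_jump]
  · simp [hsE_zero]
  · have := congrArg Complex.re hP.trace
    simp only [Matrix.trace, Matrix.diag, Complex.re_sum, Complex.natCast_re] at this
    have h2 : W ⊓ hsE n n = W := by rw [hsE_top, inf_top_eq]
    rw [h2, ← this]
    exact Finset.sum_congr rfl fun j _ => by rw [if_pos j.2]
  · intro i _
    obtain ⟨Q, hQ⟩ := hsProj_exists (W ⊓ hsE n i)
    have hPQ := hP.mul_of_le hQ inf_le_left
    have hQP : Q * P = Q := by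
      have := congrArg Matrix.conjTranspose hPQ
      rwa [Matrix.conjTranspose_mul, hP.herm, hQ.herm] at this
    have hd : ∀ j, (Q j j).re ≤ (P j j).re := by
      intro j
      have := hs_diag_nonneg (P := P - Q) (by rw [Matrix.conjTranspose_sub, hP.herm, hQ.herm])
        (by rw [sub_mul, mul_sub, mul_sub, hP.idem, hQ.idem, hPQ, hQP]; simp) j
      simpa using this
    have hz : ∀ j : Fin n, ¬ j.val < i → Q j j = 0 := by
      intro j hj
      have : Q *ᵥ (Pi.single j 1) ∈ W ⊓ hsE n i := by
        rw [hQ.mem, Matrix.mulVec_mulVec, hQ.idem]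
      have := mem_hsE.1 (Submodule.mem_inf.1 this).2 j (by omega)
      simpa using this
    have ht := congrArg Complex.re hQ.trace
    simp only [Matrix.trace, Matrix.diag, Complex.re_sum, Complex.natCast_re] at ht
    refine ht.symm.le.trans ?_
    refine Finset.sum_le_sum fun j _ => ?_
    split_ifs with hj
    · exact hd j
    · rw [hz j hj]; simp

open Matrix

open Filter Topology

theorem hs_ult {m n : Type*} [Fintype m] [Fintype n] (A : ℕ → Matrix m n ℂ) (C : ℝ)
    (h : ∀ N i j, ‖A N i j‖ ≤ C) :
    ∃ A0, Tendsto A (hyperfilter ℕ : Filter ℕ) (𝓝 A0) := by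
  have h1 : ∀ i j, ∃ a, Tendsto (fun N => A N i j) (hyperfilter ℕ : Filter ℕ) (𝓝 a) := by
    intro i j
    obtain ⟨a, _, ha⟩ := (isCompact_closedBall (0 : ℂ) C).ultrafilter_le_nhds'
      ((hyperfilter ℕ).map (fun N => A N i j))
      (by
        rw [Ultrafilter.mem_map]
        exact Filter.univ_mem' fun N => by simpa using h N i j)
    exact ⟨a, ha⟩
  choose a ha using h1
  exact ⟨Matrix.of a, tendsto_pi_nhds.2 fun i => tendsto_pi_nhds.2 fun j => ha i j⟩

/-- semistability of a triple of weighted flags -/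
def hsSS {n : ℕ} (w : Fin 3 → Fin n → ℝ) (Y : Fin 3 → Matrix (Fin n) (Fin n) ℂ) : Prop :=
  ∀ V : Submodule ℂ (Fin n → ℂ), ∑ k, hsS (w k) (V.comap (Matrix.toLin' (Y k))) ≤ 0

theorem hs_trace {n : ℕ} (P U : Matrix (Fin n) (Fin n) ℂ) (w : Fin n → ℝ) :
    (P * (U * diagonal (fun j => (w j : ℂ)) * Uᴴ)).trace.re =
      ∑ j, w j * ((Uᴴ * P * U) j j).re := by
  have : (P * (U * diagonal (fun j => (w j : ℂ)) * Uᴴ)).trace =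
      ((Uᴴ * P * U) * diagonal (fun j => (w j : ℂ))).trace := by
    rw [← mul_assoc, Matrix.trace_mul_comm]
    simp only [mul_assoc]
  rw [this, Matrix.trace, Complex.re_sum]
  refine Finset.sum_congr rfl fun j _ => ?_
  rw [Matrix.diag_apply, Matrix.mul_diagonal, Complex.re_mul_ofReal, mul_comm]

theorem hsProj.conj {n : ℕ} {P U : Matrix (Fin n) (Fin n) ℂ} {V : Submodule ℂ (Fin n → ℂ)}
    (hP : hsProj P V) (hU : U ∈ unitaryGroup (Fin n) ℂ) :
    hsProj (Uᴴ * P * U) (V.comap (Matrix.toLin' U)) := by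
  have h1 : Uᴴ * U = 1 := (mem_unitaryGroup_iff').1 hU
  have h2 : U * Uᴴ = 1 := (mem_unitaryGroup_iff).1 hU
  refine ⟨?_, ?_, ?_⟩
  · simp [Matrix.conjTranspose_mul, hP.herm, mul_assoc]
  · calc Uᴴ * P * U * (Uᴴ * P * U) = Uᴴ * P * (U * Uᴴ) * P * U := by simp only [mul_assoc]
      _ = Uᴴ * (P * P) * U := by rw [h2]; simp only [mul_assoc, one_mul]
      _ = _ := by rw [hP.idem]
  · intro v
    rw [Submodule.mem_comap, Matrix.toLin'_apply, hP.mem]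
    constructor
    · intro h
      rw [mul_assoc, ← Matrix.mulVec_mulVec, ← Matrix.mulVec_mulVec, h, Matrix.mulVec_mulVec, h1,
        Matrix.one_mulVec]
    · intro h
      conv_rhs => rw [← h]
      rw [Matrix.mulVec_mulVec, Matrix.mulVec_mulVec]
      congr 1
      rw [← mul_assoc, ← mul_assoc, h2, one_mul]

theorem hs_key' {n : ℕ} {P U : Matrix (Fin n) (Fin n) ℂ} {V : Submodule ℂ (Fin n → ℂ)}
    (hP : hsProj P V) (hU : U ∈ unitaryGroup (Fin n) ℂ) (w : Fin n → ℝ) (hw : Antitone w) :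
    hsS w (V.comap (Matrix.toLin' U)) ≤
      (P * (U * diagonal (fun j => (w j : ℂ)) * Uᴴ)).trace.re := by
  rw [hs_trace]
  exact hs_key (hP.conj hU) w hw

theorem hs_ss_of_sum {n : ℕ} (w : Fin 3 → Fin n → ℝ) (hw : ∀ k, Antitone (w k))
    (U : Fin 3 → Matrix (Fin n) (Fin n) ℂ) (hU : ∀ k, U k ∈ unitaryGroup (Fin n) ℂ)
    (hs : ∑ k, U k * diagonal (fun j => (w k j : ℂ)) * (U k)ᴴ = 0) : hsSS w U := by
  intro V
  obtain ⟨P, hP⟩ := hsProj_exists V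
  refine (Finset.sum_le_sum fun k _ => hs_key' hP (hU k) (w k) (hw k)).trans ?_
  rw [← Complex.re_sum, ← Matrix.trace_sum, ← Finset.mul_sum, hs]
  simp

theorem hs_finrank_comap {n : ℕ} (Y : Matrix (Fin n) (Fin n) ℂ) (hY : Y.det ≠ 0)
    (V : Submodule ℂ (Fin n → ℂ)) :
    Module.finrank ℂ (V.comap (Matrix.toLin' Y)) = Module.finrank ℂ V := by
  let e : (Fin n → ℂ) ≃ₗ[ℂ] (Fin n → ℂ) :=
    Matrix.toLin'OfInv (M := Y⁻¹) (M' := Y) (Matrix.nonsing_inv_mul _ (isUnit_iff_ne_zero.2 hY))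
      (Matrix.mul_nonsing_inv _ (isUnit_iff_ne_zero.2 hY))
  have h : V.comap (Matrix.toLin' Y) = V.map (e.symm : (Fin n → ℂ) →ₗ[ℂ] (Fin n → ℂ)) := by
    rw [← Submodule.comap_equiv_eq_map_symm]
    rfl
  rw [h]
  exact LinearEquiv.finrank_map_eq e.symm V

theorem hs_limit {n : ℕ} (w : Fin 3 → Fin n → ℝ) (hw : ∀ k, Antitone (w k))
    (Y : Fin 3 → Matrix (Fin n) (Fin n) ℂ) (hY : ∀ k, (Y k).det ≠ 0)
    (YN : ℕ → Fin 3 → Matrix (Fin n) (Fin n) ℂ) (hYN : ∀ N k, (YN N k).det ≠ 0)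
    (hlim : ∀ k, Tendsto (fun N => YN N k) atTop (𝓝 (Y k)))
    (V : ℕ → Submodule ℂ (Fin n → ℂ)) (D : Fin 3 → ℕ → ℕ)
    (hD : ∀ N k i, Module.finrank ℂ ((V N).comap (Matrix.toLin' (YN N k)) ⊓ hsE n i :
      Submodule ℂ (Fin n → ℂ)) = D k i)
    (hss : hsSS w Y) :
    ∑ k, ∑ j : Fin n, w k j * ((D k (j.val + 1) : ℝ) - (D k j.val : ℝ)) ≤ 0 := by
  have hu : (hyperfilter ℕ : Filter ℕ) ≤ atTop := Nat.hyperfilter_le_atTop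
  choose P hP using fun N => hsProj_exists (V N)
  choose Q hQ using fun k i N => hsProj_exists ((V N).comap (Matrix.toLin' (YN N k)) ⊓ hsE n i)
  obtain ⟨P0, hP0⟩ := hs_ult P 1 (fun N => hsProj.entry_bound (hP N).herm (hP N).idem)
  choose Q0 hQ0 using fun k i => hs_ult (Q k i) 1
    (fun N => hsProj.entry_bound (hQ k i N).herm (hQ k i N).idem)
  have hY0 : ∀ k, Tendsto (fun N => YN N k) (hyperfilter ℕ : Filter ℕ) (𝓝 (Y k)) :=
    fun k => (hlim k).mono_left hu
  have limH : ∀ (A : ℕ → Matrix (Fin n) (Fin n) ℂ) (A0 : Matrix (Fin n) (Fin n) ℂ),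
      Tendsto A (hyperfilter ℕ : Filter ℕ) (𝓝 A0) → (∀ N, (A N)ᴴ = A N) → A0ᴴ = A0 := by
    intro A A0 h1 h2
    have h3 : Tendsto (fun N => (A N)ᴴ) (hyperfilter ℕ : Filter ℕ) (𝓝 A0ᴴ) :=
      (continuous_id.matrix_conjTranspose.tendsto A0).comp h1
    simp only [h2] at h3
    exact tendsto_nhds_unique h3 h1
  have limI : ∀ (A : ℕ → Matrix (Fin n) (Fin n) ℂ) (A0 : Matrix (Fin n) (Fin n) ℂ),
      Tendsto A (hyperfilter ℕ : Filter ℕ) (𝓝 A0) → (∀ N, A N * A N = A N) → A0 * A0 = A0 := by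
    intro A A0 h1 h2
    have h3 := h1.mul h1
    simp only [h2] at h3
    exact tendsto_nhds_unique h3 h1
  have limT : ∀ (A : ℕ → Matrix (Fin n) (Fin n) ℂ) (A0 : Matrix (Fin n) (Fin n) ℂ) (d : ℂ),
      Tendsto A (hyperfilter ℕ : Filter ℕ) (𝓝 A0) → (∀ N, (A N).trace = d) → A0.trace = d := by
    intro A A0 d h1 h2
    have h3 : Tendsto (fun N => (A N).trace) (hyperfilter ℕ : Filter ℕ) (𝓝 A0.trace) :=
      (continuous_id.matrix_trace.tendsto A0).comp h1
    simp only [h2] at h3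
    exact tendsto_nhds_unique h3 tendsto_const_nhds |>.symm ▸ rfl
  obtain ⟨V0, hV0⟩ := hsProj_of P0 (limH P P0 hP0 fun N => (hP N).herm)
    (limI P P0 hP0 fun N => (hP N).idem)
  choose W0 hW0 using fun k i => hsProj_of (Q0 k i)
    (limH _ _ (hQ0 k i) fun N => (hQ k i N).herm) (limI _ _ (hQ0 k i) fun N => (hQ k i N).idem)
  have htr : ∀ k i, Module.finrank ℂ (W0 k i) = D k i := by
    intro k i
    have h1 := limT _ _ (D k i) (hQ0 k i) (fun N => by rw [(hQ k i N).trace, hD])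
    rw [(hW0 k i).trace] at h1
    exact_mod_cast h1
  have hle : ∀ k i, W0 k i ≤ V0.comap (Matrix.toLin' (Y k)) ⊓ hsE n i := by
    intro k i v hv
    have hv' := ((hW0 k i).mem v).1 hv
    have h1 : P0 * (Y k * Q0 k i) = Y k * Q0 k i := by
      have h2 := hP0.mul ((hY0 k).mul (hQ0 k i))
      have h3 : ∀ N, P N * (YN N k * Q k i N) = YN N k * Q k i N := by
        intro N
        apply Matrix.toLin'.injective
        apply LinearMap.ext
        intro u
        simp only [Matrix.toLin'_apply, ← Matrix.mulVec_mulVec]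
        refine ((hP N).mem _).1 ?_
        have : Q k i N *ᵥ u ∈ (V N).comap (Matrix.toLin' (YN N k)) ⊓ hsE n i := by
          rw [(hQ k i N).mem, Matrix.mulVec_mulVec, (hQ k i N).idem]
        exact (Submodule.mem_inf.1 this).1
      simp only [h3] at h2
      exact tendsto_nhds_unique h2 ((hY0 k).mul (hQ0 k i))
    have h2 : ∀ a b : Fin n, i ≤ a.val → Q0 k i a b = 0 := by
      intro a b ha
      have h3 : Tendsto (fun N => Q k i N a b) (hyperfilter ℕ : Filter ℕ) (𝓝 (Q0 k i a b)) :=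
        tendsto_pi_nhds.1 (tendsto_pi_nhds.1 (hQ0 k i) a) b
      have h4 : ∀ N, Q k i N a b = 0 := by
        intro N
        have : Q k i N *ᵥ (Pi.single b 1) ∈ (V N).comap (Matrix.toLin' (YN N k)) ⊓ hsE n i := by
          rw [(hQ k i N).mem, Matrix.mulVec_mulVec, (hQ k i N).idem]
        have := mem_hsE.1 (Submodule.mem_inf.1 this).2 a ha
        simpa using this
      simp only [h4] at h3
      exact tendsto_nhds_unique h3 tendsto_const_nhds
    refine Submodule.mem_inf.2 ⟨?_, ?_⟩
    · rw [Submodule.mem_comap, Matrix.toLin'_apply, hV0.mem, ← hv']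
      simp only [Matrix.mulVec_mulVec]
      rw [h1]
    · intro a ha
      rw [← hv', Matrix.mulVec, dotProduct]
      exact Finset.sum_eq_zero fun b _ => by rw [h2 a b ha, zero_mul]
  refine le_trans (Finset.sum_le_sum fun k _ => ?_) (hss V0)
  refine hs_abel (w k) (hw k) (fun i => (D k i : ℝ)) (fun i => (Module.finrank ℂ
    (V0.comap (Matrix.toLin' (Y k)) ⊓ hsE n i : Submodule ℂ (Fin n → ℂ)) : ℝ)) ?_ ?_ ?_
  · have h : ∀ W : Submodule ℂ (Fin n → ℂ), W ⊓ hsE n 0 = ⊥ := fun W => by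
      rw [hsE_zero, inf_bot_eq]
    rw [← hD 0 k 0, h, h]
  · have h1 : ∀ W : Submodule ℂ (Fin n → ℂ), W ⊓ hsE n n = W := fun W => by
      rw [hsE_top, inf_top_eq]
    have h2 : ∀ N, (P N).trace = (D k n : ℂ) := by
      intro N
      rw [(hP N).trace, ← hD N k n, h1, hs_finrank_comap _ (hYN N k)]
    have h3 := limT _ _ _ hP0 h2
    rw [hV0.trace] at h3
    rw [h1, hs_finrank_comap _ (hY k)]
    exact_mod_cast h3.symm
  · intro i _
    rw [← htr]
    exact_mod_cast Submodule.finrank_mono (hle k i)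

/-- transport of a subspace under a field automorphism -/
def hsMap {n : ℕ} (σ : ℂ ≃+* ℂ) (V : Submodule ℂ (Fin n → ℂ)) : Submodule ℂ (Fin n → ℂ) where
  carrier := {v | (fun i => σ.symm (v i)) ∈ V}
  add_mem' := by
    intro a b ha hb
    have := V.add_mem ha hb
    simpa [Pi.add_def] using this
  zero_mem' := by
    have := V.zero_mem
    simpa [Pi.zero_def] using this
  smul_mem' := by
    intro c a ha
    have := V.smul_mem (σ.symm c) ha
    simpa [Pi.smul_def] using this

theorem mem_hsMap {n : ℕ} {σ : ℂ ≃+* ℂ} {V : Submodule ℂ (Fin n → ℂ)} {v : Fin n → ℂ} :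
    v ∈ hsMap σ V ↔ (fun i => σ.symm (v i)) ∈ V := Iff.rfl

theorem hsMap_finrank {n : ℕ} (σ : ℂ ≃+* ℂ) (V : Submodule ℂ (Fin n → ℂ)) :
    Module.finrank ℂ (hsMap σ V) = Module.finrank ℂ V := by
  let j : hsMap σ V ≃+ V :=
    { toFun := fun v => ⟨fun i => σ.symm (v.1 i), v.2⟩
      invFun := fun v => ⟨fun i => σ (v.1 i), by rw [mem_hsMap]; simpa using v.2⟩
      left_inv := by intro v; ext i; simp
      right_inv := by intro v; ext i; simp
      map_add' := by intro a b; ext i; simp }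
  have := rank_eq_of_equiv_equiv σ.symm j σ.symm.bijective (by intro r m; ext i; simp [j])
  unfold Module.finrank
  rw [this]

theorem hsMap_comap {n : ℕ} (σ : ℂ ≃+* ℂ) (V : Submodule ℂ (Fin n → ℂ))
    (Y : Matrix (Fin n) (Fin n) ℂ) (i : ℕ) :
    (hsMap σ V).comap (Matrix.toLin' (Y.map σ)) ⊓ hsE n i =
      hsMap σ (V.comap (Matrix.toLin' Y) ⊓ hsE n i) := by
  ext v
  simp only [Submodule.mem_inf, Submodule.mem_comap, mem_hsMap, mem_hsE, Matrix.toLin'_apply]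
  refine and_congr (iff_of_eq ?_) ?_
  · congr 1
    ext a
    simp [Matrix.mulVec, dotProduct]
  · simp

theorem hs_generic {n : ℕ} (w1 w2 : Fin 3 → Fin n → ℝ) (hw1 : ∀ k, Antitone (w1 k))
    (hw2 : ∀ k, Antitone (w2 k)) (Y1 Y2 : Fin 3 → Matrix (Fin n) (Fin n) ℂ)
    (hY1 : ∀ k, (Y1 k).det ≠ 0) (hY2 : ∀ k, (Y2 k).det ≠ 0) (h1 : hsSS w1 Y1)
    (h2 : hsSS w2 Y2) : ∃ Y : Fin 3 → Matrix (Fin n) (Fin n) ℂ, (∀ k, (Y k).det ≠ 0) ∧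
      hsSS w1 Y ∧ hsSS w2 Y := by
  let s : Set ℂ := Set.range (fun x : Fin 3 × Fin n × Fin n => Y1 x.1 x.2.1 x.2.2) ∪
    Set.range (fun x : Fin 3 × Fin n × Fin n => Y2 x.1 x.2.1 x.2.2)
  obtain ⟨t, ht⟩ := hs_exists_transc s ((Set.countable_range _).union (Set.countable_range _))
  let F := Subfield.closure s
  have hF1 : ∀ k a b, Y1 k a b ∈ F := fun k a b =>
    Subfield.subset_closure (Or.inl ⟨(k, a, b), rfl⟩)
  have hF2 : ∀ k a b, Y2 k a b ∈ F := fun k a b =>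
    Subfield.subset_closure (Or.inr ⟨(k, a, b), rfl⟩)
  let Z : ℂ → Fin 3 → Matrix (Fin n) (Fin n) ℂ := fun t k => (1 - t) • Y1 k + t • Y2 k
  have hZc : ∀ k, Continuous (fun t => Z t k) := fun k => by simp only [Z]; fun_prop
  have hZ0 : Z 0 = Y1 := by ext k; simp [Z]
  have hZ1 : Z 1 = Y2 := by ext k; simp [Z]
  have hseq : ∀ q : ℂ, Tendsto (fun N : ℕ => q + ((N : ℂ) + 1)⁻¹ * t) atTop (𝓝 q) := by
    intro q
    have h : Tendsto (fun N : ℕ => ((N : ℂ) + 1)⁻¹) atTop (𝓝 0) := by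
      have := tendsto_one_div_add_atTop_nhds_zero_nat (𝕜 := ℂ)
      simpa using this
    simpa using tendsto_const_nhds.add (h.mul_const t)
  have hσ : ∀ q ∈ F, ∀ N : ℕ, ∃ σ : ℂ ≃+* ℂ, ∀ k,
      (Z t k).map σ = Z (q + ((N : ℂ) + 1)⁻¹ * t) k := by
    intro q hq N
    have hN : ((N : ℂ) + 1)⁻¹ ∈ F := F.inv_mem (F.add_mem (natCast_mem F N) F.one_mem)
    obtain ⟨σ, hσ1, hσ2⟩ := hs_exists_auto F t _ ht (hs_transc_affine F t ht q _ hq hN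
      (inv_ne_zero (Nat.cast_add_one_ne_zero N)))
    refine ⟨σ, fun k => ?_⟩
    ext a b
    simp [Z, hσ1, hσ2 _ (hF1 k a b), hσ2 _ (hF2 k a b)]
  have hdet : ∀ k, (Z t k).det ≠ 0 := by
    intro k h0
    choose σ hσ using hσ 0 F.zero_mem
    have h3 : ∀ N : ℕ, (Z (0 + ((N : ℂ) + 1)⁻¹ * t) k).det = 0 := by
      intro N
      rw [← hσ N k, ← RingEquiv.mapMatrix_apply, ← RingEquiv.map_det, h0, map_zero]
    have h4 := (((hZc k).matrix_det).tendsto 0).comp (hseq 0)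
    simp only [Function.comp_def, h3] at h4
    have h5 := tendsto_nhds_unique h4 tendsto_const_nhds
    rw [hZ0] at h5
    exact hY1 k h5
  have main : ∀ (w : Fin 3 → Fin n → ℝ), (∀ k, Antitone (w k)) → ∀ q ∈ F,
      (∀ k, (Z q k).det ≠ 0) → hsSS w (Z q) → hsSS w (Z t) := by
    intro w hw q hq hd hss V
    choose σ hσ using hσ q hq
    refine hs_limit w hw (Z q) hd (fun N => Z (q + ((N : ℂ) + 1)⁻¹ * t)) ?_ ?_
      (fun N => hsMap (σ N) V) (fun k i => Module.finrank ℂ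
        (V.comap (Matrix.toLin' (Z t k)) ⊓ hsE n i : Submodule ℂ (Fin n → ℂ))) ?_ hss
    · intro N k
      rw [← hσ N k, ← RingEquiv.mapMatrix_apply, ← RingEquiv.map_det]
      simpa using hdet k
    · intro k
      exact ((hZc k).tendsto q).comp (hseq q)
    · intro N k i
      rw [← hσ N k, hsMap_comap, hsMap_finrank]
  exact ⟨Z t, hdet, main w1 hw1 0 F.zero_mem (by rwa [hZ0]) (by rwa [hZ0]),
    main w2 hw2 1 F.one_mem (by rwa [hZ1]) (by rwa [hZ1])⟩

open Matrix Filter Topology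

theorem hs_qr {n : ℕ} (Z : Matrix (Fin n) (Fin n) ℂ) :
    ∃ U ∈ unitaryGroup (Fin n) ℂ, ∃ R : Matrix (Fin n) (Fin n) ℂ,
      (∀ i j, j < i → R i j = 0) ∧ Z = U * R := by
  have hc : Module.finrank ℂ (EuclideanSpace ℂ (Fin n)) = Fintype.card (Fin n) := by simp
  let f : Fin n → EuclideanSpace ℂ (Fin n) := fun j => WithLp.toLp 2 (fun i => Z i j)
  let b := InnerProductSpace.gramSchmidtOrthonormalBasis hc f
  let U : Matrix (Fin n) (Fin n) ℂ := fun i j => b j i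
  have hU : U ∈ unitaryGroup (Fin n) ℂ := by
    have := OrthonormalBasis.toMatrix_orthonormalBasis_mem_unitary
      (EuclideanSpace.basisFun (Fin n) ℂ) b
    convert this using 1
    ext i j
    simp [U, Module.Basis.toMatrix_apply]
  have h2 : U * Uᴴ = 1 := (mem_unitaryGroup_iff).1 hU
  refine ⟨U, hU, Uᴴ * Z, ?_, by rw [← mul_assoc, h2, one_mul]⟩
  intro i j hij
  have := InnerProductSpace.gramSchmidtOrthonormalBasis_inv_triangular hc f hij
  rw [← this, Matrix.mul_apply, PiLp.inner_apply]
  refine Finset.sum_congr rfl fun l _ => ?_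
  show star (U l i) * Z l j = inner ℂ (b i l) (Z l j)
  rw [RCLike.inner_apply, mul_comm]
  rfl

theorem hs_det_deriv {m : Type*} [Fintype m] [DecidableEq m] (A B : Matrix m m ℂ) :
    HasDerivAt (fun t : ℝ => (det (1 + (t : ℂ) • A + ((t : ℂ) ^ 2) • B)).re) A.trace.re 0 := by
  have h : ∃ q : Polynomial ℂ, ∀ z : ℂ, det (1 + z • A + (z ^ 2) • B) =
      1 + A.trace * z + (Polynomial.eval z q) * z ^ 2 := by
    let M : Matrix m m (Polynomial ℂ) := A.map (Polynomial.C : ℂ →+* Polynomial ℂ) +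
      (Polynomial.X : Polynomial ℂ) • B.map (Polynomial.C : ℂ →+* Polynomial ℂ)
    obtain ⟨Q, h1⟩ : ∃ Q : Polynomial ℂ, (1 + (Polynomial.X : Polynomial ℂ) • M).det =
        1 + M.trace * Polynomial.X + Q * Polynomial.X ^ 2 :=
      ⟨_, Matrix.det_one_add_smul (Polynomial.X : Polynomial ℂ) M⟩
    refine ⟨Polynomial.C B.trace + Q, fun z => ?_⟩
    have h2 := congrArg (Polynomial.evalRingHom z) h1
    rw [RingHom.map_det] at h2
    have h3 : (Polynomial.evalRingHom z).mapMatrix (1 + (Polynomial.X : Polynomial ℂ) • M) =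
        1 + z • A + (z ^ 2) • B := by
      ext a b
      simp [M, Matrix.one_apply]
      split_ifs <;> simp <;> ring
    have h4 : M.trace = Polynomial.C A.trace + Polynomial.X * Polynomial.C B.trace := by
      simp [M, Matrix.trace, Finset.sum_add_distrib, Finset.mul_sum]
    rw [h3, h4] at h2
    rw [h2]
    simp
    ring
  obtain ⟨q, hq⟩ := h
  have h1 : HasDerivAt (fun z : ℂ => det (1 + z • A + (z ^ 2) • B)) A.trace ((0 : ℝ) : ℂ) := by
    simp only [hq]
    have h2 := (((hasDerivAt_id (((0 : ℝ) : ℂ))).const_mul A.trace).const_add 1).add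
      ((q.hasDerivAt ((0 : ℝ) : ℂ)).mul ((hasDerivAt_id (((0 : ℝ) : ℂ))).pow 2))
    refine HasDerivAt.congr_deriv h2 ?_
    simp
  exact h1.real_of_complex

/-- leading index type -/
abbrev hsI (n i : ℕ) := {j : Fin n // j.val < i}

/-- leading submatrix -/
def hsL {n : ℕ} (i : ℕ) (A : Matrix (Fin n) (Fin n) ℂ) : Matrix (hsI n i) (hsI n i) ℂ :=
  A.submatrix Subtype.val Subtype.val

theorem hsL_mul {n : ℕ} (i : ℕ) (A R : Matrix (Fin n) (Fin n) ℂ) (hR : ∀ i j, j < i → R i j = 0) :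
    hsL i (A * R) = hsL i A * hsL i R := by
  ext a b
  simp only [hsL, Matrix.submatrix_apply, Matrix.mul_apply]
  rw [← Finset.sum_subtype (Finset.univ.filter (fun j : Fin n => j.val < i)) (by simp)
    (fun x => A a x * R x b), Finset.sum_filter]
  refine Finset.sum_congr rfl fun l _ => ?_
  split_ifs with h
  · rfl
  · rw [hR l b, mul_zero]
    have := b.2
    rw [Fin.lt_def]; omega

theorem hsL_conj {n : ℕ} (i : ℕ) (A R : Matrix (Fin n) (Fin n) ℂ) (hR : ∀ i j, j < i → R i j = 0) :
    hsL i (Rᴴ * A * R) = (hsL i R)ᴴ * hsL i A * hsL i R := by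
  rw [hsL_mul _ _ _ hR]
  congr 1
  have := hsL_mul i Aᴴ R hR
  have h := congrArg Matrix.conjTranspose this
  rw [Matrix.conjTranspose_mul] at h
  have h2 : ∀ B : Matrix (Fin n) (Fin n) ℂ, (hsL i B)ᴴ = hsL i Bᴴ := fun B => rfl
  rw [h2 (Aᴴ * R), h2 Aᴴ, Matrix.conjTranspose_mul, Matrix.conjTranspose_conjTranspose] at h
  exact h

/-- leading Gram determinant -/
noncomputable def hsD {n : ℕ} (i : ℕ) (Z : Matrix (Fin n) (Fin n) ℂ) : ℝ := (hsL i (Zᴴ * Z)).det.re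

theorem hsL_det_tri {n : ℕ} (i : ℕ) (R A : Matrix (Fin n) (Fin n) ℂ)
    (hR : ∀ i j, j < i → R i j = 0) :
    (hsL i (Rᴴ * A * R)).det.re = (∏ l : hsI n i, ‖R l l‖ ^ 2) * (hsL i A).det.re := by
  rw [hsL_conj _ _ _ hR, Matrix.det_mul, Matrix.det_mul, Matrix.det_conjTranspose]
  have h1 : (hsL i R).det = ∏ l : hsI n i, R l l := by
    rw [Matrix.det_of_isUpperTriangular]
    · rfl
    · intro a b hab
      exact hR _ _ hab
  have h2 : star (hsL i R).det * (hsL i A).det * (hsL i R).det =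
      ((∏ l : hsI n i, ‖R l l‖ ^ 2 : ℝ) : ℂ) * (hsL i A).det := by
    have : star (hsL i R).det * (hsL i R).det = ((∏ l : hsI n i, ‖R l l‖ ^ 2 : ℝ) : ℂ) := by
      rw [h1, Finset.prod_pow, ← norm_prod]
      rw [Complex.star_def, mul_comm, Complex.mul_conj, Complex.normSq_eq_norm_sq]
    rw [← this]; ring
  rw [h2, Complex.re_ofReal_mul]

theorem hsD_qr {n : ℕ} (i : ℕ) (U R : Matrix (Fin n) (Fin n) ℂ) (hU : U ∈ unitaryGroup (Fin n) ℂ)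
    (hR : ∀ i j, j < i → R i j = 0) : hsD i (U * R) = ∏ l : hsI n i, ‖R l l‖ ^ 2 := by
  have h1 : Uᴴ * U = 1 := (mem_unitaryGroup_iff').1 hU
  have h2 : (U * R)ᴴ * (U * R) = Rᴴ * 1 * R := by
    rw [Matrix.conjTranspose_mul, ← h1]; simp only [mul_assoc]
  have h3 : hsL i (1 : Matrix (Fin n) (Fin n) ℂ) = 1 :=
    Matrix.submatrix_one _ Subtype.val_injective
  rw [hsD, h2, hsL_det_tri _ _ _ hR, h3]
  simp

theorem hs_qr_diag {n : ℕ} (U R : Matrix (Fin n) (Fin n) ℂ)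
    (hR : ∀ i j, j < i → R i j = 0) (hdet : (U * R).det ≠ 0) (l : Fin n) : R l l ≠ 0 := by
  rw [Matrix.det_mul] at hdet
  have h := right_ne_zero_of_mul hdet
  rw [Matrix.det_of_isUpperTriangular (M := R) (fun a b hab => hR _ _ hab)] at h
  exact Finset.prod_ne_zero_iff.1 h l (Finset.mem_univ l)

theorem hs_sum_hsI {n : ℕ} (i : ℕ) (a : Fin n → ℝ) :
    ∑ l : hsI n i, a l = ∑ l : Fin n, if l.val < i then a l else 0 := by
  rw [← Finset.sum_subtype (Finset.univ.filter (fun j : Fin n => j.val < i)) (by simp) a,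
    Finset.sum_filter]

/-- the Kempf-Ness type functional of a weighted flag -/
noncomputable def hsF {n : ℕ} (w : Fin n → ℝ) (Z : Matrix (Fin n) (Fin n) ℂ) : ℝ :=
  ∑ j : Fin n, w j * (Real.log (hsD (j.val + 1) Z) - Real.log (hsD j.val Z))

theorem hsF_qr {n : ℕ} (w : Fin n → ℝ) (U R : Matrix (Fin n) (Fin n) ℂ)
    (hU : U ∈ unitaryGroup (Fin n) ℂ)
    (hR : ∀ i j, j < i → R i j = 0) (hdet : (U * R).det ≠ 0) :
    hsF w (U * R) = ∑ j, w j * Real.log (‖R j j‖ ^ 2) := by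
  have h : ∀ i, Real.log (hsD i (U * R)) =
      ∑ l : Fin n, if l.val < i then Real.log (‖R l l‖ ^ 2) else 0 := by
    intro i
    rw [hsD_qr i U R hU hR, Real.log_prod, hs_sum_hsI i (fun l => Real.log (‖R l l‖ ^ 2))]
    intro l _
    exact pow_ne_zero _ (norm_ne_zero_iff.2 (hs_qr_diag U R hR hdet l))
  simp only [hsF, h, hs_jump]

theorem hsD_pos {n : ℕ} (i : ℕ) (Z : Matrix (Fin n) (Fin n) ℂ) (hZ : Z.det ≠ 0) : 0 < hsD i Z := by
  obtain ⟨U, hU, R, hR, rfl⟩ := hs_qr Z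
  rw [hsD_qr i U R hU hR]
  refine Finset.prod_pos fun l _ => ?_
  have := norm_pos_iff.2 (hs_qr_diag U R hR hZ l)
  positivity

theorem hsD_cont {n : ℕ} (i : ℕ) : Continuous (hsD (n := n) i) := by
  unfold hsD hsL
  refine Complex.continuous_re.comp (Continuous.matrix_det ?_)
  exact Continuous.matrix_submatrix (by fun_prop) _ _

theorem hsD_deriv {n : ℕ} (i : ℕ) (U R X : Matrix (Fin n) (Fin n) ℂ)
    (hU : U ∈ unitaryGroup (Fin n) ℂ)
    (hR : ∀ i j, j < i → R i j = 0) (hdet : (U * R).det ≠ 0) (hX : Xᴴ = X) :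
    HasDerivAt (fun t : ℝ => Real.log (hsD i ((1 + (t : ℂ) • X) * (U * R))))
      (∑ l : Fin n, if l.val < i then 2 * ((Uᴴ * X * U) l l).re else 0) 0 := by
  have h1 : Uᴴ * U = 1 := (mem_unitaryGroup_iff').1 hU
  have h2 : ∀ t : ℝ, ((1 + (t : ℂ) • X) * (U * R))ᴴ * ((1 + (t : ℂ) • X) * (U * R)) =
      Rᴴ * (1 + (t : ℂ) • ((2 : ℂ) • (Uᴴ * X * U)) + ((t : ℂ) ^ 2) • (Uᴴ * (X * X) * U)) * R := by
    intro t
    have h1' : Rᴴ * (1 + (t : ℂ) • ((2 : ℂ) • (Uᴴ * X * U)) +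
      ((t : ℂ) ^ 2) • (Uᴴ * (X * X) * U)) * R = Rᴴ * (Uᴴ * U + (t : ℂ) • ((2 : ℂ) • (Uᴴ * X * U)) +
      ((t : ℂ) ^ 2) • (Uᴴ * (X * X) * U)) * R := by rw [h1]
    rw [h1']
    simp only [Matrix.conjTranspose_mul, Matrix.conjTranspose_add, Matrix.conjTranspose_smul, hX,
      Matrix.conjTranspose_one, Complex.star_def, Complex.conj_ofReal]
    simp only [mul_add, add_mul, mul_one, one_mul, Matrix.mul_smul, Matrix.smul_mul, smul_add,
      mul_assoc, two_smul, pow_two, mul_smul]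
    abel
  have h3 : hsL i (1 : Matrix (Fin n) (Fin n) ℂ) = 1 :=
    Matrix.submatrix_one _ Subtype.val_injective
  have h4 : ∀ t : ℝ, hsD i ((1 + (t : ℂ) • X) * (U * R)) = (∏ l : hsI n i, ‖R l l‖ ^ 2) *
      (det (1 + (t : ℂ) • hsL i ((2 : ℂ) • (Uᴴ * X * U)) +
        ((t : ℂ) ^ 2) • hsL i (Uᴴ * (X * X) * U))).re := by
    intro t
    rw [hsD, h2, hsL_det_tri _ _ _ hR, ← h3]
    rfl
  simp only [h4]
  have hp : 0 < (∏ l : hsI n i, ‖R l l‖ ^ 2) := by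
    refine Finset.prod_pos fun l _ => ?_
    have := norm_pos_iff.2 (hs_qr_diag U R hR hdet l)
    positivity
  have h5 := (hs_det_deriv (hsL i ((2 : ℂ) • (Uᴴ * X * U))) (hsL i (Uᴴ * (X * X) * U))).const_mul
    (∏ l : hsI n i, ‖R l l‖ ^ 2)
  have h6 := h5.log (by simpa using hp.ne')
  refine HasDerivAt.congr_deriv h6 ?_
  have h7 : (hsL i ((2 : ℂ) • (Uᴴ * X * U))).trace.re =
    ∑ l : Fin n, if l.val < i then 2 * ((Uᴴ * X * U) l l).re else 0 := by
    rw [← hs_sum_hsI i (fun l => 2 * ((Uᴴ * X * U) l l).re), Matrix.trace, Complex.re_sum]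
    refine Finset.sum_congr rfl fun l _ => ?_
    simp [hsL]
  rw [h7]
  simp
  rw [mul_div_cancel_left₀ _ (by exact_mod_cast hp.ne')]

theorem hsF_deriv {n : ℕ} (w : Fin n → ℝ) (U R X : Matrix (Fin n) (Fin n) ℂ)
    (hU : U ∈ unitaryGroup (Fin n) ℂ)
    (hR : ∀ i j, j < i → R i j = 0) (hdet : (U * R).det ≠ 0) (hX : Xᴴ = X) :
    HasDerivAt (fun t : ℝ => hsF w ((1 + (t : ℂ) • X) * (U * R)))
      (2 * (X * (U * diagonal (fun j => (w j : ℂ)) * Uᴴ)).trace.re) 0 := by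
  unfold hsF
  have h := HasDerivAt.fun_sum (u := Finset.univ) (fun j (_ : j ∈ (Finset.univ : Finset (Fin n))) =>
    ((hsD_deriv (j.val + 1) U R X hU hR hdet hX).sub
      (hsD_deriv j.val U R X hU hR hdet hX)).const_mul (w j))
  refine HasDerivAt.congr_deriv h ?_
  rw [hs_trace, Finset.mul_sum]
  refine Finset.sum_congr rfl fun j _ => ?_
  rw [hs_jump (fun l => 2 * ((Uᴴ * X * U) l l).re)]
  ring

open Matrix Filter Topology

/-- squared Frobenius norm -/
noncomputable def hsT {n : ℕ} (g : Matrix (Fin n) (Fin n) ℂ) : ℝ := (g * gᴴ).trace.re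

theorem hsT_eq {n : ℕ} (g : Matrix (Fin n) (Fin n) ℂ) : hsT g = ∑ i, ∑ j, ‖g i j‖ ^ 2 := by
  rw [hsT, Matrix.trace, Complex.re_sum]
  refine Finset.sum_congr rfl fun i _ => ?_
  rw [Matrix.diag_apply, Matrix.mul_apply, Complex.re_sum]
  refine Finset.sum_congr rfl fun j _ => ?_
  rw [Matrix.conjTranspose_apply, Complex.star_def, Complex.mul_conj, Complex.ofReal_re,
    Complex.normSq_eq_norm_sq]

theorem hsT_entry {n : ℕ} (g : Matrix (Fin n) (Fin n) ℂ) (i j : Fin n) : ‖g i j‖ ^ 2 ≤ hsT g := by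
  rw [hsT_eq]
  refine le_trans ?_ (Finset.single_le_sum (f := fun i => ∑ j, ‖g i j‖ ^ 2)
    (fun i _ => by positivity) (Finset.mem_univ i))
  exact Finset.single_le_sum (f := fun j => ‖g i j‖ ^ 2)
    (fun i _ => by positivity) (Finset.mem_univ j)

theorem hsT_cont {n : ℕ} : Continuous (hsT (n := n)) := by
  unfold hsT
  exact Complex.continuous_re.comp (Continuous.matrix_trace (by fun_prop))

theorem hsT_deriv {n : ℕ} (g X : Matrix (Fin n) (Fin n) ℂ) (hX : Xᴴ = X) :
    HasDerivAt (fun t : ℝ => hsT ((1 + (t : ℂ) • X) * g)) (2 * (X * (g * gᴴ)).trace.re) 0 := by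
  have h : ∀ t : ℝ, hsT ((1 + (t : ℂ) • X) * g) = hsT g + (2 * (X * (g * gᴴ)).trace.re) * t +
      (X * (g * gᴴ) * X).trace.re * t ^ 2 := by
    intro t
    have h1 : ((1 + (t : ℂ) • X) * g) * ((1 + (t : ℂ) • X) * g)ᴴ = g * gᴴ + (t : ℂ) •
        (X * (g * gᴴ)) + (t : ℂ) • ((g * gᴴ) * X) + (t : ℂ) • (t : ℂ) • (X * (g * gᴴ) * X) := by
      simp only [Matrix.conjTranspose_mul, Matrix.conjTranspose_add, Matrix.conjTranspose_smul, hX,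
        Matrix.conjTranspose_one, Complex.star_def, Complex.conj_ofReal]
      simp only [mul_add, add_mul, mul_one, one_mul, Matrix.mul_smul, Matrix.smul_mul, smul_add,
        mul_assoc]
      abel
    rw [hsT, h1]
    simp only [Matrix.trace_add, Matrix.trace_smul, Matrix.trace_mul_comm (g * gᴴ) X,
      Complex.add_re, smul_eq_mul, Complex.re_ofReal_mul, hsT]
    ring
  simp only [h]
  have h2 := (((hasDerivAt_id (0 : ℝ)).const_mul (2 * (X * (g * gᴴ)).trace.re)).const_add
    (hsT g)).add (((hasDerivAt_id (0 : ℝ)).pow 2).const_mul (X * (g * gᴴ) * X).trace.re)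
  refine HasDerivAt.congr_deriv h2 ?_
  simp

theorem hsT_smul {n : ℕ} (g : Matrix (Fin n) (Fin n) ℂ) (c : ℝ) :
    hsT ((c : ℂ) • g) = c ^ 2 * hsT g := by
  simp only [hsT_eq, Finset.mul_sum, Matrix.smul_apply, smul_eq_mul, norm_mul, mul_pow]
  simp

theorem hsF_smul {n : ℕ} (w : Fin n → ℝ) (Z : Matrix (Fin n) (Fin n) ℂ) (hZ : Z.det ≠ 0) (c : ℝ)
    (hc : c ≠ 0) : hsF w ((c : ℂ) • Z) = hsF w Z + (∑ j, w j) * Real.log (c ^ 2) := by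
  obtain ⟨U, hU, R, hR, rfl⟩ := hs_qr Z
  have hR' : ∀ i j, j < i → ((c : ℂ) • R) i j = 0 := fun i j h => by simp [hR i j h]
  rw [← Matrix.mul_smul, hsF_qr w U _ hU hR', hsF_qr w U R hU hR hZ, Finset.sum_mul,
    ← Finset.sum_add_distrib]
  · refine Finset.sum_congr rfl fun j _ => ?_
    have h1 := hs_qr_diag U R hR hZ j
    have : ‖((c : ℂ) • R) j j‖ ^ 2 = ‖R j j‖ ^ 2 * c ^ 2 := by
      simp [mul_pow, mul_comm]
    rw [this, Real.log_mul (pow_ne_zero _ (norm_ne_zero_iff.2 h1)) (pow_ne_zero _ hc), mul_add]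
  · rw [Matrix.mul_smul, Matrix.det_smul]
    exact mul_ne_zero (pow_ne_zero _ (by exact_mod_cast hc)) hZ

theorem hs_norm_det_unitary {n : ℕ} {U : Matrix (Fin n) (Fin n) ℂ}
    (hU : U ∈ unitaryGroup (Fin n) ℂ) : ‖U.det‖ = 1 := by
  have h := Matrix.det_of_mem_unitary hU
  exact CStarRing.norm_of_mem_unitary h

theorem hs_sum_log {n : ℕ} (U R : Matrix (Fin n) (Fin n) ℂ)
    (hU : U ∈ unitaryGroup (Fin n) ℂ)
    (hR : ∀ i j, j < i → R i j = 0) (hdet : (U * R).det ≠ 0) :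
    ∑ j, Real.log (‖R j j‖ ^ 2) = Real.log (‖(U * R).det‖ ^ 2) := by
  rw [Matrix.det_mul, norm_mul, hs_norm_det_unitary hU, one_mul,
    Matrix.det_of_isUpperTriangular (M := R) (fun a b hab => hR _ _ hab), norm_prod,
    ← Finset.prod_pow, Real.log_prod]
  intro l _
  exact pow_ne_zero _ (norm_ne_zero_iff.2 (hs_qr_diag U R hR hdet l))

theorem hsF_one {n : ℕ} (Z : Matrix (Fin n) (Fin n) ℂ) (hZ : Z.det ≠ 0) :
    hsF (fun _ => 1) Z = Real.log (‖Z.det‖ ^ 2) := by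
  obtain ⟨U, hU, R, hR, rfl⟩ := hs_qr Z
  rw [hsF_qr _ U R hU hR hZ, ← hs_sum_log U R hU hR hZ]
  simp

theorem hsF_bound {n : ℕ} (hn : 1 ≤ n) (w : Fin n → ℝ) (Z : Matrix (Fin n) (Fin n) ℂ)
    (hZ : Z.det ≠ 0) (C : ℝ) (hC : 1 ≤ C) (hb : ∀ i j, ‖Z i j‖ ≤ C) :
    |hsF w Z| ≤ (∑ j, |w j|) * (|Real.log (‖Z.det‖ ^ 2)| + n * Real.log ((n * C) ^ 2)) := by
  obtain ⟨U, hU, R, hR, rfl⟩ := hs_qr Z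
  have hn' : (1 : ℝ) ≤ n := by exact_mod_cast hn
  have hnC : 1 ≤ n * C := one_le_mul_of_one_le_of_one_le hn' hC
  have h1 : Uᴴ * U = 1 := (mem_unitaryGroup_iff').1 hU
  have hK : 0 ≤ Real.log ((n * C) ^ 2) := Real.log_nonneg (one_le_pow₀ hnC)
  have hRb : ∀ j, ‖R j j‖ ≤ n * C := by
    intro j
    have : R = Uᴴ * (U * R) := by rw [← mul_assoc, h1, one_mul]
    have h2 : R j j = ∑ l, Uᴴ j l * (U * R) l j := by
      conv_lhs => rw [this]
      rw [Matrix.mul_apply]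
    rw [h2]
    refine (norm_sum_le _ _).trans ?_
    have : ∀ l ∈ (Finset.univ : Finset (Fin n)), ‖Uᴴ j l * (U * R) l j‖ ≤ C := by
      intro l _
      rw [norm_mul, Matrix.conjTranspose_apply, norm_star]
      have := entry_norm_bound_of_unitary hU l j
      have h3 := hb l j
      nlinarith [norm_nonneg (U l j), norm_nonneg ((U * R) l j)]
    refine (Finset.sum_le_sum this).trans ?_
    simp
  have hpos : ∀ j, 0 < ‖R j j‖ := fun j => norm_pos_iff.2 (hs_qr_diag U R hR hZ j)
  have hle : ∀ j, Real.log (‖R j j‖ ^ 2) ≤ Real.log ((n * C) ^ 2) := fun j =>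
    Real.log_le_log (pow_pos (hpos j) 2) (pow_le_pow_left₀ (hpos j).le (hRb j) 2)
  have hs := hs_sum_log U R hU hR hZ
  have habs : ∀ j, |Real.log (‖R j j‖ ^ 2)| ≤
      |Real.log (‖(U * R).det‖ ^ 2)| + n * Real.log ((n * C) ^ 2) := by
    intro j
    rw [abs_le]
    constructor
    · rw [← Finset.add_sum_erase _ _ (Finset.mem_univ j)] at hs
      have h4 : ∑ x ∈ Finset.univ.erase j, Real.log (‖R x x‖ ^ 2) ≤ n * Real.log ((n * C) ^ 2) := by
        refine (Finset.sum_le_sum fun x _ => hle x).trans ?_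
        rw [Finset.sum_const, nsmul_eq_mul]
        refine mul_le_mul_of_nonneg_right ?_ hK
        have := Finset.card_le_univ (Finset.univ.erase j)
        rw [Fintype.card_fin] at this
        exact_mod_cast this
      have := neg_abs_le (Real.log (‖(U * R).det‖ ^ 2))
      linarith
    · have := hle j
      have h5 := abs_nonneg (Real.log (‖(U * R).det‖ ^ 2))
      nlinarith
  rw [hsF_qr w U R hU hR hZ, Finset.sum_mul]
  refine (Finset.abs_sum_le_sum_abs _ _).trans (Finset.sum_le_sum fun j _ => ?_)
  rw [abs_mul]
  exact mul_le_mul_of_nonneg_left (habs j) (abs_nonneg _)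

theorem hsF_bound' {n : ℕ} (hn : 1 ≤ n) (w : Fin n → ℝ) (Y : Matrix (Fin n) (Fin n) ℂ)
    (hY : Y.det ≠ 0) : ∃ W B : ℝ, ∀ g : Matrix (Fin n) (Fin n) ℂ, g.det ≠ 0 → hsT g = 1 →
      |hsF w (g * Y)| ≤ W * |Real.log (‖g.det‖ ^ 2)| + B := by
  let C : ℝ := 1 + ∑ i, ∑ j, ‖Y i j‖
  refine ⟨∑ j, |w j|, (∑ j, |w j|) * (|Real.log (‖Y.det‖ ^ 2)| + n * Real.log ((n * C) ^ 2)),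
    fun g hg hT => ?_⟩
  have hC : 1 ≤ C := by
    have : 0 ≤ ∑ i, ∑ j, ‖Y i j‖ := by positivity
    simp only [C]; linarith
  have hd : (g * Y).det ≠ 0 := by rw [Matrix.det_mul]; exact mul_ne_zero hg hY
  refine (hsF_bound hn w (g * Y) hd C hC ?_).trans ?_
  · intro i j
    rw [Matrix.mul_apply]
    refine (norm_sum_le _ _).trans ?_
    have h1 : ∀ l ∈ (Finset.univ : Finset (Fin n)), ‖g i l * Y l j‖ ≤ ∑ j, ‖Y l j‖ := by
      intro l _
      rw [norm_mul]
      have h2 : ‖g i l‖ ≤ 1 := by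
        have := hsT_entry g i l
        rw [hT] at this
        exact (sq_le_one_iff₀ (norm_nonneg _)).1 this
      refine (mul_le_of_le_one_left (norm_nonneg _) h2).trans ?_
      exact Finset.single_le_sum (f := fun j => ‖Y l j‖) (fun _ _ => norm_nonneg _)
        (Finset.mem_univ j)
    refine (Finset.sum_le_sum h1).trans ?_
    simp only [C]; linarith
  · rw [← mul_add]
    refine mul_le_mul_of_nonneg_left ?_ (by positivity)
    rw [← add_assoc]
    refine add_le_add_left ?_ _
    rw [Matrix.det_mul, norm_mul, mul_pow, Real.log_mul]
    · exact abs_add_le _ _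
    · exact pow_ne_zero _ (norm_ne_zero_iff.2 hg)
    · exact pow_ne_zero _ (norm_ne_zero_iff.2 hY)

/-- the penalised functional -/
noncomputable def hsPhi {n : ℕ} (w : Fin 3 → Fin n → ℝ) (Y : Fin 3 → Matrix (Fin n) (Fin n) ℂ)
    (ε : ℝ) (g : Matrix (Fin n) (Fin n) ℂ) : ℝ :=
  ∑ k, hsF (w k) (g * Y k) + ε * (hsT g ^ n * Real.exp (- hsF (fun _ => 1) g))

theorem hs_exp {n : ℕ} (g : Matrix (Fin n) (Fin n) ℂ) (hg : g.det ≠ 0) :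
    Real.exp (- hsF (fun _ => 1) g) = (‖g.det‖ ^ 2)⁻¹ := by
  rw [hsF_one g hg, Real.exp_neg, Real.exp_log (pow_pos (norm_pos_iff.2 hg) 2)]

theorem hsF_cont {n : ℕ} (w : Fin n → ℝ) (g : Matrix (Fin n) (Fin n) ℂ) (hg : g.det ≠ 0) :
    ContinuousAt (hsF w) g := by
  unfold hsF
  refine tendsto_finsetSum _ fun j _ => ?_
  refine Tendsto.const_mul _ (Tendsto.sub ?_ ?_)
  · exact ((hsD_cont _).continuousAt).log (hsD_pos _ g hg).ne'
  · exact ((hsD_cont _).continuousAt).log (hsD_pos _ g hg).ne'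

theorem hsPhi_cont {n : ℕ} (w : Fin 3 → Fin n → ℝ) (Y : Fin 3 → Matrix (Fin n) (Fin n) ℂ)
    (hY : ∀ k, (Y k).det ≠ 0)
    (ε : ℝ) (g : Matrix (Fin n) (Fin n) ℂ) (hg : g.det ≠ 0) : ContinuousAt (hsPhi w Y ε) g := by
  unfold hsPhi
  refine ContinuousAt.add ?_ ?_
  · refine tendsto_finsetSum _ fun k _ => ?_
    have h : Continuous (fun g : Matrix (Fin n) (Fin n) ℂ => g * Y k) := by fun_prop
    refine (hsF_cont (w k) (g * Y k) ?_).tendsto.comp h.continuousAt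
    rw [Matrix.det_mul]; exact mul_ne_zero hg (hY k)
  · refine continuousAt_const.mul ((hsT_cont.continuousAt.pow n).mul ?_)
    exact (hsF_cont _ g hg).neg.rexp

theorem hsPhi_smul {n : ℕ} (w : Fin 3 → Fin n → ℝ) (Y : Fin 3 → Matrix (Fin n) (Fin n) ℂ)
    (hY : ∀ k, (Y k).det ≠ 0) (hw : ∑ k, ∑ j, w k j = 0)
    (ε : ℝ) (g : Matrix (Fin n) (Fin n) ℂ) (hg : g.det ≠ 0) (c : ℝ) (hc : c ≠ 0) :
    hsPhi w Y ε ((c : ℂ) • g) = hsPhi w Y ε g := by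
  have hd : ((c : ℂ) • g).det ≠ 0 := by
    rw [Matrix.det_smul]
    exact mul_ne_zero (pow_ne_zero _ (by exact_mod_cast hc)) hg
  have hA : ∑ k, hsF (w k) ((c : ℂ) • g * Y k) = ∑ k, hsF (w k) (g * Y k) := by
    have : ∀ k, hsF (w k) ((c : ℂ) • g * Y k) =
        hsF (w k) (g * Y k) + (∑ j, w k j) * Real.log (c ^ 2) := by
      intro k
      rw [Matrix.smul_mul, hsF_smul _ _ _ c hc]
      rw [Matrix.det_mul]; exact mul_ne_zero hg (hY k)
    simp only [this, Finset.sum_add_distrib, ← Finset.sum_mul, hw]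
    simp
  have hB : hsT ((c : ℂ) • g) ^ n * Real.exp (- hsF (fun _ => 1) ((c : ℂ) • g)) =
      hsT g ^ n * Real.exp (- hsF (fun _ => 1) g) := by
    rw [hs_exp _ hd, hs_exp _ hg, hsT_smul, Matrix.det_smul, norm_mul, norm_pow, Complex.norm_real,
      Fintype.card_fin]
    have h1 : (‖c‖ ^ n * ‖g.det‖) ^ 2 = (c ^ 2) ^ n * ‖g.det‖ ^ 2 := by
      rw [mul_pow, ← pow_mul, mul_comm n 2, pow_mul, Real.norm_eq_abs, sq_abs]
    rw [h1, mul_pow, mul_inv]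
    have h2 : (c ^ 2) ^ n ≠ 0 := pow_ne_zero _ (pow_ne_zero _ hc)
    generalize (c ^ 2) ^ n = x at *
    generalize (‖g.det‖ ^ 2)⁻¹ = y
    generalize hsT g ^ n = z
    field_simp
  unfold hsPhi
  rw [hA, hB]

theorem hs_min {n : ℕ} (hn : 1 ≤ n) (w : Fin 3 → Fin n → ℝ) (Y : Fin 3 → Matrix (Fin n) (Fin n) ℂ)
    (hY : ∀ k, (Y k).det ≠ 0) (hw : ∑ k, ∑ j, w k j = 0) (ε : ℝ) (hε : 0 < ε) :
    ∃ g : Matrix (Fin n) (Fin n) ℂ, hsT g = 1 ∧ g.det ≠ 0 ∧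
      ∀ h : Matrix (Fin n) (Fin n) ℂ, h.det ≠ 0 → hsPhi w Y ε g ≤ hsPhi w Y ε h := by
  have hnorm : ∀ h : Matrix (Fin n) (Fin n) ℂ, h.det ≠ 0 → ∃ c : ℝ, c ≠ 0 ∧
      hsT ((c : ℂ) • h) = 1 ∧ ((c : ℂ) • h).det ≠ 0 := by
    intro h hh
    have hT : 0 < hsT h := by
      have h0 : 0 ≤ hsT h := by rw [hsT_eq]; positivity
      refine lt_of_le_of_ne h0 fun h1 => hh ?_
      have : h = 0 := by
        ext i j
        have := hsT_entry h i j
        rw [← h1] at this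
        have h2 : ‖h i j‖ = 0 := by nlinarith [norm_nonneg (h i j)]
        simpa using h2
      rw [this]
      haveI : Nonempty (Fin n) := ⟨⟨0, hn⟩⟩
      exact Matrix.det_zero
    have hs : Real.sqrt (hsT h) ≠ 0 := (Real.sqrt_pos.2 hT).ne'
    refine ⟨(Real.sqrt (hsT h))⁻¹, inv_ne_zero hs, ?_, ?_⟩
    · rw [hsT_smul, inv_pow, Real.sq_sqrt hT.le, inv_mul_cancel₀ hT.ne']
    · rw [Matrix.det_smul]
      exact mul_ne_zero (pow_ne_zero _ (by exact_mod_cast inv_ne_zero hs)) hh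
  obtain ⟨c0, hc0, hg0T, hg0⟩ := hnorm 1 (by simp)
  set g0 : Matrix (Fin n) (Fin n) ℂ := (c0 : ℂ) • 1 with hg0def
  choose W B hWB using fun k => hsF_bound' hn (w k) (Y k) (hY k)
  have hlow : ∀ g : Matrix (Fin n) (Fin n) ℂ, g.det ≠ 0 → hsT g = 1 →
      ε * (‖g.det‖ ^ 2)⁻¹ - (∑ k, W k) * |Real.log (‖g.det‖ ^ 2)| - ∑ k, B k ≤ hsPhi w Y ε g := by
    intro g hg hT
    have h1 : -((∑ k, W k) * |Real.log (‖g.det‖ ^ 2)| + ∑ k, B k) ≤ ∑ k, hsF (w k) (g * Y k) := by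
      rw [Finset.sum_mul, ← Finset.sum_add_distrib, ← Finset.sum_neg_distrib]
      exact Finset.sum_le_sum fun k _ => (abs_le.1 (hWB k g hg hT)).1
    rw [hsPhi, hs_exp g hg, hT, one_pow, one_mul]
    linarith
  have hev : ∀ᶠ d in 𝓝[>] (0 : ℝ), (∑ k, W k) * |Real.log d * d| +
      (∑ k, B k + hsPhi w Y ε g0) * d < ε := by
    have h1 : Tendsto (fun d : ℝ => Real.log d * d) (𝓝[>] 0) (𝓝 0) := by
      simpa using tendsto_log_mul_rpow_nhdsGT_zero (r := 1) one_pos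
    have h2 : Tendsto (fun d : ℝ => d) (𝓝[>] 0) (𝓝 0) := tendsto_id.mono_left nhdsWithin_le_nhds
    have h3 := (h1.abs.const_mul (∑ k, W k)).add (h2.const_mul (∑ k, B k + hsPhi w Y ε g0))
    refine h3.eventually_lt_const ?_
    simpa using hε
  obtain ⟨δ, hδ, hδ'⟩ := (mem_nhdsGT_iff_exists_Ioo_subset).1 hev
  have hδ0 : 0 < δ := hδ
  let S : Set (Matrix (Fin n) (Fin n) ℂ) := {g | hsT g = 1 ∧ min δ (‖g0.det‖ ^ 2) ≤ ‖g.det‖ ^ 2}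
  have hm : 0 < min δ (‖g0.det‖ ^ 2) := lt_min hδ0 (pow_pos (norm_pos_iff.2 hg0) 2)
  have hSd : ∀ g ∈ S, g.det ≠ 0 := by
    intro g hg h0
    have := hg.2
    rw [h0] at this
    simp at this
    rcases this with h | h
    · linarith
    · exact hg0 h
  have hSc : IsClosed S := by
    have h1 : IsClosed {g : Matrix (Fin n) (Fin n) ℂ | hsT g = 1} :=
      isClosed_eq hsT_cont continuous_const
    have h2 : IsClosed {g : Matrix (Fin n) (Fin n) ℂ | min δ (‖g0.det‖ ^ 2) ≤ ‖g.det‖ ^ 2} :=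
      isClosed_le continuous_const ((continuous_id.matrix_det.norm).pow 2)
    exact h1.inter h2
  have hScomp : IsCompact S := by
    have hK : IsCompact (Set.pi Set.univ (fun _ : Fin n => Set.pi Set.univ
      (fun _ : Fin n => Metric.closedBall (0 : ℂ) 1))) :=
      isCompact_univ_pi fun _ => isCompact_univ_pi fun _ => isCompact_closedBall _ _
    refine IsCompact.of_isClosed_subset hK hSc ?_
    intro g hg i _ j _
    have := hsT_entry g i j
    rw [hg.1] at this
    simpa using (sq_le_one_iff₀ (norm_nonneg _)).1 this
  have hg0S : g0 ∈ S := ⟨hg0T, min_le_right _ _⟩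
  obtain ⟨g, hgS, hgmin⟩ := hScomp.exists_isMinOn ⟨g0, hg0S⟩
    (f := hsPhi w Y ε) (fun g hg => (hsPhi_cont w Y hY ε g (hSd g hg)).continuousWithinAt)
  refine ⟨g, hgS.1, hSd g hgS, fun h hh => ?_⟩
  obtain ⟨c, hc, hcT, hcd⟩ := hnorm h hh
  rw [← hsPhi_smul w Y hY hw ε h hh c hc]
  set h' := (c : ℂ) • h
  by_cases hS : h' ∈ S
  · exact hgmin hS
  · have hlt : ‖h'.det‖ ^ 2 < δ := by
      by_contra hcon
      exact hS ⟨hcT, (min_le_left _ _).trans (not_lt.1 hcon)⟩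
    have hp : 0 < ‖h'.det‖ ^ 2 := pow_pos (norm_pos_iff.2 hcd) 2
    refine (hgmin hg0S).trans (le_trans ?_ (hlow h' hcd hcT))
    have h1 : (∑ k, W k) * |Real.log (‖h'.det‖ ^ 2) * ‖h'.det‖ ^ 2| +
      (∑ k, B k + hsPhi w Y ε g0) * ‖h'.det‖ ^ 2 < ε := hδ' ⟨hp, hlt⟩
    generalize ‖h'.det‖ ^ 2 = d at *
    rw [abs_mul, abs_of_pos hp] at h1
    have h2 : (∑ k, W k) * |Real.log d| + (∑ k, B k + hsPhi w Y ε g0) ≤ ε * d⁻¹ := by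
      rw [← div_eq_mul_inv, le_div_iff₀ hp]
      nlinarith
    show hsPhi w Y ε g0 ≤ _
    linarith

theorem hs_crit {n : ℕ} (hn : 1 ≤ n) (w : Fin 3 → Fin n → ℝ)
    (Y : Fin 3 → Matrix (Fin n) (Fin n) ℂ)
    (hY : ∀ k, (Y k).det ≠ 0) (hw : ∑ k, ∑ j, w k j = 0) (ε : ℝ) (hε : 0 < ε) :
    ∃ (g : Matrix (Fin n) (Fin n) ℂ) (U R : Fin 3 → Matrix (Fin n) (Fin n) ℂ) (τ : ℝ),
      hsT g = 1 ∧ 0 < τ ∧ τ * ‖g.det‖ ^ 2 = ε ∧ (∀ k, U k ∈ unitaryGroup (Fin n) ℂ) ∧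
      (∀ k i j, j < i → R k i j = 0) ∧ (∀ k, g * Y k = U k * R k) ∧
      ∑ k, U k * diagonal (fun j => (w k j : ℂ)) * (U k)ᴴ =
        (τ : ℂ) • (1 - (n : ℂ) • (g * gᴴ)) := by
  obtain ⟨g, hT, hg, hmin⟩ := hs_min hn w Y hY hw ε hε
  choose U hU R hR hUR using fun k => hs_qr (g * Y k)
  obtain ⟨U0, hU0, R0, hR0, hUR0⟩ := hs_qr g
  have hp : 0 < ‖g.det‖ ^ 2 := pow_pos (norm_pos_iff.2 hg) 2
  let τ : ℝ := ε * (‖g.det‖ ^ 2)⁻¹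
  refine ⟨g, U, R, τ, hT, by positivity, by simp only [τ]; field_simp, hU, hR, hUR, ?_⟩
  let M := ∑ k, U k * diagonal (fun j => (w k j : ℂ)) * (U k)ᴴ
  let X := M + (τ : ℂ) • ((n : ℂ) • (g * gᴴ) - 1)
  have hM : Mᴴ = M := by
    simp only [M, Matrix.conjTranspose_sum]
    refine Finset.sum_congr rfl fun k _ => ?_
    simp only [Matrix.conjTranspose_mul, Matrix.conjTranspose_conjTranspose,
      Matrix.diagonal_conjTranspose, mul_assoc]
    congr 3
    ext j
    simp
  have hX : Xᴴ = X := by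
    simp only [X, Matrix.conjTranspose_add, hM, Matrix.conjTranspose_smul, Matrix.conjTranspose_sub,
      Matrix.conjTranspose_mul, Matrix.conjTranspose_conjTranspose, Matrix.conjTranspose_one]
    simp
  have hd1 : HasDerivAt (fun t : ℝ => ∑ k, hsF (w k) ((1 + (t : ℂ) • X) * g * Y k))
      (∑ k, 2 * (X * (U k * diagonal (fun j => (w k j : ℂ)) * (U k)ᴴ)).trace.re) 0 := by
    refine HasDerivAt.fun_sum fun k _ => ?_
    have hdk : (U k * R k).det ≠ 0 := by
      rw [← hUR k, Matrix.det_mul]; exact mul_ne_zero hg (hY k)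
    have := hsF_deriv (w k) (U k) (R k) X (hU k) (hR k) hdk hX
    simp only [mul_assoc _ g (Y k), hUR k]
    exact this
  have hd2 : HasDerivAt (fun t : ℝ => hsF (fun _ => 1) ((1 + (t : ℂ) • X) * g))
      (2 * X.trace.re) 0 := by
    have := hsF_deriv (fun _ => 1) U0 R0 X hU0 hR0 (by rw [← hUR0]; exact hg) hX
    rw [← hUR0] at this
    have h1 : U0 * U0ᴴ = 1 := (mem_unitaryGroup_iff).1 hU0
    simpa [h1] using this
  have hd3 := hsT_deriv g X hX
  have hd := hd1.add (((hd3.pow n).mul hd2.neg.exp).const_mul ε)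
  have hloc : IsLocalMin (fun t : ℝ => hsPhi w Y ε ((1 + (t : ℂ) • X) * g)) 0 := by
    have hc : Continuous (fun t : ℝ => ((1 + (t : ℂ) • X) * g).det) := by
      refine Continuous.matrix_det ?_
      fun_prop
    have hev : ∀ᶠ t : ℝ in 𝓝 0, ((1 + (t : ℂ) • X) * g).det ≠ 0 :=
      hc.continuousAt.eventually_ne (by simpa using hg)
    filter_upwards [hev] with t ht
    simpa using hmin _ ht
  have h0 := hloc.hasDerivAt_eq_zero hd
  have he := hs_exp g hg
  simp only [Pi.neg_apply, Pi.pow_apply, Complex.ofReal_zero, zero_smul, add_zero, one_mul, hT, one_pow, he, mul_one] at h0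
  have hXX : (X * X).trace.re = ∑ k, (X * (U k * diagonal (fun j => (w k j : ℂ)) * (U k)ᴴ)).trace.re
      + τ * (n * (X * (g * gᴴ)).trace.re - X.trace.re) := by
    conv_lhs => rhs; arg 1; rhs; rw [show X = M + (τ : ℂ) • ((n : ℂ) • (g * gᴴ) - 1) from rfl]
    rw [mul_add, Matrix.trace_add, Complex.add_re, Finset.mul_sum, Matrix.trace_sum, Complex.re_sum,
      Matrix.mul_smul, Matrix.trace_smul, smul_eq_mul, Complex.re_ofReal_mul, mul_sub, mul_one,
      Matrix.trace_sub, Complex.sub_re, Matrix.mul_smul, Matrix.trace_smul, smul_eq_mul]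
    simp
  have hXX0 : hsT X = 0 := by
    rw [hsT, hX, hXX]
    rw [← Finset.mul_sum] at h0
    simp only [τ]
    linear_combination h0 / 2
  have hX0 : X = 0 := by
    ext i j
    have := hsT_entry X i j
    rw [hXX0] at this
    have h2 : ‖X i j‖ = 0 := by nlinarith [norm_nonneg (X i j)]
    simpa using h2
  have : M = (τ : ℂ) • (1 - (n : ℂ) • (g * gᴴ)) := by
    have h : M + (τ : ℂ) • ((n : ℂ) • (g * gᴴ) - 1) = 0 := hX0
    rw [eq_neg_of_add_eq_zero_left h, ← smul_neg, neg_sub]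
  exact this

open Matrix Filter Topology

theorem hs_rank {n : ℕ} (f : (Fin n → ℂ) →ₗ[ℂ] (Fin n → ℂ)) (p : Submodule ℂ (Fin n → ℂ)) :
    Module.finrank ℂ (p.map f) + Module.finrank ℂ (LinearMap.ker f ⊓ p : Submodule ℂ (Fin n → ℂ)) =
      Module.finrank ℂ p := by
  have h := LinearMap.finrank_range_add_finrank_ker (f.domRestrict p)
  rw [LinearMap.range_domRestrict, LinearMap.ker_domRestrict] at h
  rw [← h]
  congr 1
  have h2 : (LinearMap.ker f ⊓ p : Submodule ℂ (Fin n → ℂ)) =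
      ((LinearMap.ker f).comap p.subtype).map p.subtype := by
    rw [Submodule.map_comap_subtype, inf_comm]
  rw [h2]
  exact Submodule.finrank_map_subtype_eq p _

theorem hs_finrank_E {n : ℕ} (i : ℕ) : (Module.finrank ℂ (hsE n i) : ℝ) =
    ∑ l : Fin n, if l.val < i then (1 : ℝ) else 0 := by
  have h : hsProj (diagonal (fun l : Fin n => if l.val < i then (1 : ℂ) else 0)) (hsE n i) := by
    refine ⟨?_, ?_, ?_⟩
    · rw [Matrix.diagonal_conjTranspose]
      congr 1
      ext l
      simp only [Pi.star_apply]
      split_ifs <;> simp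
    · rw [Matrix.diagonal_mul_diagonal]
      congr 1
      ext l
      split_ifs <;> simp
    · intro v
      rw [mem_hsE, funext_iff]
      refine forall_congr' fun l => ?_
      rw [Matrix.mulVec_diagonal]
      split_ifs with hl
      · simp; omega
      · simp only [zero_mul]
        constructor
        · intro h; exact (h (by omega)).symm
        · intro h _; exact h.symm
  have h1 := h.trace
  rw [Matrix.trace_diagonal] at h1
  have h2 := congrArg Complex.re h1
  rw [Complex.re_sum, Complex.natCast_re] at h2
  rw [← h2]
  refine Finset.sum_congr rfl fun l _ => ?_
  split_ifs <;> simp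

/-- one flag estimate at a degenerate limit -/
theorem hs_flag {n : ℕ} (w : Fin n → ℝ) (hw : Antitone w) (g Y U R : Matrix (Fin n) (Fin n) ℂ)
    (hY : Y.det ≠ 0) (hU : U ∈ unitaryGroup (Fin n) ℂ) (hR : ∀ i j, j < i → R i j = 0)
    (h : g * Y = U * R) :
    ∑ j, w j - hsS w ((LinearMap.ker (Matrix.toLin' g)).comap (Matrix.toLin' Y)) ≤
      hsS w ((LinearMap.range (Matrix.toLin' g)).comap (Matrix.toLin' U)) := by
  have h1 : Uᴴ * U = 1 := (mem_unitaryGroup_iff').1 hU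
  have hUd : U.det ≠ 0 := by
    intro h0
    have := hs_norm_det_unitary hU
    rw [h0] at this
    simp at this
  set K := (LinearMap.ker (Matrix.toLin' g)).comap (Matrix.toLin' Y) with hK
  set I := (LinearMap.range (Matrix.toLin' g)).comap (Matrix.toLin' U) with hI
  have hker : LinearMap.ker (Matrix.toLin' R) = K := by
    ext v
    simp only [hK, Submodule.mem_comap, LinearMap.mem_ker, Matrix.toLin'_apply,
      Matrix.mulVec_mulVec, h]
    constructor
    · intro hv
      rw [← Matrix.mulVec_mulVec, hv, Matrix.mulVec_zero]
    · intro hv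
      have : R = Uᴴ * (U * R) := by rw [← mul_assoc, h1, one_mul]
      rw [this, ← Matrix.mulVec_mulVec, hv, Matrix.mulVec_zero]
  have hrk : ∀ i, ((Module.finrank ℂ (hsE n i) : ℝ) -
      (Module.finrank ℂ (K ⊓ hsE n i : Submodule ℂ (Fin n → ℂ)) : ℝ)) =
        (Module.finrank ℂ ((hsE n i).map (Matrix.toLin' R)) : ℝ) := by
    intro i
    have := hs_rank (Matrix.toLin' R) (hsE n i)
    rw [hker] at this
    rw [← this]
    push_cast
    ring
  have key := hs_abel w hw
    (fun i => (Module.finrank ℂ (hsE n i) : ℝ) -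
      (Module.finrank ℂ (K ⊓ hsE n i : Submodule ℂ (Fin n → ℂ)) : ℝ))
    (fun i => (Module.finrank ℂ (I ⊓ hsE n i : Submodule ℂ (Fin n → ℂ)) : ℝ)) ?_ ?_ ?_
  · refine le_trans (le_of_eq ?_) key
    rw [hsS, ← Finset.sum_sub_distrib]
    refine Finset.sum_congr rfl fun j _ => ?_
    have h2 := hs_jump (fun _ : Fin n => (1 : ℝ)) j
    rw [← hs_finrank_E, ← hs_finrank_E] at h2
    linear_combination (- w j) * h2
  · have h0 : ∀ W : Submodule ℂ (Fin n → ℂ), W ⊓ hsE n 0 = ⊥ := fun W => by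
      rw [hsE_zero, inf_bot_eq]
    rw [h0, h0, hsE_zero]
    simp
  · have h0 : ∀ W : Submodule ℂ (Fin n → ℂ), W ⊓ hsE n n = W := fun W => by
      rw [hsE_top, inf_top_eq]
    rw [h0, h0, hsE_top, hK, hI, hs_finrank_comap _ hY, hs_finrank_comap _ hUd]
    have := LinearMap.finrank_range_add_finrank_ker (Matrix.toLin' g)
    rw [finrank_top, ← this]
    push_cast
    ring
  · intro i _
    rw [hrk]
    have : (hsE n i).map (Matrix.toLin' R) ≤ I ⊓ hsE n i := by
      rintro _ ⟨v, hv, rfl⟩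
      refine Submodule.mem_inf.2 ⟨?_, ?_⟩
      · rw [hI, Submodule.mem_comap, Matrix.toLin'_apply, Matrix.toLin'_apply,
          Matrix.mulVec_mulVec, ← h, ← Matrix.mulVec_mulVec, ← Matrix.toLin'_apply g]
        exact LinearMap.mem_range_self _ _
      · intro a ha
        rw [Matrix.toLin'_apply, Matrix.mulVec, dotProduct]
        refine Finset.sum_eq_zero fun b _ => ?_
        by_cases hb : i ≤ b.val
        · rw [mem_hsE.1 hv b hb, mul_zero]
        · rw [hR a b (by rw [Fin.lt_def]; omega), zero_mul]
    exact_mod_cast Submodule.finrank_mono this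

theorem hs_solve {n : ℕ} (hn : 1 ≤ n) (w : Fin 3 → Fin n → ℝ) (hwa : ∀ k, Antitone (w k))
    (Y : Fin 3 → Matrix (Fin n) (Fin n) ℂ)
    (hY : ∀ k, (Y k).det ≠ 0) (hw : ∑ k, ∑ j, w k j = 0) (hss : hsSS w Y) :
    ∃ U : Fin 3 → Matrix (Fin n) (Fin n) ℂ, (∀ k, U k ∈ unitaryGroup (Fin n) ℂ) ∧
      ∑ k, U k * diagonal (fun j => (w k j : ℂ)) * (U k)ᴴ = 0 := by
  let F : Filter ℕ := (hyperfilter ℕ : Filter ℕ)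
  have hF : F ≤ atTop := Nat.hyperfilter_le_atTop
  haveI : NeBot F := (hyperfilter ℕ).neBot
  choose g U R τ hT hτ hτd hU hR hUR hM using fun N : ℕ =>
    hs_crit hn w Y hY hw (1 / ((N : ℝ) + 1)) (by positivity)
  obtain ⟨g0, hg0⟩ : ∃ g0, Tendsto g F (𝓝 g0) := hs_ult g 1 (fun N i j => by
    have := hsT_entry (g N) i j
    rw [hT] at this
    exact (sq_le_one_iff₀ (norm_nonneg _)).1 this)
  have hU0' : ∀ k, ∃ U0, Tendsto (fun N => U N k) F (𝓝 U0) := fun k =>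
    hs_ult (fun N => U N k) 1 (fun N => entry_norm_bound_of_unitary (hU N k))
  choose U0 hU0 using hU0'
  have hct : ∀ (A : ℕ → Matrix (Fin n) (Fin n) ℂ) (A0 : Matrix (Fin n) (Fin n) ℂ),
      Tendsto A F (𝓝 A0) → Tendsto (fun N => (A N)ᴴ) F (𝓝 A0ᴴ) := fun A A0 h =>
    (continuous_id.matrix_conjTranspose.tendsto A0).comp h
  have hU0u : ∀ k, U0 k ∈ unitaryGroup (Fin n) ℂ := by
    intro k
    rw [mem_unitaryGroup_iff]
    have h1 := (hU0 k).mul (hct _ _ (hU0 k))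
    have h2 : ∀ N, U N k * (U N k)ᴴ = 1 := fun N => mem_unitaryGroup_iff.1 (hU N k)
    simp only [h2] at h1
    exact tendsto_nhds_unique h1 tendsto_const_nhds
  refine ⟨U0, hU0u, ?_⟩
  set M0 := ∑ k, U0 k * diagonal (fun j => (w k j : ℂ)) * (U0 k)ᴴ with hM0
  have hMlim : Tendsto (fun N => (τ N : ℂ) • (1 - (n : ℂ) • (g N * (g N)ᴴ))) F (𝓝 M0) := by
    simp only [← hM]
    exact tendsto_finsetSum _ fun k _ => ((hU0 k).mul tendsto_const_nhds).mul (hct _ _ (hU0 k))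
  have hBlim : Tendsto (fun N => (1 - (n : ℂ) • (g N * (g N)ᴴ) : Matrix (Fin n) (Fin n) ℂ)) F
      (𝓝 (1 - (n : ℂ) • (g0 * g0ᴴ))) :=
    tendsto_const_nhds.sub ((hg0.mul (hct _ _ hg0)).const_smul (n : ℂ))
  have hT0 : hsT g0 = 1 := by
    have h1 : Tendsto (fun N => hsT (g N)) F (𝓝 (hsT g0)) := (hsT_cont.tendsto g0).comp hg0
    simp only [hT] at h1
    exact tendsto_nhds_unique h1 tendsto_const_nhds
  suffices hτ0 : Tendsto τ F (𝓝 0) by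
    have h1 : Tendsto (fun N => (τ N : ℂ)) F (𝓝 ((0 : ℝ) : ℂ)) :=
      (Complex.continuous_ofReal.tendsto 0).comp hτ0
    have h2 := h1.smul hBlim
    rw [Complex.ofReal_zero, zero_smul] at h2
    exact tendsto_nhds_unique hMlim h2
  by_cases hd : g0.det = 0
  · obtain ⟨P, hP⟩ := hsProj_exists (LinearMap.range (Matrix.toLin' g0))
    have hPg : P * g0 = g0 := by
      apply Matrix.toLin'.injective
      apply LinearMap.ext
      intro v
      rw [Matrix.toLin'_apply, ← Matrix.mulVec_mulVec, ← Matrix.toLin'_apply g0]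
      exact (hP.mem _).1 (LinearMap.mem_range_self _ _)
    have htrc : ∀ (A : ℕ → Matrix (Fin n) (Fin n) ℂ) (A0 : Matrix (Fin n) (Fin n) ℂ),
        Tendsto A F (𝓝 A0) → Tendsto (fun N => (P * A N).trace.re) F (𝓝 (P * A0).trace.re) := by
      intro A A0 h
      have hc : Continuous (fun A : Matrix (Fin n) (Fin n) ℂ => (P * A).trace.re) :=
        Complex.continuous_re.comp (Continuous.matrix_trace (by fun_prop))
      exact (hc.tendsto A0).comp h
    have h1 := htrc _ _ hMlim
    have h2 := htrc _ _ hBlim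
    have hneg : (P * (1 - (n : ℂ) • (g0 * g0ᴴ))).trace.re < 0 := by
      have h3 : P * (1 - (n : ℂ) • (g0 * g0ᴴ)) = P - (n : ℂ) • (g0 * g0ᴴ) := by
        rw [mul_sub, mul_one, Matrix.mul_smul, ← mul_assoc, hPg]
      rw [h3, Matrix.trace_sub, hP.trace, Matrix.trace_smul, smul_eq_mul, Complex.sub_re,
        Complex.natCast_re]
      have h4 : ((n : ℂ) * (g0 * g0ᴴ).trace).re = n * hsT g0 := by
        rw [hsT, ← Complex.ofReal_natCast, Complex.re_ofReal_mul]
      rw [h4, hT0, mul_one, sub_neg]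
      have h5 : Module.finrank ℂ (LinearMap.range (Matrix.toLin' g0)) < n := by
        have h6 : LinearMap.range (Matrix.toLin' g0) ≠ ⊤ := by
          intro htop
          have h7 : LinearMap.ker (Matrix.toLin' g0) = ⊥ :=
            LinearMap.ker_eq_bot_iff_range_eq_top.2 htop
          obtain ⟨v, hv, hv0⟩ := Matrix.exists_mulVec_eq_zero_iff.2 hd
          exact hv ((Submodule.eq_bot_iff _).1 h7 v (by
            rw [LinearMap.mem_ker, Matrix.toLin'_apply, hv0]))
        have := Submodule.finrank_lt h6
        simpa using this
      exact_mod_cast h5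
    have hpos : 0 ≤ (P * M0).trace.re := by
      have hR0 : ∀ k i j, j < i → ((U0 k)ᴴ * (g0 * Y k)) i j = 0 := by
        intro k i j hij
        have h3 : Tendsto (fun N => (U N k)ᴴ * (g N * Y k)) F (𝓝 ((U0 k)ᴴ * (g0 * Y k))) :=
          (hct _ _ (hU0 k)).mul (hg0.mul tendsto_const_nhds)
        have h4 : ∀ N, (U N k)ᴴ * (g N * Y k) = R N k := by
          intro N
          rw [hUR, ← mul_assoc, show (U N k)ᴴ * U N k = 1 from mem_unitaryGroup_iff'.1 (hU N k),
            one_mul]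
        simp only [h4] at h3
        have h5 := tendsto_pi_nhds.1 (tendsto_pi_nhds.1 h3 i) j
        simp only [hR _ k i j hij] at h5
        exact tendsto_nhds_unique h5 tendsto_const_nhds
      have h3 : ∀ k, ∑ j, w k j -
          hsS (w k) ((LinearMap.ker (Matrix.toLin' g0)).comap (Matrix.toLin' (Y k))) ≤
          (P * (U0 k * diagonal (fun j => (w k j : ℂ)) * (U0 k)ᴴ)).trace.re := by
        intro k
        refine (hs_flag (w k) (hwa k) g0 (Y k) (U0 k) _ (hY k) (hU0u k) (hR0 k) ?_).trans
          (hs_key' hP (hU0u k) (w k) (hwa k))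
        rw [← mul_assoc, show U0 k * (U0 k)ᴴ = 1 from mem_unitaryGroup_iff.1 (hU0u k), one_mul]
      have h4 := Finset.sum_le_sum fun k (_ : k ∈ Finset.univ) => h3 k
      rw [Finset.sum_sub_distrib, hw, ← Complex.re_sum, ← Matrix.trace_sum, ← Finset.mul_sum] at h4
      have := hss (LinearMap.ker (Matrix.toLin' g0))
      rw [hM0]
      linarith
    have h3 : ∀ N, (P * ((τ N : ℂ) • (1 - (n : ℂ) • (g N * (g N)ᴴ)))).trace.re =
        τ N * (P * (1 - (n : ℂ) • (g N * (g N)ᴴ))).trace.re := by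
      intro N
      rw [Matrix.mul_smul, Matrix.trace_smul, smul_eq_mul, Complex.re_ofReal_mul]
    simp only [h3] at h1
    have h4 := h1.div h2 hneg.ne
    have h5 : Tendsto τ F (𝓝 ((P * M0).trace.re / (P * (1 - (n : ℂ) • (g0 * g0ᴴ))).trace.re)) := by
      refine h4.congr' ?_
      filter_upwards [h2.eventually_ne hneg.ne] with N hN
      exact mul_div_cancel_right₀ _ hN
    have h6 := ge_of_tendsto' h5 (fun N => (hτ N).le)
    have h7 := div_nonpos_of_nonneg_of_nonpos hpos hneg.le
    rwa [le_antisymm h7 h6] at h5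
  · have h1 : Tendsto (fun N => ‖(g N).det‖ ^ 2) F (𝓝 (‖g0.det‖ ^ 2)) :=
      (((continuous_id.matrix_det.norm).pow 2).tendsto g0).comp hg0
    have h2 : Tendsto (fun N : ℕ => 1 / ((N : ℝ) + 1)) F (𝓝 0) :=
      tendsto_one_div_add_atTop_nhds_zero_nat.mono_left hF
    have hne : ‖g0.det‖ ^ 2 ≠ 0 := pow_ne_zero _ (norm_ne_zero_iff.2 hd)
    have h3 := h2.div h1 hne
    rw [zero_div] at h3
    refine h3.congr' ?_
    filter_upwards [h1.eventually_ne hne] with N hN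
    show 1 / ((N : ℝ) + 1) / ‖(g N).det‖ ^ 2 = τ N
    rw [← hτd N]
    exact mul_div_cancel_right₀ _ hN


theorem hs_charpoly_conj {n : ℕ} (U : Matrix (Fin n) (Fin n) ℂ) (hU : U ∈ unitaryGroup (Fin n) ℂ)
    (d : Fin n → ℂ) : (U * diagonal d * Uᴴ).charpoly =
      ∏ i, (Polynomial.X - Polynomial.C (d i)) := by
  have h1 : Uᴴ * U = 1 := (mem_unitaryGroup_iff').1 hU
  rw [Matrix.charpoly_mul_comm, ← mul_assoc, h1, one_mul, Matrix.charpoly_diagonal]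

theorem hs_herm_conj {n : ℕ} (U : Matrix (Fin n) (Fin n) ℂ) (w : Fin n → ℝ) :
    (U * diagonal (fun j => (w j : ℂ)) * Uᴴ).IsHermitian := by
  have hD : (diagonal (fun j => (w j : ℂ))).IsHermitian :=
    Matrix.isHermitian_diagonal_of_self_adjoint _ (by
      ext j
      simp)
  exact Matrix.isHermitian_mul_mul_conjTranspose U hD

theorem hs_diagz {n : ℕ} (A : Matrix (Fin n) (Fin n) ℂ) (hA : A.IsHermitian) (w : Fin n → ℝ)
    (h : A.charpoly = ∏ i, (Polynomial.X - Polynomial.C ((w i : ℂ)))) :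
    ∃ U ∈ unitaryGroup (Fin n) ℂ, A = U * diagonal (fun j => (w j : ℂ)) * Uᴴ := by
  have hD : (diagonal (fun j => (w j : ℂ))).IsHermitian :=
    Matrix.isHermitian_diagonal_of_self_adjoint _ (by
      ext j
      simp)
  have he : hA.eigenvalues = hD.eigenvalues := by
    rw [Matrix.IsHermitian.eigenvalues_eq_eigenvalues_iff, h, Matrix.charpoly_diagonal]
  have h1 := hA.spectral_theorem
  have h2 := hD.spectral_theorem
  rw [← he] at h2
  rw [Unitary.conjStarAlgAut_apply] at h1 h2
  generalize diagonal ((RCLike.ofReal : ℝ → ℂ) ∘ hA.eigenvalues) = E at h1 h2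
  generalize hA.eigenvectorUnitary = VV at h1
  generalize hD.eigenvectorUnitary = VV' at h2
  obtain ⟨V, hV⟩ := VV
  obtain ⟨V', hV'⟩ := VV'
  have h3 : V'ᴴ * V' = 1 := (mem_unitaryGroup_iff').1 hV'
  refine ⟨V * star V', mul_mem hV (Unitary.star_mem hV'), ?_⟩
  rw [h1, h2]
  simp only [Matrix.star_eq_conjTranspose, Matrix.conjTranspose_mul,
    Matrix.conjTranspose_conjTranspose]
  calc V * E * Vᴴ = V * ((V'ᴴ * V') * E * (V'ᴴ * V')) * Vᴴ := by
        rw [h3, one_mul, mul_one]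
    _ = _ := by simp only [mul_assoc]

theorem hs_rev {n : ℕ} (U : Matrix (Fin n) (Fin n) ℂ) (hU : U ∈ unitaryGroup (Fin n) ℂ)
    (w : Fin n → ℝ) : ∃ U' ∈ unitaryGroup (Fin n) ℂ,
      U' * diagonal (fun j => ((-w (Fin.rev j) : ℝ) : ℂ)) * U'ᴴ =
        -(U * diagonal (fun j => (w j : ℂ)) * Uᴴ) := by
  have h1 : Uᴴ * U = 1 := (mem_unitaryGroup_iff').1 hU
  refine ⟨U.submatrix id Fin.rev, ?_, ?_⟩
  · rw [mem_unitaryGroup_iff']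
    have : star (U.submatrix id Fin.rev) * U.submatrix id Fin.rev =
        (Uᴴ * U).submatrix Fin.rev Fin.rev := by
      ext a b
      simp [Matrix.mul_apply, Matrix.star_apply]
    rw [this, h1, Matrix.submatrix_one _ Fin.rev_injective]
  · ext a b
    rw [Matrix.neg_apply, Matrix.mul_apply, Matrix.mul_apply, ← Finset.sum_neg_distrib]
    refine Fintype.sum_equiv Fin.revPerm _ _ fun j => ?_
    rw [Matrix.mul_diagonal, Matrix.mul_diagonal]
    simp

/-- the triple of weights -/
def hsW {n : ℕ} (lam mu ν : Fin n → ℝ) : Fin 3 → Fin n → ℝ := ![lam, mu, fun j => -ν (Fin.rev j)]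

theorem hs_fwd {n : ℕ} (lam mu ν : Fin n → ℝ) (A B : Matrix (Fin n) (Fin n) ℂ)
    (hA : A.IsHermitian) (hB : B.IsHermitian) (h1 : HasOrdSpecC A lam) (h2 : HasOrdSpecC B mu)
    (h3 : HasOrdSpecC (A + B) ν) : ∃ U : Fin 3 → Matrix (Fin n) (Fin n) ℂ,
      (∀ k, U k ∈ unitaryGroup (Fin n) ℂ) ∧
      ∑ k, U k * diagonal (fun j => (hsW lam mu ν k j : ℂ)) * (U k)ᴴ = 0 := by
  obtain ⟨U0, hU0, e0⟩ := hs_diagz A hA lam h1.2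
  obtain ⟨U1, hU1, e1⟩ := hs_diagz B hB mu h2.2
  obtain ⟨V, hV, e2⟩ := hs_diagz (A + B) (hA.add hB) ν h3.2
  obtain ⟨U2, hU2, e3⟩ := hs_rev V hV ν
  refine ⟨![U0, U1, U2], ?_, ?_⟩
  · intro k
    fin_cases k
    · exact hU0
    · exact hU1
    · exact hU2
  · rw [Fin.sum_univ_three]
    show U0 * diagonal (fun j => (lam j : ℂ)) * U0ᴴ + U1 * diagonal (fun j => (mu j : ℂ)) * U1ᴴ +
      U2 * diagonal (fun j => ((-ν (Fin.rev j) : ℝ) : ℂ)) * U2ᴴ = 0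
    rw [e3, ← e2, ← e0, ← e1, add_neg_cancel]

theorem hs_bwd {n : ℕ} (lam mu ν : Fin n → ℝ) (hlam : Antitone lam) (hmu : Antitone mu)
    (hν : Antitone ν) (U : Fin 3 → Matrix (Fin n) (Fin n) ℂ)
    (hU : ∀ k, U k ∈ unitaryGroup (Fin n) ℂ)
    (hs : ∑ k, U k * diagonal (fun j => (hsW lam mu ν k j : ℂ)) * (U k)ᴴ = 0) :
    ∃ A B : Matrix (Fin n) (Fin n) ℂ, A.IsHermitian ∧ B.IsHermitian ∧
      HasOrdSpecC A lam ∧ HasOrdSpecC B mu ∧ HasOrdSpecC (A + B) ν := by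
  obtain ⟨V, hV, e⟩ := hs_rev (U 2) (hU 2) (hsW lam mu ν 2)
  have e' : (fun j => ((-hsW lam mu ν 2 (Fin.rev j) : ℝ) : ℂ)) = fun j => (ν j : ℂ) := by
    ext j
    simp [hsW]
  rw [e'] at e
  rw [Fin.sum_univ_three] at hs
  refine ⟨U 0 * diagonal (fun j => (lam j : ℂ)) * (U 0)ᴴ,
    U 1 * diagonal (fun j => (mu j : ℂ)) * (U 1)ᴴ, hs_herm_conj _ _, hs_herm_conj _ _,
    ⟨hlam, hs_charpoly_conj _ (hU 0) _⟩, ⟨hmu, hs_charpoly_conj _ (hU 1) _⟩, hν, ?_⟩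
  rw [← hs_charpoly_conj V hV, e]
  congr 1
  exact eq_neg_of_add_eq_zero_left hs

theorem hs_trace_sum {n : ℕ} (w : Fin 3 → Fin n → ℝ) (U : Fin 3 → Matrix (Fin n) (Fin n) ℂ)
    (hU : ∀ k, U k ∈ unitaryGroup (Fin n) ℂ)
    (hs : ∑ k, U k * diagonal (fun j => (w k j : ℂ)) * (U k)ᴴ = 0) : ∑ k, ∑ j, w k j = 0 := by
  have h := congrArg Matrix.trace hs
  rw [Matrix.trace_sum, Matrix.trace_zero] at h
  have h2 : ∀ k, (U k * diagonal (fun j => (w k j : ℂ)) * (U k)ᴴ).trace = ∑ j, (w k j : ℂ) := by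
    intro k
    rw [Matrix.trace_mul_comm, ← mul_assoc,
      show (U k)ᴴ * U k = 1 from (mem_unitaryGroup_iff').1 (hU k), one_mul, Matrix.trace_diagonal]
  simp only [h2] at h
  exact_mod_cast h

theorem hsW_anti {n : ℕ} (lam mu ν : Fin n → ℝ) (hlam : Antitone lam) (hmu : Antitone mu)
    (hν : Antitone ν) (k : Fin 3) : Antitone (hsW lam mu ν k) := by
  fin_cases k
  · exact hlam
  · exact hmu
  · intro i j hij
    exact neg_le_neg (hν (Fin.rev_le_rev.2 hij))

theorem hsS_comb {n : ℕ} (w1 w2 : Fin n → ℝ) (a b : ℝ) (W : Submodule ℂ (Fin n → ℂ)) :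
    hsS (fun j => a * w1 j + b * w2 j) W = a * hsS w1 W + b * hsS w2 W := by
  simp only [hsS, Finset.mul_sum, ← Finset.sum_add_distrib]
  refine Finset.sum_congr rfl fun j _ => ?_
  ring

/-- Kirwan; the Horn polytope is convex.  For weakly decreasing
`λ, μ ∈ ℝ^n`, the set of ordered spectra of `A + B`, where `A, B` range over complex
Hermitian `n×n` matrices with ordered spectra `λ, μ`, is a convex subset of `ℝ^n`. -/
theorem convex_horn_set (n : ℕ) (lam mu : Fin n → ℝ)
    (hlam : Antitone lam) (hmu : Antitone mu) :
    Convex ℝ {ν : Fin n → ℝ | ∃ A B : Matrix (Fin n) (Fin n) ℂ,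
      A.IsHermitian ∧ B.IsHermitian ∧
      HasOrdSpecC A lam ∧ HasOrdSpecC B mu ∧ HasOrdSpecC (A + B) ν} := by
  rintro x hx y hy a b ha hb hab
  rcases Nat.eq_zero_or_pos n with hn | hn
  · subst hn
    rwa [Subsingleton.elim (a • x + b • y) x]
  obtain ⟨A1, B1, hA1, hB1, s1, s2, s3⟩ := hx
  obtain ⟨A2, B2, hA2, hB2, t1, t2, t3⟩ := hy
  obtain ⟨U1, hU1, e1⟩ := hs_fwd lam mu x A1 B1 hA1 hB1 s1 s2 s3
  obtain ⟨U2, hU2, e2⟩ := hs_fwd lam mu y A2 B2 hA2 hB2 t1 t2 t3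
  have hx := s3.1
  have hy := t3.1
  have hud : ∀ U : Matrix (Fin n) (Fin n) ℂ, U ∈ unitaryGroup (Fin n) ℂ → U.det ≠ 0 := by
    intro U hU h0
    have := hs_norm_det_unitary hU
    rw [h0] at this
    simp at this
  have hz : Antitone (a • x + b • y) := by
    intro i j hij
    have h1 := mul_le_mul_of_nonneg_left (hx hij) ha
    have h2 := mul_le_mul_of_nonneg_left (hy hij) hb
    simpa using add_le_add h1 h2
  have hW : ∀ k j, hsW lam mu (a • x + b • y) k j =
      a * hsW lam mu x k j + b * hsW lam mu y k j := by
    intro k j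
    fin_cases k
    · show lam j = a * lam j + b * lam j
      rw [← add_mul, hab, one_mul]
    · show mu j = a * mu j + b * mu j
      rw [← add_mul, hab, one_mul]
    · show -(a * x (Fin.rev j) + b * y (Fin.rev j)) = a * -x (Fin.rev j) + b * -y (Fin.rev j)
      ring
  have hW' : ∀ k, hsW lam mu (a • x + b • y) k =
      fun j => a * hsW lam mu x k j + b * hsW lam mu y k j := fun k => funext (hW k)
  have hxa := hsW_anti lam mu x hlam hmu hx
  have hya := hsW_anti lam mu y hlam hmu hy
  obtain ⟨Y, hY, ss1, ss2⟩ := hs_generic (hsW lam mu x) (hsW lam mu y) hxa hya U1 U2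
    (fun k => hud _ (hU1 k)) (fun k => hud _ (hU2 k)) (hs_ss_of_sum _ hxa U1 hU1 e1)
    (hs_ss_of_sum _ hya U2 hU2 e2)
  have hsum : ∑ k, ∑ j, hsW lam mu (a • x + b • y) k j = 0 := by
    simp only [hW, Finset.sum_add_distrib, ← Finset.mul_sum]
    rw [hs_trace_sum _ U1 hU1 e1, hs_trace_sum _ U2 hU2 e2]
    simp
  have hss : hsSS (hsW lam mu (a • x + b • y)) Y := by
    intro V
    simp only [hW', hsS_comb, Finset.sum_add_distrib, ← Finset.mul_sum]
    have h1 := mul_nonpos_of_nonneg_of_nonpos ha (ss1 V)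
    have h2 := mul_nonpos_of_nonneg_of_nonpos hb (ss2 V)
    linarith
  obtain ⟨U, hU, e⟩ := hs_solve hn _ (hsW_anti lam mu _ hlam hmu hz) Y hY hsum hss
  exact hs_bwd lam mu _ hlam hmu hz U hU e
end
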